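/- Assume Hypothesis 3.1. Let u ∈ D(V) and let ν be a finite nonnegative Borel measure on [0,T] × H. Then u(t,·) is Fréchet differentiable in x and there exist a sequence (u_n) ⊂ E_A([0,T]×H) and a constant c > 0 such that |u_n(t,x)| + |D_x u_n(t,x)| + |V₀u_n(t,x)| ≤ c(1 + |x|²) for all (t,x) ∈ [0,T] × H, and u_n → u, D_x u_n → D_x u, and V₀u_n → Vu in ν-measure as n → ∞. -/

import Mathlib

open MeasureTheory Set Filter Topology
open scoped InnerProductSpace ENNReal NNReal

attribute [local instance] Classical.propDecidable

noncomputable section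

variable (H : Type) [NormedAddCommGroup H] [InnerProductSpace ℝ H] [CompleteSpace H]
  [SecondCountableTopology H] [MeasurableSpace H] [BorelSpace H]

/-- All data of the framework: the `C₀`-semigroup `e^{tA}` with its generator `A`
(a densely defined unbounded operator), the diffusion operator `C` (symmetric, nonnegative)
with a square root `C^{1/2}`, a Hilbert basis of `H`, the time horizon `T > 0`, and the
Borel measurable drift `F` defined on a Borel set `DF ⊆ [0,T] × H`. -/
structure FPData where
  T : ℝ
  hT : 0 < T
  S : ℝ → H →L[ℝ] H
  S_zero : S 0 = 1
  S_add : ∀ s t : ℝ, 0 ≤ s → 0 ≤ t → S (s + t) = (S s).comp (S t)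
  S_cont : ∀ x : H, ContinuousOn (fun t => S t x) (Ici (0 : ℝ))
  A : H →ₗ.[ℝ] H
  A_dense : Dense (A.domain : Set H)
  A_mem_iff : ∀ x : H, x ∈ A.domain ↔
    ∃ y : H, Tendsto (fun t : ℝ => t⁻¹ • (S t x - x)) (𝓝[>] 0) (𝓝 y)
  A_gen : ∀ x : A.domain,
    Tendsto (fun t : ℝ => t⁻¹ • (S t (x : H) - (x : H))) (𝓝[>] 0) (𝓝 (A x))
  C : H →L[ℝ] H
  C_pos : C.IsPositive
  sqrtC : H →L[ℝ] H
  sqrtC_pos : sqrtC.IsPositive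
  sqrtC_sq : sqrtC.comp sqrtC = C
  ι : Type
  basis : HilbertBasis ι ℝ H
  F : ℝ × H → H
  DF : Set (ℝ × H)
  DF_meas : MeasurableSet DF
  F_meas : Measurable F

variable {H}

/-- The spatial gradient `D_x u(t,x)` of a function `u : ℝ × H → ℝ`. -/
def xGrad (u : ℝ × H → ℝ) (p : ℝ × H) : H :=
  gradient (fun z => u (p.1, z)) p.2

/-- The set `Sf` of functions is dense in `L¹([s,T] × H, μ)`. -/
def DenseRangeL1 (μ : Measure (ℝ × H)) (Sf : Set (ℝ × H → ℝ)) : Prop :=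
  ∀ f : ℝ × H → ℝ, Integrable f μ → ∀ ε > 0,
    ∃ g ∈ Sf, Integrable g μ ∧ ∫ p, |f p - g p| ∂μ < ε

namespace FPData

variable (D : FPData H)

/-- `h ∈ C¹([0,T]; D(A*))`, represented by the pair `(h, g)` with `g t = A* (h t)`. -/
def CinDAstar (h g : ℝ → H) : Prop :=
  ContDiffOn ℝ 1 h (Icc 0 D.T) ∧ ContDiffOn ℝ 1 g (Icc 0 D.T) ∧
    ∀ t ∈ Icc 0 D.T, (h t, g t) ∈ D.A.adjoint.graph

/-- Generators of `E_A([0,T] × H)`: real parts of `φ(t) e^{i⟨x, h(t)⟩}`. -/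
def EAgen : Set (ℝ × H → ℝ) :=
  {u | ∃ (φ : ℝ → ℝ) (h g : ℝ → H), ContDiffOn ℝ 1 φ (Icc 0 D.T) ∧ φ D.T = 0 ∧
    D.CinDAstar h g ∧
    (u = (fun p => φ p.1 * Real.cos ⟪p.2, h p.1⟫_ℝ) ∨
     u = (fun p => φ p.1 * Real.sin ⟪p.2, h p.1⟫_ℝ))}

/-- The space of test functions `E_A([0,T] × H) = D(L₀)`: the linear span of the generators. -/
def EA : Set (ℝ × H → ℝ) := ↑(Submodule.span ℝ D.EAgen)

/-- The trace term `Tr[C D²_x u(t,x)] = Σ_i ⟨D²_x u(t,x)(C^{1/2} e_i), C^{1/2} e_i⟩`. -/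
def traceCD2 (u : ℝ × H → ℝ) (p : ℝ × H) : ℝ :=
  ∑' i : D.ι,
    ⟪(fderiv ℝ (gradient fun z => u (p.1, z)) p.2) (D.sqrtC (D.basis i)),
      D.sqrtC (D.basis i)⟫_ℝ

/-- The Ornstein–Uhlenbeck part `V₀u = D_t u + (1/2)Tr[C D²_x u] + ⟨x, A* D_x u⟩`
of the Kolmogorov operator. -/
def Vzero (u : ℝ × H → ℝ) (p : ℝ × H) : ℝ :=
  deriv (fun r => u (r, p.2)) p.1 + (1 / 2) * D.traceCD2 u p +
    (if hk : xGrad u p ∈ D.A.adjoint.domain then ⟪p.2, D.A.adjoint ⟨xGrad u p, hk⟩⟫_ℝ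
     else 0)

/-- The Kolmogorov operator `L₀u = V₀u + ⟨F(t,x), D_x u⟩`. -/
def Lzero (u : ℝ × H → ℝ) (p : ℝ × H) : ℝ :=
  D.Vzero u p + ⟪D.F p, xGrad u p⟫_ℝ

/-- `|F(t,x)|`, with the convention `|F(t,x)| = +∞` outside `D(F)`. -/
def FnormE (p : ℝ × H) : ℝ≥0∞ := if p ∈ D.DF then (‖D.F p‖₊ : ℝ≥0∞) else ⊤

/-- Condition (1.6): `∫ (|⟨y, A*h(t)⟩| + |F(t,y)|) dμ < ∞` for all `h ∈ C¹([0,T]; D(A*))`. -/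
def DriftIntegrable (μ : Measure (ℝ × H)) : Prop :=
  ∀ h g : ℝ → H, D.CinDAstar h g →
    ∫⁻ p, ((‖⟪p.2, g p.1⟫_ℝ‖₊ : ℝ≥0∞) + D.FnormE p) ∂μ < ⊤

/-- `μ(dt,dx) = μ_t(dx) dt` on `[s,T] × H` for a measurable kernel `(μ_t)`. -/
def IsKernel (s : ℝ) (μ : Measure (ℝ × H)) (μt : ℝ → Measure H) : Prop :=
  (∀ B : Set H, MeasurableSet B → Measurable fun t => μt t B) ∧
  ∀ E : Set (ℝ × H), MeasurableSet E → μ E = ∫⁻ t in Icc s D.T, μt t {x | (t, x) ∈ E}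

/-- `μ = μ_t dt` is a solution of the Fokker–Planck equation (1.5) with initial condition
`ζ` at time `s` (membership in `M_{s,ζ}`). -/
def IsFPSol (s : ℝ) (ζ : Measure H) (μ : Measure (ℝ × H)) (μt : ℝ → Measure H) : Prop :=
  (∀ t ∈ Icc s D.T, IsProbabilityMeasure (μt t)) ∧
  D.IsKernel s μ μt ∧ D.DriftIntegrable μ ∧
  ∀ u ∈ D.EA, ∀ᵐ t ∂(volume.restrict (Icc s D.T)),
    ∫ y, u (t, y) ∂(μt t) =
      ∫ y, u (s, y) ∂ζ + ∫ r in Icc s t, (∫ y, D.Lzero u (r, y) ∂(μt r))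

/-- The set `M_{s,ζ}` of solutions of the Fokker–Planck equation. -/
def Mset (s : ℝ) (ζ : Measure H) : Set (Measure (ℝ × H)) :=
  {μ | ∃ μt : ℝ → Measure H, D.IsFPSol s ζ μ μt}

/-- Membership in `M_s^λ` (formula (4.2)): `ν = ν_t dt` is a finite nonnegative measure with
`∫ L₀ u dν ≤ 2λ ∫ u dν` for all nonnegative `u ∈ E_A`. -/
def IsSubInv (lam s : ℝ) (ν : Measure (ℝ × H)) (νt : ℝ → Measure H) : Prop :=
  (∀ t ∈ Icc s D.T, IsFiniteMeasure (νt t)) ∧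
  D.IsKernel s ν νt ∧ D.DriftIntegrable ν ∧
  ∀ u ∈ D.EA, (∀ p : ℝ × H, p.1 ∈ Icc 0 D.T → 0 ≤ u p) →
    ∫ t in Icc s D.T, (∫ y, D.Lzero u (t, y) ∂(νt t)) ≤
      2 * lam * ∫ t in Icc s D.T, (∫ y, u (t, y) ∂(νt t))

/-- The moment condition `∫_s^T ∫_H (|x|⁴ + |F(t,x)|² + |x|⁴|F(t,x)|²) ν_t(dx) dt < ∞`. -/
def moment2 (s : ℝ) (νt : ℝ → Measure H) : Prop :=
  ∫⁻ t in Icc s D.T, (∫⁻ y, (ENNReal.ofReal (‖y‖ ^ 4) + (D.FnormE (t, y)) ^ 2 +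
    ENNReal.ofReal (‖y‖ ^ 4) * (D.FnormE (t, y)) ^ 2) ∂(νt t)) < ⊤

/-- The moment condition `∫_s^T ∫_H (|x|² + |F(t,x)| + |x|²|F(t,x)|) ν_t(dx) dt < ∞`. -/
def moment1 (s : ℝ) (νt : ℝ → Measure H) : Prop :=
  ∫⁻ t in Icc s D.T, (∫⁻ y, (ENNReal.ofReal (‖y‖ ^ 2) + D.FnormE (t, y) +
    ENNReal.ofReal (‖y‖ ^ 2) * D.FnormE (t, y)) ∂(νt t)) < ⊤

/-- Hypothesis 3.1: dissipativity of `A`, trace class `Q_t = ∫_0^t e^{sA} C e^{sA*} ds`,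
and the smoothing condition `e^{tA}(H) ⊆ Q_t^{1/2}(H)` with `Λ_t := (Q_t^{1/2})^{-1} e^{tA}`
satisfying `∫_0^∞ e^{-λt} ‖Λ_t‖ dt < ∞` for `λ` large enough. -/
structure Hyp31 where
  ω : ℝ
  A_diss : ∀ x : D.A.domain, ⟪D.A x, (x : H)⟫_ℝ ≤ ω * ‖(x : H)‖ ^ 2
  Q : ℝ → H →L[ℝ] H
  Q_def : ∀ t : ℝ, 0 < t → ∀ x : H,
    Q t x = ∫ r in (0 : ℝ)..t, D.S r (D.C ((ContinuousLinearMap.adjoint (D.S r)) x))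
  Q_pos : ∀ t : ℝ, 0 < t → (Q t).IsPositive
  Q_traceClass : ∀ t : ℝ, 0 < t → Summable fun i : D.ι => ⟪Q t (D.basis i), D.basis i⟫_ℝ
  sqrtQ : ℝ → H →L[ℝ] H
  sqrtQ_pos : ∀ t : ℝ, 0 < t → (sqrtQ t).IsPositive
  sqrtQ_sq : ∀ t : ℝ, 0 < t → (sqrtQ t).comp (sqrtQ t) = Q t
  range_incl : ∀ t : ℝ, 0 < t → Set.range (D.S t) ⊆ Set.range (sqrtQ t)
  Λ : ℝ → H →L[ℝ] H
  Λ_spec : ∀ t : ℝ, 0 < t → (sqrtQ t).comp (Λ t) = D.S t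
  lam₀ : ℝ
  Λ_int : ∀ lam : ℝ, lam₀ ≤ lam →
    IntegrableOn (fun t => Real.exp (-lam * t) * ‖Λ t‖) (Ioi 0)

/-- Hypothesis 5.1: `F(t,·)` is the minimal section of an `m`-dissipative graph
`F̄(t,·)`, with `F(t,0) = 0`. -/
structure Hyp51 where
  Fbar : ℝ → H → Set H
  dom_meas : ∀ t ∈ Icc 0 D.T, MeasurableSet {x : H | (Fbar t x).Nonempty}
  K : ℝ
  K_pos : 0 < K
  diss : ∀ t ∈ Icc 0 D.T, ∀ x y u v : H, u ∈ Fbar t x → v ∈ Fbar t y →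
    ⟪u - v, x - y⟫_ℝ ≤ K * ‖x - y‖ ^ 2
  mrange : ∀ t ∈ Icc 0 D.T, ∀ lam : ℝ, K < lam → ∀ z : H,
    ∃ x : H, ∃ w ∈ Fbar t x, lam • x - w = z
  dom_eq : ∀ t ∈ Icc 0 D.T, ∀ x : H, (t, x) ∈ D.DF ↔ (Fbar t x).Nonempty
  minimal : ∀ t ∈ Icc 0 D.T, ∀ x : H, (t, x) ∈ D.DF →
    D.F (t, x) ∈ Fbar t x ∧ ∀ w ∈ Fbar t x, ‖D.F (t, x)‖ ≤ ‖w‖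
  zero_mem : ∀ t ∈ Icc 0 D.T, (t, (0 : H)) ∈ D.DF ∧ D.F (t, 0) = 0

/-- Hypothesis 3.3 for a drift `F₀ : [0,T] × H → H`: continuity, continuous space
derivative, and uniform Lipschitz continuity in the space variable. -/
def Hyp33 (F0 : ℝ × H → H) : Prop :=
  ContinuousOn F0 (Icc 0 D.T ×ˢ (univ : Set H)) ∧
  (∀ t ∈ Icc 0 D.T, ∀ x : H, DifferentiableAt ℝ (fun y => F0 (t, y)) x) ∧
  (∀ t ∈ Icc 0 D.T, Continuous fun x : H => fderiv ℝ (fun y => F0 (t, y)) x) ∧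
  ∃ K > 0, ∀ t ∈ Icc 0 D.T, ∀ x y : H, ‖F0 (t, x) - F0 (t, y)‖ ≤ K * ‖x - y‖

/-- The data of the Ornstein–Uhlenbeck semigroup: the Gaussian measures `N_{Q_t}`
(specified through their characteristic functionals). -/
structure OUData (hyp : D.Hyp31) where
  N : ℝ → Measure H
  N_prob : ∀ t : ℝ, 0 ≤ t → IsProbabilityMeasure (N t)
  N_zero : N 0 = Measure.dirac 0
  N_char : ∀ t : ℝ, 0 < t → ∀ h : H,
    ∫ x, Complex.exp ((⟪x, h⟫_ℝ : ℂ) * Complex.I) ∂(N t) =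
      Complex.exp (-((⟪hyp.Q t h, h⟫_ℝ : ℂ)) / 2)

end FPData

namespace FPData.OUData

variable {H : Type} [NormedAddCommGroup H] [InnerProductSpace ℝ H] [CompleteSpace H]
  [SecondCountableTopology H] [MeasurableSpace H] [BorelSpace H]
  {D : FPData H} {hyp : D.Hyp31}

/-- The Ornstein–Uhlenbeck semigroup `R_t φ(x) = ∫_H φ(e^{tA} x + y) N_{Q_t}(dy)`. -/
def Rop (O : D.OUData hyp) (t : ℝ) (φ : H → ℝ) (x : H) : ℝ :=
  ∫ y, φ (D.S t x + y) ∂(O.N t)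

/-- The resolvent `G̃_λ f(x) = ∫_0^∞ e^{-λt} R_t f(x) dt` of the OU semigroup. -/
def Gtilde (O : D.OUData hyp) (lam : ℝ) (f : H → ℝ) (x : H) : ℝ :=
  ∫ t in Ioi (0 : ℝ), Real.exp (-lam * t) * O.Rop t f x

/-- The resolvent `G_λ f(t,x) = ∫_t^T e^{-λ(r-t)} R_{r-t} f(r,·)(x) dr` of the
time-dependent OU operator `V`; by definition `u ∈ D(V)` iff `u = G_λ f` for some `λ` and
some `f ∈ C([0,T]; C_{u,2}(H))`, and then `Vu = λu - f`. -/
def Gop (O : D.OUData hyp) (lam : ℝ) (f : ℝ → H → ℝ) (p : ℝ × H) : ℝ :=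
  ∫ r in p.1..D.T, Real.exp (-lam * (r - p.1)) * O.Rop (r - p.1) (f r) p.2

end FPData.OUData

section Spaces

variable {H : Type} [NormedAddCommGroup H] [InnerProductSpace ℝ H] [CompleteSpace H]

/-- Membership in `C_{u,2}(H)`: `x ↦ φ(x)/(1+|x|²)` is uniformly continuous and bounded. -/
def MemCu2 (φ : H → ℝ) : Prop :=
  UniformContinuous (fun x : H => φ x / (1 + ‖x‖ ^ 2)) ∧
    ∃ M : ℝ, ∀ x : H, |φ x| ≤ M * (1 + ‖x‖ ^ 2)

/-- The norm of `C_{u,2}(H)`: `‖φ‖ = sup_x |φ(x)|/(1+|x|²)`. -/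
def cu2Norm (φ : H → ℝ) : ℝ := ⨆ x : H, |φ x| / (1 + ‖x‖ ^ 2)

/-- The sup norm `‖f‖_∞ = sup_x |f(x)|`. -/
def supNorm (f : H → ℝ) : ℝ := ⨆ x : H, |f x|

/-- Membership in `C¹_u(H)`: bounded and uniformly continuous together with the
(Fréchet) derivative. -/
def MemC1u (φ : H → ℝ) : Prop :=
  UniformContinuous φ ∧ (∃ M : ℝ, ∀ x : H, |φ x| ≤ M) ∧ Differentiable ℝ φ ∧
    UniformContinuous (gradient φ) ∧ ∃ M : ℝ, ∀ x : H, ‖gradient φ x‖ ≤ M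

/-- Membership in `C_u(H,H)`: bounded and uniformly continuous `H → H`. -/
def MemCuHH (Φ : H → H) : Prop := UniformContinuous Φ ∧ ∃ M : ℝ, ∀ x : H, ‖Φ x‖ ≤ M

end Spaces

namespace FPData

variable {H : Type} [NormedAddCommGroup H] [InnerProductSpace ℝ H] [CompleteSpace H]
  [SecondCountableTopology H] [MeasurableSpace H] [BorelSpace H] (D : FPData H)

/-- Membership in `C([0,T]; C_{u,2}(H))`. -/
def MemCT (f : ℝ → H → ℝ) : Prop :=
  (∀ t ∈ Icc 0 D.T, MemCu2 (f t)) ∧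
  ∀ t₀ ∈ Icc 0 D.T, ∀ ε > 0, ∃ δ > 0, ∀ t ∈ Icc 0 D.T, |t - t₀| < δ →
    ∀ x : H, |f t x - f t₀ x| ≤ ε * (1 + ‖x‖ ^ 2)

/-- Membership in `C([0,T]; C¹_u(H))`. -/
def MemCTC1u (f : ℝ → H → ℝ) : Prop :=
  (∀ t ∈ Icc 0 D.T, MemC1u (f t)) ∧
  ∀ t₀ ∈ Icc 0 D.T, ∀ ε > 0, ∃ δ > 0, ∀ t ∈ Icc 0 D.T, |t - t₀| < δ →
    ∀ x : H, |f t x - f t₀ x| + ‖gradient (f t) x - gradient (f t₀) x‖ ≤ ε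

/-- `D_x u ∈ C([0,T]; C_u(H,H))`. -/
def GradInCTCuHH (u : ℝ × H → ℝ) : Prop :=
  (∀ t ∈ Icc 0 D.T, MemCuHH fun x : H => xGrad u (t, x)) ∧
  ∀ t₀ ∈ Icc 0 D.T, ∀ ε > 0, ∃ δ > 0, ∀ t ∈ Icc 0 D.T, |t - t₀| < δ →
    ∀ x : H, ‖xGrad u (t, x) - xGrad u (t₀, x)‖ ≤ ε

end FPData

end


section Semigroup

set_option linter.unusedSectionVars false

namespace FPData

variable {H : Type} [NormedAddCommGroup H] [InnerProductSpace ℝ H] [CompleteSpace H]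
  [MeasurableSpace H] (D : FPData H)

theorem inner_intervalIntegral {F : ℝ → H} {a b : ℝ} (hF : IntervalIntegrable F volume a b)
    (x : H) : ⟪∫ r in a..b, F r, x⟫_ℝ = ∫ r in a..b, ⟪F r, x⟫_ℝ := by
  have := (innerSL ℝ x).intervalIntegral_comp_comm hF
  simp only [innerSL_apply_apply] at this
  rw [real_inner_comm, ← this]
  simp only [real_inner_comm]

theorem exists_norm_S_le : ∃ M : ℝ, 1 ≤ M ∧ ∀ s ∈ Icc 0 D.T, ‖D.S s‖ ≤ M := by
  have h : ∀ x, ∃ C, ∀ i : Icc (0 : ℝ) D.T, ‖D.S i x‖ ≤ C := by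
    intro x
    obtain ⟨C, hC⟩ := (isCompact_Icc (a := (0 : ℝ)) (b := D.T)).exists_bound_of_continuousOn
      ((D.S_cont x).mono Icc_subset_Ici_self)
    exact ⟨C, fun i => hC i i.2⟩
  obtain ⟨C, hC⟩ := banach_steinhaus h
  exact ⟨max 1 C, le_max_left _ _, fun s hs => (hC ⟨s, hs⟩).trans (le_max_right _ _)⟩

/-- The adjoint semigroup `e^{tA*}`. -/
noncomputable def adjS (s : ℝ) : H →L[ℝ] H := ContinuousLinearMap.adjoint (D.S s)

theorem inner_adjS (s : ℝ) (x y : H) : ⟪x, D.adjS s y⟫_ℝ = ⟪D.S s x, y⟫_ℝ :=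
  ContinuousLinearMap.adjoint_inner_right _ _ _

theorem norm_adjS (s : ℝ) : ‖D.adjS s‖ = ‖D.S s‖ :=
  LinearIsometryEquiv.norm_map ContinuousLinearMap.adjoint (D.S s)

theorem mem_adjoint_graph_iff {h g : H} :
    (h, g) ∈ D.A.adjoint.graph ↔ ∀ x : D.A.domain, ⟪D.A x, h⟫_ℝ = ⟪(x : H), g⟫_ℝ := by
  rw [LinearPMap.adjoint_graph_eq_graph_adjoint D.A_dense, Submodule.mem_adjoint_iff]
  simp only [LinearPMap.mem_graph_iff, sub_eq_zero]
  constructor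
  · intro hh x
    exact hh x (D.A x) ⟨x, rfl, rfl⟩
  · rintro hh a b ⟨x, rfl, rfl⟩
    exact hh x

theorem exists_S_mem_domain {s : ℝ} (hs : 0 ≤ s) (x : D.A.domain) :
    ∃ hx : D.S s x ∈ D.A.domain, D.A ⟨D.S s x, hx⟩ = D.S s (D.A x) := by
  have key : Tendsto (fun t : ℝ => t⁻¹ • (D.S t (D.S s x) - D.S s x)) (𝓝[>] 0)
      (𝓝 (D.S s (D.A x))) := by
    refine (((D.S s).continuous.tendsto _).comp (D.A_gen x)).congr' ?_
    filter_upwards [self_mem_nhdsWithin] with t ht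
    have ht : 0 < t := ht
    have e1 : D.S t (D.S s x) = D.S s (D.S t x) := by
      rw [← ContinuousLinearMap.comp_apply, ← D.S_add t s ht.le hs, add_comm,
        D.S_add s t hs ht.le, ContinuousLinearMap.comp_apply]
    simp [e1]
  have hx : D.S s x ∈ D.A.domain := (D.A_mem_iff _).2 ⟨_, key⟩
  exact ⟨hx, tendsto_nhds_unique (D.A_gen ⟨D.S s x, hx⟩) key⟩

theorem adjS_mem_graph {s : ℝ} (hs : 0 ≤ s) {h g : H} (hg : (h, g) ∈ D.A.adjoint.graph) :
    (D.adjS s h, D.adjS s g) ∈ D.A.adjoint.graph := by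
  rw [mem_adjoint_graph_iff] at hg ⊢
  intro x
  obtain ⟨hx, e⟩ := D.exists_S_mem_domain hs x
  rw [inner_adjS, inner_adjS, ← e, hg]

theorem hasDerivWithinAt_S {s : ℝ} (hs : 0 ≤ s) (x : D.A.domain) :
    HasDerivWithinAt (fun r => D.S r x) (D.S s (D.A x)) (Ioi s) s := by
  rw [hasDerivWithinAt_iff_tendsto_slope' (by simp)]
  have h1 : Tendsto (fun r : ℝ => r - s) (𝓝[>] s) (𝓝[>] 0) := by
    refine tendsto_nhdsWithin_iff.2 ⟨?_, ?_⟩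
    · have : Tendsto (fun r : ℝ => r - s) (𝓝 s) (𝓝 (s - s)) := (continuous_sub_right s).tendsto s
      rw [sub_self] at this
      exact this.mono_left nhdsWithin_le_nhds
    · filter_upwards [self_mem_nhdsWithin] with r hr
      exact mem_Ioi.2 (sub_pos.2 hr)
  refine ((((D.S s).continuous.tendsto _).comp (D.A_gen x)).comp h1).congr' ?_
  filter_upwards [self_mem_nhdsWithin] with r hr
  have hr : s < r := hr
  have e1 : D.S r x = D.S s (D.S (r - s) x) := by
    rw [← ContinuousLinearMap.comp_apply, ← D.S_add s (r - s) hs (sub_pos.2 hr).le]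
    simp
  simp [slope_def_module, e1]

theorem S_continuousOn (x : H) (a b : ℝ) (ha : 0 ≤ a) (hb : 0 ≤ b) :
    ContinuousOn (fun r => D.S r x) (uIcc a b) :=
  (D.S_cont x).mono fun _ hr => (le_min ha hb).trans hr.1

theorem integral_S_domain {t : ℝ} (ht : 0 ≤ t) (x : D.A.domain) :
    ∫ r in (0 : ℝ)..t, D.S r (D.A x) = D.S t x - x := by
  have h := intervalIntegral.integral_eq_sub_of_hasDeriv_right
    (f := fun r => D.S r (x : H)) (a := 0) (b := t)
    (D.S_continuousOn _ _ _ le_rfl ht)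
    (fun r hr => D.hasDerivWithinAt_S (by rw [min_eq_left ht] at hr; exact hr.1.le) x)
    ((D.S_continuousOn _ _ _ le_rfl ht).intervalIntegrable)
  rw [h, D.S_zero]; rfl

/-- The time integral `x ↦ ∫_0^t e^{rA} x dr` as a bounded operator. -/
theorem exists_intS {M t : ℝ} (hM : ∀ s ∈ Icc 0 D.T, ‖D.S s‖ ≤ M) (ht : t ∈ Icc 0 D.T) :
    ∃ B : H →L[ℝ] H, (∀ x, B x = ∫ r in (0 : ℝ)..t, D.S r x) ∧ ∀ x, ‖B x‖ ≤ M * t * ‖x‖ := by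
  have hb : ∀ x : H, ‖∫ r in (0 : ℝ)..t, D.S r x‖ ≤ M * t * ‖x‖ := by
    intro x
    have := intervalIntegral.norm_integral_le_of_norm_le_const (f := fun r => D.S r x)
      (a := 0) (b := t) (C := M * ‖x‖) (fun r hr => by
        rw [uIoc_of_le ht.1] at hr
        exact (D.S r).le_of_opNorm_le (hM r ⟨hr.1.le, hr.2.trans ht.2⟩) x)
    rw [sub_zero, abs_of_nonneg ht.1] at this
    linarith
  have hi : ∀ x : H, IntervalIntegrable (fun r => D.S r x) volume 0 t := fun x =>
    (D.S_continuousOn _ _ _ le_rfl ht.1).intervalIntegrable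
  let L : H →ₗ[ℝ] H :=
    { toFun := fun x => ∫ r in (0 : ℝ)..t, D.S r x
      map_add' := fun x y => by
        simp only [map_add]
        exact intervalIntegral.integral_add (hi x) (hi y)
      map_smul' := fun c x => by
        simp only [map_smul, RingHom.id_apply]
        exact intervalIntegral.integral_smul _ _ }
  exact ⟨L.mkContinuous (M * t) hb, fun x => rfl, hb⟩

theorem inner_S_sub {t : ℝ} (ht : t ∈ Icc 0 D.T) {h g : H}
    (hg : (h, g) ∈ D.A.adjoint.graph) (x : H) :
    ⟪D.S t x, h⟫_ℝ - ⟪x, h⟫_ℝ = ∫ r in (0 : ℝ)..t, ⟪D.S r x, g⟫_ℝ := by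
  obtain ⟨M, -, hM⟩ := D.exists_norm_S_le
  obtain ⟨B, hB, -⟩ := D.exists_intS hM ht
  have hi : ∀ x : H, IntervalIntegrable (fun r => D.S r x) volume 0 t := fun x =>
    (D.S_continuousOn _ _ _ le_rfl ht.1).intervalIntegrable
  have e : ∀ x (g : H), ∫ r in (0 : ℝ)..t, ⟪D.S r x, g⟫_ℝ = ⟪B x, g⟫_ℝ := by
    intro x g
    rw [hB, inner_intervalIntegral (hi x)]
  rw [e]
  revert x
  refine isClosed_property D.A_dense.denseRange_val (isClosed_eq (by fun_prop) (by fun_prop)) ?_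
  intro x
  have hg' := D.mem_adjoint_graph_iff.1 hg
  rw [← e, ← inner_sub_left, ← D.integral_S_domain ht.1,
    inner_intervalIntegral (hi _)]
  refine intervalIntegral.integral_congr fun r hr => ?_
  rw [uIcc_of_le ht.1] at hr
  obtain ⟨hx, e2⟩ := D.exists_S_mem_domain hr.1 x
  rw [← e2, hg']

/-- Time averages of the adjoint semigroup map into the domain of `A*`. -/
theorem exists_smoothing {ε : ℝ} (hε : ε ∈ Ioc 0 D.T) (B : H →L[ℝ] H)
    (hB : ∀ x, B x = ∫ r in (0 : ℝ)..ε, D.S r x) (h : H) :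
    ∃ g, (ContinuousLinearMap.adjoint B h, g) ∈ D.A.adjoint.graph := by
  refine ⟨D.adjS ε h - h, D.mem_adjoint_graph_iff.2 fun x => ?_⟩
  rw [ContinuousLinearMap.adjoint_inner_right, hB, D.integral_S_domain hε.1.le, inner_sub_right,
    inner_adjS, inner_sub_left]

theorem tendsto_average {εn : ℕ → ℝ} (h0 : ∀ n, εn n ∈ Ioc 0 D.T) (hlim : Tendsto εn atTop (𝓝 0))
    (x : H) :
    Tendsto (fun n => (εn n)⁻¹ • ∫ r in (0 : ℝ)..εn n, D.S r x) atTop (𝓝 x) := by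
  rw [Metric.tendsto_atTop]
  intro η hη
  have hc := D.S_cont x 0 (by simp)
  rw [Metric.continuousWithinAt_iff] at hc
  obtain ⟨δ, hδ, hc⟩ := hc (η / 2) (half_pos hη)
  obtain ⟨N, hN⟩ := Metric.tendsto_atTop.1 hlim δ hδ
  refine ⟨N, fun n hn => ?_⟩
  have hp := (h0 n).1
  have hne := hp.ne'
  have hNn := hN n hn
  rw [Real.dist_eq, sub_zero, abs_of_pos hp] at hNn
  have e : (εn n)⁻¹ • (∫ r in (0 : ℝ)..εn n, D.S r x) - x
      = (εn n)⁻¹ • ∫ r in (0 : ℝ)..εn n, (D.S r x - x) := by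
    rw [intervalIntegral.integral_sub
      (D.S_continuousOn _ _ _ le_rfl hp.le).intervalIntegrable (by simp)]
    simp [smul_sub, smul_smul, hne]
  rw [dist_eq_norm, e, norm_smul]
  have := intervalIntegral.norm_integral_le_of_norm_le_const (f := fun r => D.S r x - x)
      (a := 0) (b := εn n) (C := η / 2) (fun r hr => by
        rw [uIoc_of_le hp.le] at hr
        have := hc (show r ∈ Ici 0 from hr.1.le) (by
          rw [Real.dist_eq, sub_zero, abs_of_pos hr.1]; linarith [hr.2])
        rw [dist_eq_norm, D.S_zero] at this
        exact this.le)
  rw [sub_zero, abs_of_pos hp] at this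
  rw [Real.norm_eq_abs, abs_of_pos (inv_pos.2 hp)]
  calc _ ≤ (εn n)⁻¹ * (η / 2 * εn n) := by gcongr
    _ = η / 2 := by field_simp
    _ < η := half_lt_self hη

theorem dense_adjoint_domain : Dense {h : H | ∃ g, (h, g) ∈ D.A.adjoint.graph} := by
  obtain ⟨M, -, hM⟩ := D.exists_norm_S_le
  let K : Submodule ℝ H := D.A.adjoint.graph.map (LinearMap.fst ℝ H H)
  have hK : (K : Set H) = {h : H | ∃ g, (h, g) ∈ D.A.adjoint.graph} := by
    ext h
    simp only [K, Submodule.map_coe, Set.mem_image, SetLike.mem_coe, LinearMap.fst_apply,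
      Prod.exists, exists_and_right, exists_eq_right, Set.mem_ofPred_eq]
  rw [← hK, Submodule.dense_iff_topologicalClosure_eq_top,
    Submodule.topologicalClosure_eq_top_iff, Submodule.eq_bot_iff]
  intro x hx
  rw [Submodule.mem_orthogonal] at hx
  have h0 : ∀ n : ℕ, D.T / (n + 1) ∈ Ioc 0 D.T := fun n =>
    ⟨div_pos D.hT (by positivity), div_le_self D.hT.le (by simp)⟩
  have hl : Tendsto (fun n : ℕ => D.T / ((n : ℝ) + 1)) atTop (𝓝 0) :=
    tendsto_const_div_atTop_nhds_zero_nat D.T |>.comp (tendsto_add_atTop_nat 1) |>.congr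
      fun n => by simp
  have ht := D.tendsto_average h0 hl x
  refine tendsto_nhds_unique ht (tendsto_const_nhds.congr fun n => ?_)
  obtain ⟨B, hB, -⟩ := D.exists_intS hM ⟨(h0 n).1.le, (h0 n).2⟩
  have : ⟪B x, B x⟫_ℝ = 0 := by
    rw [← ContinuousLinearMap.adjoint_inner_left]
    obtain ⟨g, hg⟩ := D.exists_smoothing (h0 n) B hB (B x)
    exact hx _ (by rw [← SetLike.mem_coe, hK]; exact ⟨g, hg⟩)
  rw [← hB, inner_self_eq_zero.1 this, smul_zero]

theorem adjS_lipschitz {M : ℝ} (hM : ∀ s ∈ Icc 0 D.T, ‖D.S s‖ ≤ M) {h g : H}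
    (hg : (h, g) ∈ D.A.adjoint.graph) {s t : ℝ} (hs : s ∈ Icc 0 D.T) (ht : t ∈ Icc 0 D.T) :
    ‖D.adjS t h - D.adjS s h‖ ≤ M * ‖g‖ * |t - s| := by
  set y := D.adjS t h - D.adjS s h with hy
  have hM0 : 0 ≤ M := (norm_nonneg _).trans (hM s hs)
  have hi : ∀ t ∈ Icc 0 D.T, IntervalIntegrable (fun r => ⟪D.S r y, g⟫_ℝ) volume 0 t := fun t ht =>
    ((D.S_continuousOn y _ _ le_rfl ht.1).inner continuousOn_const).intervalIntegrable
  have e : ⟪y, y⟫_ℝ = ∫ r in s..t, ⟪D.S r y, g⟫_ℝ := by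
    rw [← intervalIntegral.integral_interval_sub_left (hi t ht) (hi s hs),
      ← D.inner_S_sub ht hg, ← D.inner_S_sub hs hg]
    conv_lhs => rw [hy, inner_sub_right, ← hy, inner_adjS, inner_adjS]
    ring
  have hb := intervalIntegral.norm_integral_le_of_norm_le_const
      (f := fun r => ⟪D.S r y, g⟫_ℝ) (a := s) (b := t) (C := M * ‖y‖ * ‖g‖) (fun r hr => by
        have hr' : r ∈ Icc 0 D.T := by
          have := uIoc_subset_uIcc hr
          exact (uIcc_subset_Icc hs ht) this
        exact (norm_inner_le_norm _ _).trans (by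
          gcongr; exact (D.S r).le_of_opNorm_le (hM r hr') y))
  rw [← e, Real.norm_eq_abs, real_inner_self_eq_norm_sq, abs_of_nonneg (sq_nonneg _)] at hb
  rcases (norm_nonneg y).eq_or_lt with h0 | h0
  · rw [← h0]; positivity
  · refine le_of_mul_le_mul_left ?_ h0
    nlinarith

theorem adjS_continuousOn (k : H) : ContinuousOn (fun s => D.adjS s k) (Icc 0 D.T) := by
  obtain ⟨M, hM1, hM⟩ := D.exists_norm_S_le
  refine continuousOn_of_uniform_approx_of_continuousOn fun u hu => ?_
  obtain ⟨ε, hε, hu⟩ := Metric.mem_uniformity_dist.1 hu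
  obtain ⟨h, hh, g, hg⟩ := Metric.dense_iff.1 D.dense_adjoint_domain k (ε / (M + 1)) (div_pos hε (by linarith))
  refine ⟨fun s => D.adjS s h, ?_, fun s hs => hu ?_⟩
  · have : LipschitzOnWith (Real.toNNReal (M * ‖g‖)) (fun s => D.adjS s h) (Icc 0 D.T) :=
      LipschitzOnWith.of_dist_le_mul fun t ht s hs => by
        rw [dist_eq_norm, Real.dist_eq, Real.coe_toNNReal _ (by positivity)]
        exact D.adjS_lipschitz hM hg hs ht
    exact this.continuousOn
  · rw [dist_eq_norm, ← map_sub]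
    rw [Metric.mem_ball, dist_comm, dist_eq_norm] at hh
    have hpos : 0 < M + 1 := by linarith
    calc _ ≤ M * ‖k - h‖ := (D.adjS s).le_of_opNorm_le ((D.norm_adjS s).trans_le (hM s hs)) _
      _ ≤ (M + 1) * ‖k - h‖ := by gcongr; linarith
      _ < (M + 1) * (ε / (M + 1)) := by gcongr
      _ = ε := by field_simp

end FPData

end Semigroup

section Gaussian

set_option linter.unusedSectionVars false

variable {H : Type} [NormedAddCommGroup H] [InnerProductSpace ℝ H]
  [SecondCountableTopology H] [MeasurableSpace H] [BorelSpace H]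
  {μ : Measure H} [IsProbabilityMeasure μ] {Q : H →L[ℝ] H}

/-- The characteristic functional of `μ` is that of the centered Gaussian measure with
covariance `Q`. -/
def HasGaussianCharFun (μ : Measure H) (Q : H →L[ℝ] H) : Prop :=
  ∀ h : H, ∫ x, Complex.exp ((⟪x, h⟫_ℝ : ℂ) * Complex.I) ∂μ =
      Complex.exp (-((⟪Q h, h⟫_ℝ : ℂ)) / 2)

namespace HasGaussianCharFun

theorem integral_cos (hμ : HasGaussianCharFun μ Q) (h : H) (θ : ℝ) :
    ∫ y, Real.cos (⟪y, h⟫_ℝ + θ) ∂μ = Real.exp (-⟪Q h, h⟫_ℝ / 2) * Real.cos θ := by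
  have e : ∀ y : H, Real.cos (⟪y, h⟫_ℝ + θ) =
      Complex.reCLM (Complex.exp ((⟪y, h⟫_ℝ : ℂ) * Complex.I) * Complex.exp (θ * Complex.I)) := by
    intro y
    rw [← Complex.exp_add, ← add_mul, Complex.reCLM_apply, ← Complex.ofReal_add,
      Complex.exp_ofReal_mul_I_re]
  have hi : Integrable (fun y : H => Complex.exp ((⟪y, h⟫_ℝ : ℂ) * Complex.I) *
      Complex.exp (θ * Complex.I)) μ := by
    refine (Integrable.of_bound (C := 1) (by fun_prop) ?_).mul_const _
    exact Eventually.of_forall fun y => (Complex.norm_exp_ofReal_mul_I _).le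
  simp_rw [e]
  rw [ContinuousLinearMap.integral_comp_comm _ hi, integral_mul_const, hμ h, Complex.reCLM_apply]
  have : Complex.exp (-((⟪Q h, h⟫_ℝ : ℂ)) / 2) = ((Real.exp (-⟪Q h, h⟫_ℝ / 2) : ℝ) : ℂ) := by
    push_cast; rfl
  rw [this, Complex.re_ofReal_mul, Complex.exp_ofReal_mul_I_re]

theorem map_inner (hμ : HasGaussianCharFun μ Q) (hQ : Q.IsPositive) (h : H) :
    μ.map (fun y => ⟪y, h⟫_ℝ) = ProbabilityTheory.gaussianReal 0 (⟪Q h, h⟫_ℝ).toNNReal := by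
  have hm : AEMeasurable (fun y : H => ⟪y, h⟫_ℝ) μ := by fun_prop
  have := Measure.isProbabilityMeasure_map hm
  refine Measure.ext_of_charFun ?_
  ext t
  have hq : 0 ≤ ⟪Q h, h⟫_ℝ := hQ.re_inner_nonneg_left h
  rw [charFun_apply_real, integral_map hm (by fun_prop), ProbabilityTheory.charFun_gaussianReal]
  have := hμ (t • h)
  simp only [inner_smul_right, map_smul, inner_smul_left, Complex.ofReal_mul] at this
  rw [this]
  congr 1
  simp only [Complex.ofReal_zero, mul_zero, zero_mul, zero_sub]
  rw [show ((⟪Q h, h⟫_ℝ).toNNReal : ℂ) = ((⟪Q h, h⟫_ℝ : ℝ) : ℂ) by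
    rw [← Real.coe_toNNReal _ hq]; simp]
  simp
  ring

theorem memLp_inner (hμ : HasGaussianCharFun μ Q) (hQ : Q.IsPositive) (h : H) :
    MemLp (fun y => ⟪y, h⟫_ℝ) 2 μ := by
  have hm : AEMeasurable (fun y : H => ⟪y, h⟫_ℝ) μ := by fun_prop
  have := ProbabilityTheory.memLp_id_gaussianReal (μ := 0) (v := (⟪Q h, h⟫_ℝ).toNNReal) 2
  rw [← hμ.map_inner hQ h] at this
  exact this.comp_of_map hm

theorem integral_inner_sq (hμ : HasGaussianCharFun μ Q) (hQ : Q.IsPositive) (h : H) :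
    ∫ y, ⟪y, h⟫_ℝ ^ 2 ∂μ = ⟪Q h, h⟫_ℝ := by
  have hm : AEMeasurable (fun y : H => ⟪y, h⟫_ℝ) μ := by fun_prop
  have hq : 0 ≤ ⟪Q h, h⟫_ℝ := hQ.re_inner_nonneg_left h
  have e := ProbabilityTheory.variance_fun_id_gaussianReal
    (μ := 0) (v := (⟪Q h, h⟫_ℝ).toNNReal)
  rw [ProbabilityTheory.variance_of_integral_eq_zero (by fun_prop)
    ProbabilityTheory.integral_id_gaussianReal, ← hμ.map_inner hQ h,
    integral_map hm (by fun_prop), Real.coe_toNNReal _ hq] at e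
  exact e

theorem eLpNorm_inner_sq (hμ : HasGaussianCharFun μ Q) (hQ : Q.IsPositive) (h : H) :
    eLpNorm (fun y => ⟪y, h⟫_ℝ ^ 2) 2 μ = ENNReal.ofReal ⟪Q h, h⟫_ℝ *
      eLpNorm (fun x : ℝ => x ^ 2) 2 (ProbabilityTheory.gaussianReal 0 1) := by
  have hm : AEMeasurable (fun y : H => ⟪y, h⟫_ℝ) μ := by fun_prop
  have hq : 0 ≤ ⟪Q h, h⟫_ℝ := hQ.re_inner_nonneg_left h
  have e1 : eLpNorm (fun y => ⟪y, h⟫_ℝ ^ 2) 2 μ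
      = eLpNorm (fun x : ℝ => x ^ 2) 2 (μ.map (fun y => ⟪y, h⟫_ℝ)) := by
    rw [eLpNorm_map_measure (by fun_prop) hm]; rfl
  have e2 := ProbabilityTheory.gaussianReal_map_const_mul (μ := 0) (v := 1) (√⟪Q h, h⟫_ℝ)
  have e3 : NNReal.mk (√⟪Q h, h⟫_ℝ ^ 2) (sq_nonneg _) * 1 = (⟪Q h, h⟫_ℝ).toNNReal := by
    ext; simp [Real.sq_sqrt hq, hq]
  rw [mul_zero, e3] at e2
  rw [e1, hμ.map_inner hQ, ← e2, eLpNorm_map_measure (by fun_prop) (by fun_prop)]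
  have e4 : ((fun x : ℝ => x ^ 2) ∘ fun x => √⟪Q h, h⟫_ℝ * x) = ⟪Q h, h⟫_ℝ • fun x : ℝ => x ^ 2 := by
    ext x; simp [mul_pow, Real.sq_sqrt hq]
  rw [e4, eLpNorm_const_smul, Real.enorm_of_nonneg hq]

theorem integral_inner_mul_cos (hμ : HasGaussianCharFun μ Q) (hQ : Q.IsPositive) (h w : H) (θ : ℝ) :
    ∫ y, ⟪y, w⟫_ℝ * Real.cos (⟪y, h⟫_ℝ + θ) ∂μ =
      - (⟪Q h, w⟫_ℝ * (Real.exp (-⟪Q h, h⟫_ℝ / 2) * Real.sin θ)) := by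
  have hsin : ∀ τ : ℝ, ∫ y, Real.sin (⟪y, h + τ • w⟫_ℝ + θ) ∂μ =
      Real.exp (-⟪Q (h + τ • w), h + τ • w⟫_ℝ / 2) * Real.sin θ := by
    intro τ
    have := hμ.integral_cos (h + τ • w) (θ - Real.pi / 2)
    rw [Real.cos_sub_pi_div_two] at this
    rw [← this]
    refine integral_congr_ae (Eventually.of_forall fun y => ?_)
    simp only
    rw [← add_sub_assoc, Real.cos_sub_pi_div_two]
  have h1 : HasDerivAt (fun τ : ℝ => ∫ y, Real.sin (⟪y, h + τ • w⟫_ℝ + θ) ∂μ)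
      (∫ y, ⟪y, w⟫_ℝ * Real.cos (⟪y, h + (0 : ℝ) • w⟫_ℝ + θ) ∂μ) 0 := by
    refine (hasDerivAt_integral_of_dominated_loc_of_deriv_le (bound := fun y => |⟪y, w⟫_ℝ|)
      (F' := fun τ y => ⟪y, w⟫_ℝ * Real.cos (⟪y, h + τ • w⟫_ℝ + θ))
      (Metric.ball_mem_nhds (0 : ℝ) one_pos) ?_ ?_ ?_ ?_ ?_ ?_).2
    · exact Eventually.of_forall fun τ => by fun_prop
    · refine Integrable.of_bound (C := 1) (by fun_prop) ?_
      exact Eventually.of_forall fun y => by simpa using Real.abs_sin_le_one _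
    · fun_prop
    · refine Eventually.of_forall fun y τ _ => ?_
      rw [norm_mul, Real.norm_eq_abs, Real.norm_eq_abs]
      exact mul_le_of_le_one_right (abs_nonneg _) (Real.abs_cos_le_one _)
    · exact ((hμ.memLp_inner hQ w).integrable (by norm_num)).abs
    · refine Eventually.of_forall fun y τ _ => ?_
      have : HasDerivAt (fun τ : ℝ => ⟪y, h + τ • w⟫_ℝ + θ) ⟪y, w⟫_ℝ τ := by
        simp only [inner_add_right, inner_smul_right]
        simpa using (((hasDerivAt_id τ).mul_const ⟪y, w⟫_ℝ).const_add ⟪y, h⟫_ℝ).add_const θ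
      simpa [mul_comm] using this.sin
  have h2 : HasDerivAt (fun τ : ℝ => ∫ y, Real.sin (⟪y, h + τ • w⟫_ℝ + θ) ∂μ)
      (- (⟪Q h, w⟫_ℝ * (Real.exp (-⟪Q h, h⟫_ℝ / 2) * Real.sin θ))) 0 := by
    simp_rw [hsin]
    have e : ∀ τ : ℝ, -⟪Q (h + τ • w), h + τ • w⟫_ℝ / 2 =
        -(⟪Q h, h⟫_ℝ + 2 * τ * ⟪Q h, w⟫_ℝ + τ ^ 2 * ⟪Q w, w⟫_ℝ) / 2 := by
      intro τ
      have : ⟪Q w, h⟫_ℝ = ⟪Q h, w⟫_ℝ := by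
        rw [← real_inner_comm]; exact (hQ.isSymmetric h w).symm
      simp only [map_add, map_smul, inner_add_left, inner_add_right, inner_smul_left,
        inner_smul_right, this]
      simp; ring
    simp_rw [e]
    have hd : HasDerivAt (fun τ : ℝ =>
        -(⟪Q h, h⟫_ℝ + 2 * τ * ⟪Q h, w⟫_ℝ + τ ^ 2 * ⟪Q w, w⟫_ℝ) / 2) (-⟪Q h, w⟫_ℝ) 0 := by
      have a1 := ((hasDerivAt_id (0 : ℝ)).const_mul 2).mul_const ⟪Q h, w⟫_ℝ
      have a2 := ((hasDerivAt_id (0 : ℝ)).pow 2).mul_const ⟪Q w, w⟫_ℝ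
      have := (((a1.const_add ⟪Q h, h⟫_ℝ).add a2).neg).div_const 2
      refine (this.congr_deriv ?_).congr_of_eventuallyEq (Eventually.of_forall fun τ => ?_)
      · simp
        ring
      · simp
    have := hd.exp.mul_const (Real.sin θ)
    refine this.congr_deriv ?_
    simp; ring
  have := h1.unique h2
  simpa using this

theorem norm_sqrt_le (hμ : HasGaussianCharFun μ Q) (hQ : Q.IsPositive) {R : H →L[ℝ] H}
    (hR : R.IsPositive) (hRQ : R.comp R = Q) {J : Type*} [Fintype J] (b θ : J → ℝ) (h : J → H) :
    ‖R (∑ j, (b j * (Real.exp (-⟪Q (h j), h j⟫_ℝ / 2) * Real.sin (θ j))) • h j)‖ ≤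
      √(∫ y, (∑ j, b j * Real.cos (⟪y, h j⟫_ℝ + θ j)) ^ 2 ∂μ) := by
  set ξ := ∑ j, (b j * (Real.exp (-⟪Q (h j), h j⟫_ℝ / 2) * Real.sin (θ j))) • h j with hξ
  set φ : H → ℝ := fun y => ∑ j, b j * Real.cos (⟪y, h j⟫_ℝ + θ j) with hφ
  have hφ2 : MemLp φ 2 μ := by
    refine MemLp.of_bound (C := ∑ j, |b j|) (by fun_prop) (Eventually.of_forall fun y => ?_)
    refine (norm_sum_le _ _).trans (Finset.sum_le_sum fun j _ => ?_)
    rw [norm_mul, Real.norm_eq_abs, Real.norm_eq_abs]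
    exact mul_le_of_le_one_right (abs_nonneg _) (Real.abs_cos_le_one _)
  have hw := hμ.memLp_inner hQ ξ
  have hQξ : ⟪Q ξ, ξ⟫_ℝ = ‖R ξ‖ ^ 2 := by
    rw [← hRQ, ContinuousLinearMap.comp_apply, ← real_inner_self_eq_norm_sq]
    exact hR.isSymmetric _ _
  have e1 : ⟪Q ξ, ξ⟫_ℝ = - ∫ y, ⟪y, ξ⟫_ℝ * φ y ∂μ := by
    have : ∀ y, ⟪y, ξ⟫_ℝ * φ y = ∑ j, b j * (⟪y, ξ⟫_ℝ * Real.cos (⟪y, h j⟫_ℝ + θ j)) := by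
      intro y
      rw [hφ, Finset.mul_sum]
      exact Finset.sum_congr rfl fun j _ => by ring
    simp_rw [this]
    rw [integral_finsetSum]
    · simp_rw [integral_const_mul, hμ.integral_inner_mul_cos hQ]
      conv_lhs => rw [hξ, map_sum, sum_inner]
      rw [← Finset.sum_neg_distrib]
      refine Finset.sum_congr rfl fun j _ => ?_
      rw [map_smul, inner_smul_left]
      simp; ring
    · intro j _
      refine Integrable.const_mul ?_ _
      refine (hw.integrable (by norm_num)).mul_bdd (c := 1) (by fun_prop) ?_
      exact Eventually.of_forall fun y => by simpa using Real.abs_cos_le_one _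
  have e2 : ‖R ξ‖ ^ 2 ≤ ‖R ξ‖ * √(∫ y, φ y ^ 2 ∂μ) := by
    rw [← hQξ, e1]
    refine (neg_le_abs _).trans ?_
    have hcs := integral_mul_norm_le_Lp_mul_Lq (μ := μ) (f := fun y => ⟪y, ξ⟫_ℝ) (g := φ)
      (p := 2) (q := 2) Real.HolderConjugate.two_two (by simpa using hw) (by simpa using hφ2)
    refine (norm_integral_le_integral_norm (μ := μ) (fun y => ⟪y, ξ⟫_ℝ * φ y)).trans ?_
    simp only [norm_mul]
    refine hcs.trans (le_of_eq ?_)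
    have hq := hμ.integral_inner_sq hQ ξ
    simp only [Real.norm_eq_abs, Real.rpow_ofNat, sq_abs, ← Real.sqrt_eq_rpow]
    rw [hq, hQξ, Real.sqrt_sq (norm_nonneg _)]
  rcases (norm_nonneg (R ξ)).eq_or_lt with h0 | h0
  · rw [← h0]; positivity
  · exact le_of_mul_le_mul_left (by rw [← sq]; exact e2) h0

end HasGaussianCharFun

/-- The index set of a Hilbert basis of a separable space is countable. -/
theorem HilbertBasis.countable_index {ι : Type*} (e : HilbertBasis ι ℝ H) : Countable ι := by
  have hd : (univ : Set ι).PairwiseDisjoint fun i => Metric.ball (e i) (1 / 2) := by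
    intro i _ j _ hij
    refine Metric.ball_disjoint_ball ?_
    have h := e.orthonormal
    have h2 : dist (e i) (e j) ^ 2 = 2 := by
      rw [dist_eq_norm, norm_sub_sq_real, h.1 i, h.1 j, h.2 hij]; norm_num
    nlinarith [dist_nonneg (x := e i) (y := e j)]
  exact countable_univ_iff.1 (hd.countable_of_isOpen (fun i _ => Metric.isOpen_ball)
    fun i _ => ⟨e i, Metric.mem_ball_self (by norm_num)⟩)

theorem HasGaussianCharFun.eLpNorm_norm_sq_le (hμ : HasGaussianCharFun μ Q) (hQ : Q.IsPositive)
    {ι : Type*} (e : HilbertBasis ι ℝ H) (hs : Summable fun i => ⟪Q (e i), e i⟫_ℝ) :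
    eLpNorm (fun y : H => ‖y‖ ^ 2) 2 μ ≤ ENNReal.ofReal (∑' i, ⟪Q (e i), e i⟫_ℝ) *
      eLpNorm (fun x : ℝ => x ^ 2) 2 (ProbabilityTheory.gaussianReal 0 1) := by
  have := e.countable_index
  obtain ⟨F, hF⟩ := exists_seq_tendsto (atTop : Filter (Finset ι))
  have hlim : ∀ y : H, Tendsto (fun n => ∑ i ∈ F n, ⟪y, e i⟫_ℝ ^ 2) atTop (𝓝 (‖y‖ ^ 2)) := by
    intro y
    have := e.hasSum_inner_mul_inner y y
    rw [real_inner_self_eq_norm_sq] at this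
    refine (this.comp hF).congr fun n => Finset.sum_congr rfl fun i _ => ?_
    rw [real_inner_comm, sq]; simp [real_inner_comm]
  refine (Lp.eLpNorm_lim_le_liminf_eLpNorm (fun n => by fun_prop) _
    (Eventually.of_forall hlim)).trans ?_
  refine (liminf_le_liminf (v := fun _ => _) (Eventually.of_forall fun n => ?_)).trans_eq
    (liminf_const _)
  have := eLpNorm_sum_le (μ := μ) (p := 2) (s := F n) (f := fun i y => ⟪y, e i⟫_ℝ ^ 2)
    (fun i _ => by fun_prop) (by norm_num)
  have e1 : (fun y : H => ∑ i ∈ F n, ⟪y, e i⟫_ℝ ^ 2) =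
      ∑ i ∈ F n, fun y => ⟪y, e i⟫_ℝ ^ 2 := by ext; simp
  rw [e1]
  refine this.trans ?_
  simp_rw [hμ.eLpNorm_inner_sq hQ, ← Finset.sum_mul]
  gcongr
  have hnn : ∀ i, 0 ≤ ⟪Q (e i), e i⟫_ℝ := fun i => hQ.re_inner_nonneg_left _
  rw [← ENNReal.ofReal_sum_of_nonneg fun i _ => hnn i]
  exact ENNReal.ofReal_le_ofReal (hs.sum_le_tsum _ fun i _ => hnn i)

end Gaussian

section OrnsteinUhlenbeck

set_option linter.unusedSectionVars false

namespace FPData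

variable {H : Type} [NormedAddCommGroup H] [InnerProductSpace ℝ H] [CompleteSpace H]
  [SecondCountableTopology H] [MeasurableSpace H] [BorelSpace H] (D : FPData H)

theorem continuousOn_S_apply {w : ℝ → H} (hw : ContinuousOn w (Icc 0 D.T)) :
    ContinuousOn (fun r => D.S r (w r)) (Icc 0 D.T) := by
  obtain ⟨M, hM1, hM⟩ := D.exists_norm_S_le
  intro r₀ hr₀
  have h1 : Tendsto (fun r => D.S r (w r - w r₀)) (𝓝[Icc 0 D.T] r₀) (𝓝 0) := by
    have h2 : Tendsto (fun r => M * ‖w r - w r₀‖) (𝓝[Icc 0 D.T] r₀) (𝓝 0) := by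
      have := (((hw r₀ hr₀).tendsto.sub_const (w r₀)).norm).const_mul M
      simpa using this
    refine squeeze_zero_norm' ?_ h2
    filter_upwards [self_mem_nhdsWithin] with r hr
    exact (D.S r).le_of_opNorm_le (hM r hr) _
  have h3 := (((D.S_cont (w r₀)).mono Icc_subset_Ici_self) r₀ hr₀).tendsto
  have := h1.add h3
  rw [zero_add] at this
  exact this.congr fun r => by rw [map_sub, sub_add_cancel]

/-- The integrand of the quadratic form of the covariance. -/
noncomputable def covDensity (h : H) (r : ℝ) : ℝ := ⟪D.C (D.adjS r h), D.adjS r h⟫_ℝ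

/-- The quadratic form `⟨Q_s h, h⟩ = ∫_0^s ⟨C e^{rA*}h, e^{rA*}h⟩ dr`. -/
noncomputable def covForm (h : H) (s : ℝ) : ℝ := ∫ r in (0 : ℝ)..s, D.covDensity h r

theorem covDensity_nonneg (h : H) (r : ℝ) : 0 ≤ D.covDensity h r :=
  D.C_pos.re_inner_nonneg_left _

theorem covDensity_continuousOn (h : H) : ContinuousOn (D.covDensity h) (Icc 0 D.T) :=
  (D.C.continuous.comp_continuousOn (D.adjS_continuousOn h)).inner (D.adjS_continuousOn h)

theorem covDensity_intervalIntegrable (h : H) {s t : ℝ} (hs : s ∈ Icc 0 D.T)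
    (ht : t ∈ Icc 0 D.T) : IntervalIntegrable (D.covDensity h) volume s t :=
  ((D.covDensity_continuousOn h).mono (ordConnected_Icc.uIcc_subset hs ht)).intervalIntegrable

theorem covForm_continuousOn (h : H) : ContinuousOn (D.covForm h) (Icc 0 D.T) := by
  have := intervalIntegral.continuousOn_primitive_interval' (f := D.covDensity h) (μ := volume)
    (b₁ := 0) (b₂ := D.T) (a := 0)
    (D.covDensity_intervalIntegrable h ⟨le_rfl, D.hT.le⟩ ⟨D.hT.le, le_rfl⟩) left_mem_uIcc
  rwa [uIcc_of_le D.hT.le] at this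

theorem covForm_hasDerivAt (h : H) {s : ℝ} (hs : s ∈ Ioo 0 D.T) :
    HasDerivAt (D.covForm h) (D.covDensity h s) s := by
  have hc := (D.covDensity_continuousOn h).mono Ioo_subset_Icc_self
  exact intervalIntegral.integral_hasDerivAt_right
    (D.covDensity_intervalIntegrable h ⟨le_rfl, D.hT.le⟩ (Ioo_subset_Icc_self hs))
    (hc.stronglyMeasurableAtFilter isOpen_Ioo s hs) (hc.continuousAt (isOpen_Ioo.mem_nhds hs))

theorem covForm_zero (h : H) : D.covForm h 0 = 0 := intervalIntegral.integral_same

theorem covForm_mono (h : H) {s t : ℝ} (hs : 0 ≤ s) (hst : s ≤ t) (ht : t ≤ D.T) :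
    D.covForm h s ≤ D.covForm h t :=
  intervalIntegral.integral_mono_interval le_rfl hs hst
    (Eventually.of_forall fun r => D.covDensity_nonneg h r)
    (D.covDensity_intervalIntegrable h ⟨le_rfl, D.hT.le⟩ ⟨hs.trans hst, ht⟩)

variable {D} {hyp : D.Hyp31}

theorem Hyp31.inner_Q (hyp : D.Hyp31) {s : ℝ} (hs : s ∈ Ioc 0 D.T) (h : H) :
    ⟪hyp.Q s h, h⟫_ℝ = D.covForm h s := by
  have hi : IntervalIntegrable (fun r => D.S r (D.C (D.adjS r h))) volume 0 s := by
    refine ContinuousOn.intervalIntegrable ?_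
    rw [uIcc_of_le hs.1.le]
    exact (D.continuousOn_S_apply
      (D.C.continuous.comp_continuousOn (D.adjS_continuousOn h))).mono (Icc_subset_Icc_right hs.2)
  rw [hyp.Q_def s hs.1 h]
  refine (inner_intervalIntegral hi h).trans ?_
  refine intervalIntegral.integral_congr fun r _ => ?_
  exact (D.inner_adjS _ _ _).symm

namespace OUData

variable (O : D.OUData hyp)

theorem hasGaussianCharFun {s : ℝ} (hs : 0 < s) : HasGaussianCharFun (O.N s) (hyp.Q s) :=
  O.N_char s hs

/-- The measures `N_{Q_s}`, `0 < s ≤ T`, have uniformly bounded fourth moments. -/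
theorem exists_moment_bound : ∃ m : ℝ, ∀ s ∈ Ioc 0 D.T,
    Integrable (fun y : H => (1 + ‖y‖ ^ 2) ^ 2) (O.N s) ∧
      ∫ y, (1 + ‖y‖ ^ 2) ^ 2 ∂(O.N s) ≤ m := by
  set c := eLpNorm (fun x : ℝ => x ^ 2) 2 (ProbabilityTheory.gaussianReal 0 1) with hc
  have hcfin : c < ⊤ := by
    have h4 := ProbabilityTheory.memLp_id_gaussianReal (μ := 0) (v := 1) 4
    have h2 : MemLp (fun x : ℝ => x ^ 2) 2 (ProbabilityTheory.gaussianReal 0 1) := by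
      rw [memLp_two_iff_integrable_sq (by fun_prop)]
      have := h4.integrable_norm_rpow (by norm_num) (by norm_num)
      refine this.congr (Eventually.of_forall fun x => ?_)
      simp only [id, Real.norm_eq_abs]
      norm_num
      rw [← pow_mul, ← abs_pow, abs_of_nonneg (show 0 ≤ x ^ (2 * 2) by rw [pow_mul]; positivity)]
    exact h2.2
  set tr := ∑' i, ⟪hyp.Q D.T (D.basis i), D.basis i⟫_ℝ with htr
  set L : ℝ≥0∞ := 1 + ENNReal.ofReal tr * c with hL
  have hLfin : L < ⊤ := by
    refine ENNReal.add_lt_top.2 ⟨ENNReal.one_lt_top, ENNReal.mul_lt_top ENNReal.ofReal_lt_top hcfin⟩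
  refine ⟨L.toReal ^ 2, fun s hs => ?_⟩
  have := O.N_prob s hs.1.le
  have hT : D.T ∈ Ioc 0 D.T := ⟨D.hT, le_rfl⟩
  have htrs : ∑' i, ⟪hyp.Q s (D.basis i), D.basis i⟫_ℝ ≤ tr := by
    refine Summable.tsum_le_tsum (fun i => ?_) (hyp.Q_traceClass s hs.1) (hyp.Q_traceClass _ D.hT)
    rw [hyp.inner_Q hs, hyp.inner_Q hT]
    exact D.covForm_mono _ hs.1.le hs.2 le_rfl
  have hn : eLpNorm (fun y : H => 1 + ‖y‖ ^ 2) 2 (O.N s) ≤ L := by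
    refine (eLpNorm_add_le (f := fun _ => (1 : ℝ)) (by fun_prop) (by fun_prop) (by norm_num)).trans ?_
    refine add_le_add ?_ ?_
    · rw [eLpNorm_const _ (by norm_num) (IsProbabilityMeasure.ne_zero _)]
      simp
    · refine ((O.hasGaussianCharFun hs.1).eLpNorm_norm_sq_le (hyp.Q_pos s hs.1) D.basis
        (hyp.Q_traceClass s hs.1)).trans ?_
      gcongr
  have hmem : MemLp (fun y : H => 1 + ‖y‖ ^ 2) 2 (O.N s) := ⟨by fun_prop, hn.trans_lt hLfin⟩
  refine ⟨hmem.integrable_sq, ?_⟩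
  have e := hmem.eLpNorm_eq_integral_rpow_norm (by norm_num) (by norm_num)
  have hI : 0 ≤ ∫ y, (1 + ‖y‖ ^ 2) ^ 2 ∂(O.N s) := integral_nonneg fun y => by positivity
  have e' : eLpNorm (fun y : H => 1 + ‖y‖ ^ 2) 2 (O.N s) =
      ENNReal.ofReal (√(∫ y, (1 + ‖y‖ ^ 2) ^ 2 ∂(O.N s))) := by
    rw [e, Real.sqrt_eq_rpow]
    norm_num
  have h5 : √(∫ y, (1 + ‖y‖ ^ 2) ^ 2 ∂(O.N s)) ≤ L.toReal := by
    rw [← ENNReal.ofReal_le_iff_le_toReal hLfin.ne, ← e']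
    exact hn
  exact (Real.sqrt_le_left ENNReal.toReal_nonneg).1 h5

end OUData

/-- The weight `1 + |·|²` along the translates of the semigroup. -/
theorem one_add_norm_S_add_le {M s : ℝ} (hM1 : 1 ≤ M) (hM : ‖D.S s‖ ≤ M) (x y : H) :
    1 + ‖D.S s x + y‖ ^ 2 ≤ 2 * M ^ 2 * (1 + ‖x‖ ^ 2) * (1 + ‖y‖ ^ 2) := by
  have h1 : ‖D.S s x + y‖ ≤ M * ‖x‖ + ‖y‖ :=
    (norm_add_le _ _).trans (by gcongr; exact (D.S s).le_of_opNorm_le hM x)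
  have h2 : ‖D.S s x + y‖ ^ 2 ≤ (M * ‖x‖ + ‖y‖) ^ 2 := by gcongr
  have h3 : (M * ‖x‖ + ‖y‖) ^ 2 ≤ 2 * (M * ‖x‖) ^ 2 + 2 * ‖y‖ ^ 2 := by
    nlinarith [sq_nonneg (M * ‖x‖ - ‖y‖)]
  have h4 : 1 ≤ M ^ 2 := one_le_pow₀ hM1
  nlinarith [mul_nonneg (sq_nonneg ‖x‖) (sq_nonneg ‖y‖), sq_nonneg ‖x‖, sq_nonneg ‖y‖,
    mul_nonneg (sub_nonneg.2 h4) (sq_nonneg ‖y‖),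
    mul_nonneg (sq_nonneg M) (mul_nonneg (sq_nonneg ‖x‖) (sq_nonneg ‖y‖))]

end FPData

end OrnsteinUhlenbeck

section TrigonometricSums

set_option linter.unusedSectionVars false

namespace FPData

variable {H : Type} [NormedAddCommGroup H] [InnerProductSpace ℝ H] [CompleteSpace H]
  [SecondCountableTopology H] [MeasurableSpace H] [BorelSpace H]

/-- A finite sum `∑_j b_j(t) cos(⟨x, h_j⟩ + θ_j)` with `b_j` of class `C¹` and `h_j ∈ D(A*)`,
where `g_j = A* h_j`. -/
structure TrigSum (D : FPData H) where
  J : Type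
  fin : Fintype J
  b : J → ℝ → ℝ
  θ : J → ℝ
  h : J → H
  g : J → H
  b_contDiff : ∀ j, ContDiff ℝ 1 (b j)
  mem : ∀ j, (h j, g j) ∈ D.A.adjoint.graph

attribute [instance] TrigSum.fin

namespace TrigSum

variable {D : FPData H} (p : D.TrigSum)

/-- The value of a trigonometric sum. -/
noncomputable def ev (z : ℝ × H) : ℝ :=
  ∑ j, p.b j z.1 * Real.cos (⟪z.2, p.h j⟫_ℝ + p.θ j)

/-- The space gradient of a trigonometric sum. -/
noncomputable def gr (z : ℝ × H) : H :=
  ∑ j, (-(p.b j z.1 * Real.sin (⟪z.2, p.h j⟫_ℝ + p.θ j))) • p.h j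

/-- The Ornstein–Uhlenbeck operator applied to a trigonometric sum. -/
noncomputable def vz (z : ℝ × H) : ℝ :=
  ∑ j, (deriv (p.b j) z.1 * Real.cos (⟪z.2, p.h j⟫_ℝ + p.θ j) -
    p.b j z.1 * (1 / 2 * ⟪D.C (p.h j), p.h j⟫_ℝ * Real.cos (⟪z.2, p.h j⟫_ℝ + p.θ j) +
      ⟪z.2, p.g j⟫_ℝ * Real.sin (⟪z.2, p.h j⟫_ℝ + p.θ j)))

theorem b_continuous (j : p.J) : Continuous (p.b j) := (p.b_contDiff j).continuous

theorem deriv_b_continuous (j : p.J) : Continuous (deriv (p.b j)) :=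
  (p.b_contDiff j).continuous_deriv le_rfl

theorem ev_continuous : Continuous p.ev := by
  have := p.b_continuous
  unfold ev
  fun_prop

theorem gr_continuous : Continuous p.gr := by
  have := p.b_continuous
  unfold gr
  fun_prop

theorem vz_continuous : Continuous p.vz := by
  have := p.b_continuous
  have := p.deriv_b_continuous
  unfold vz
  fun_prop

theorem ev_mem_EA (hb : ∀ j, p.b j D.T = 0) : p.ev ∈ D.EA := by
  have hC : ∀ j, D.CinDAstar (fun _ => p.h j) (fun _ => p.g j) := fun j =>
    ⟨contDiffOn_const, contDiffOn_const, fun _ _ => p.mem j⟩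
  have e : p.ev = ∑ j, (Real.cos (p.θ j) • (fun z : ℝ × H => p.b j z.1 * Real.cos ⟪z.2, p.h j⟫_ℝ) -
      Real.sin (p.θ j) • fun z : ℝ × H => p.b j z.1 * Real.sin ⟪z.2, p.h j⟫_ℝ) := by
    ext z
    simp only [ev, Finset.sum_apply, Pi.sub_apply, Pi.smul_apply, smul_eq_mul, Real.cos_add]
    exact Finset.sum_congr rfl fun j _ => by ring
  rw [e]
  refine Submodule.sum_mem _ fun j _ => Submodule.sub_mem _ (Submodule.smul_mem _ _ ?_)
    (Submodule.smul_mem _ _ ?_)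
  · exact Submodule.subset_span
      ⟨p.b j, _, _, (p.b_contDiff j).contDiffOn, hb j, hC j, Or.inl rfl⟩
  · exact Submodule.subset_span
      ⟨p.b j, _, _, (p.b_contDiff j).contDiffOn, hb j, hC j, Or.inr rfl⟩

theorem hasFDerivAt_inner_add (h : H) (θ : ℝ) (x : H) :
    HasFDerivAt (fun y : H => ⟪y, h⟫_ℝ + θ) (innerSL ℝ h) x := by
  have : HasFDerivAt (fun y : H => innerSL ℝ h y + θ) (innerSL ℝ h) x :=
    (innerSL ℝ h).hasFDerivAt.add_const θ
  simpa only [innerSL_apply_apply, real_inner_comm] using this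

theorem hasGradientAt_ev (t : ℝ) (x : H) :
    HasGradientAt (fun y => p.ev (t, y)) (p.gr (t, x)) x := by
  rw [hasGradientAt_iff_hasFDerivAt]
  have := HasFDerivAt.fun_sum (u := Finset.univ) fun j _ =>
    ((hasFDerivAt_inner_add (p.h j) (p.θ j) x).cos.const_mul (p.b j t))
  refine this.congr_fderiv ?_
  ext v
  simp [gr, mul_assoc]

theorem xGrad_ev (z : ℝ × H) : xGrad p.ev z = p.gr z :=
  (p.hasGradientAt_ev z.1 z.2).gradient

theorem traceCD2_ev (z : ℝ × H) : D.traceCD2 p.ev z =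
    ∑ j, -(p.b j z.1 * (⟪D.C (p.h j), p.h j⟫_ℝ * Real.cos (⟪z.2, p.h j⟫_ℝ + p.θ j))) := by
  have hg : (gradient fun y => p.ev (z.1, y)) = fun y => p.gr (z.1, y) :=
    funext fun y => (p.hasGradientAt_ev z.1 y).gradient
  have hd := HasFDerivAt.fun_sum (u := Finset.univ) fun j _ =>
    ((((hasFDerivAt_inner_add (p.h j) (p.θ j) z.2).sin.const_mul (p.b j z.1)).neg).smul_const
      (p.h j))
  have hC : ∀ h : H, HasSum (fun i => ⟪D.sqrtC (D.basis i), h⟫_ℝ ^ 2) ⟪D.C h, h⟫_ℝ := by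
    intro h
    have h1 := D.basis.hasSum_inner_mul_inner (D.sqrtC h) (D.sqrtC h)
    have h2 : ⟪D.sqrtC h, D.sqrtC h⟫_ℝ = ⟪D.C h, h⟫_ℝ := by
      rw [← D.sqrtC_sq]
      exact (D.sqrtC_pos.isSymmetric (D.sqrtC h) h).symm
    rw [h2] at h1
    refine h1.congr_fun fun i => ?_
    have h3 : ⟪D.sqrtC (D.basis i), h⟫_ℝ = ⟪D.basis i, D.sqrtC h⟫_ℝ :=
      D.sqrtC_pos.isSymmetric _ _
    rw [h3, sq, real_inner_comm (D.sqrtC h)]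
  have hs := hasSum_sum (s := Finset.univ) fun j (_ : j ∈ Finset.univ) =>
    ((hC (p.h j)).mul_left (-(p.b j z.1 * Real.cos (⟪z.2, p.h j⟫_ℝ + p.θ j))))
  have e : ∀ i, ⟪(fderiv ℝ (gradient fun y => p.ev (z.1, y)) z.2) (D.sqrtC (D.basis i)),
      D.sqrtC (D.basis i)⟫_ℝ = ∑ j, -(p.b j z.1 * Real.cos (⟪z.2, p.h j⟫_ℝ + p.θ j)) *
        ⟪D.sqrtC (D.basis i), p.h j⟫_ℝ ^ 2 := by
    intro i
    have hd' : fderiv ℝ (fun y => p.gr (z.1, y)) z.2 = _ := hd.fderiv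
    rw [hg, hd']
    simp only [sum_apply, sum_inner, ContinuousLinearMap.smulRight_apply,
      inner_smul_left]
    refine Finset.sum_congr rfl fun j _ => ?_
    simp [real_inner_comm]
    ring
  unfold traceCD2
  simp_rw [e]
  rw [hs.tsum_eq]
  exact Finset.sum_congr rfl fun j _ => by ring

theorem gr_mem_graph (z : ℝ × H) :
    (p.gr z, ∑ j, (-(p.b j z.1 * Real.sin (⟪z.2, p.h j⟫_ℝ + p.θ j))) • p.g j) ∈
      D.A.adjoint.graph := by
  have := Submodule.sum_mem D.A.adjoint.graph (t := Finset.univ) fun j _ =>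
    Submodule.smul_mem _ (-(p.b j z.1 * Real.sin (⟪z.2, p.h j⟫_ℝ + p.θ j))) (p.mem j)
  convert this using 1
  ext <;> simp [gr, Prod.fst_sum, Prod.snd_sum]

theorem Vzero_ev (z : ℝ × H) : D.Vzero p.ev z = p.vz z := by
  obtain ⟨y, hy1, hy2⟩ := (LinearPMap.mem_graph_iff _).1 (p.gr_mem_graph z)
  simp only at hy1 hy2
  have hk : xGrad p.ev z ∈ D.A.adjoint.domain := by
    rw [xGrad_ev, ← hy1]; exact y.2
  have hy : (⟨xGrad p.ev z, hk⟩ : D.A.adjoint.domain) = y := Subtype.ext (by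
    rw [hy1]; exact p.xGrad_ev z)
  have hd : HasDerivAt (fun r => p.ev (r, z.2))
      (∑ j, deriv (p.b j) z.1 * Real.cos (⟪z.2, p.h j⟫_ℝ + p.θ j)) z.1 :=
    HasDerivAt.fun_sum fun j _ =>
      (((p.b_contDiff j).differentiable one_ne_zero z.1).hasDerivAt).mul_const (Real.cos (⟪z.2, p.h j⟫_ℝ + p.θ j))
  unfold Vzero
  rw [dif_pos hk, hy, hy2, hd.deriv, traceCD2_ev, inner_sum, Finset.mul_sum,
    ← Finset.sum_add_distrib, ← Finset.sum_add_distrib]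
  refine Finset.sum_congr rfl fun j _ => ?_
  rw [inner_smul_right]
  ring

/-- The sum of two trigonometric sums. -/
def add (q : D.TrigSum) : D.TrigSum where
  J := p.J ⊕ q.J
  fin := inferInstance
  b := Sum.elim p.b q.b
  θ := Sum.elim p.θ q.θ
  h := Sum.elim p.h q.h
  g := Sum.elim p.g q.g
  b_contDiff := by rintro (j | j); exacts [p.b_contDiff j, q.b_contDiff j]
  mem := by rintro (j | j); exacts [p.mem j, q.mem j]

theorem ev_add (q : D.TrigSum) (z : ℝ × H) : (p.add q).ev z = p.ev z + q.ev z :=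
  Fintype.sum_sum_type _

theorem gr_add (q : D.TrigSum) (z : ℝ × H) : (p.add q).gr z = p.gr z + q.gr z :=
  Fintype.sum_sum_type _

theorem vz_add (q : D.TrigSum) (z : ℝ × H) : (p.add q).vz z = p.vz z + q.vz z :=
  Fintype.sum_sum_type _

/-- Multiplication of a trigonometric sum by a function of time. -/
def mulTime (ψ : ℝ → ℝ) (hψ : ContDiff ℝ 1 ψ) : D.TrigSum where
  J := p.J
  fin := p.fin
  b := fun j t => ψ t * p.b j t
  θ := p.θ
  h := p.h
  g := p.g
  b_contDiff := fun j => hψ.mul (p.b_contDiff j)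
  mem := p.mem

variable (ψ : ℝ → ℝ) (hψ : ContDiff ℝ 1 ψ)

theorem ev_mulTime (z : ℝ × H) : (p.mulTime ψ hψ).ev z = ψ z.1 * p.ev z := by
  unfold ev
  rw [Finset.mul_sum]
  exact Finset.sum_congr rfl fun j _ => mul_assoc _ _ _

theorem gr_mulTime (z : ℝ × H) : (p.mulTime ψ hψ).gr z = ψ z.1 • p.gr z := by
  unfold gr
  rw [Finset.smul_sum]
  refine Finset.sum_congr rfl fun j _ => ?_
  rw [smul_smul]
  congr 1
  simp only [mulTime]
  ring

theorem vz_mulTime (z : ℝ × H) :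
    (p.mulTime ψ hψ).vz z = deriv ψ z.1 * p.ev z + ψ z.1 * p.vz z := by
  unfold vz ev
  rw [Finset.mul_sum, Finset.mul_sum, ← Finset.sum_add_distrib]
  refine Finset.sum_congr rfl fun j _ => ?_
  have : deriv ((p.mulTime ψ hψ).b j) z.1 = deriv ψ z.1 * p.b j z.1 + ψ z.1 * deriv (p.b j) z.1 :=
    deriv_fun_mul (hψ.differentiable one_ne_zero z.1)
      ((p.b_contDiff j).differentiable one_ne_zero z.1)
  rw [this]
  simp only [mulTime]
  ring

end TrigSum

end FPData

end TrigonometricSums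

section HeatFlow

set_option linter.unusedSectionVars false

namespace FPData

variable {H : Type} [NormedAddCommGroup H] [InnerProductSpace ℝ H] [CompleteSpace H]
  [SecondCountableTopology H] [MeasurableSpace H] [BorelSpace H]

namespace TrigSum

variable {D : FPData H} (p q : D.TrigSum) (lam : ℝ)

/-- The trigonometric sum `(t, x) ↦ e^{-λs} R_s p(t + s, ·)(x)`. -/
noncomputable def heat (s : ℝ) : D.TrigSum where
  J := p.J
  fin := p.fin
  b := fun j t => Real.exp (-lam * s) * Real.exp (-D.covForm (p.h j) s / 2) * p.b j (t + s)
  θ := p.θ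
  h := fun j => D.adjS (max s 0) (p.h j)
  g := fun j => D.adjS (max s 0) (p.g j)
  b_contDiff := fun j => contDiff_const.mul ((p.b_contDiff j).comp (contDiff_id.add contDiff_const))
  mem := fun j => D.adjS_mem_graph (le_max_right _ _) (p.mem j)

theorem ev_heat_eq {s : ℝ} (hs : 0 ≤ s) (t : ℝ) (x : H) : (p.heat lam s).ev (t, x) =
    ∑ j, Real.exp (-lam * s) * Real.exp (-D.covForm (p.h j) s / 2) * p.b j (t + s) *
      Real.cos (⟪D.S s x, p.h j⟫_ℝ + p.θ j) := by
  simp only [ev, heat, max_eq_left hs, inner_adjS]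
  rfl

variable {hyp : D.Hyp31} (O : D.OUData hyp)

theorem ev_heat {s : ℝ} (hs : s ∈ Ioc 0 D.T) (t : ℝ) (x : H) :
    (p.heat lam s).ev (t, x) =
      Real.exp (-lam * s) * ∫ y, p.ev (t + s, D.S s x + y) ∂(O.N s) := by
  have := O.N_prob s hs.1.le
  rw [p.ev_heat_eq lam hs.1.le]
  unfold ev
  rw [integral_finsetSum, Finset.mul_sum]
  · refine Finset.sum_congr rfl fun j _ => ?_
    have h1 := (O.hasGaussianCharFun hs.1).integral_cos (p.h j) (⟪D.S s x, p.h j⟫_ℝ + p.θ j)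
    rw [hyp.inner_Q hs] at h1
    simp only
    rw [integral_const_mul]
    simp only [inner_add_left]
    have h2 : ∀ y, ⟪D.S s x, p.h j⟫_ℝ + ⟪y, p.h j⟫_ℝ + p.θ j =
        ⟪y, p.h j⟫_ℝ + (⟪D.S s x, p.h j⟫_ℝ + p.θ j) := fun y => by ring
    simp_rw [h2, h1]
    ring
  · intro j _
    have := p.b_continuous j
    refine Integrable.of_bound (C := |p.b j (t + s)|) (by fun_prop) (Eventually.of_forall fun y => ?_)
    rw [norm_mul]
    exact mul_le_of_le_one_right (abs_nonneg _) (Real.abs_cos_le_one _)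

theorem norm_gr_heat_le {s : ℝ} (hs : s ∈ Ioc 0 D.T) (t : ℝ) (x : H) :
    ‖(p.heat lam s).gr (t, x)‖ ≤ Real.exp (-lam * s) * ‖hyp.Λ s‖ *
      √(∫ y, p.ev (t + s, D.S s x + y) ^ 2 ∂(O.N s)) := by
  have := O.N_prob s hs.1.le
  set ξ := ∑ j, (p.b j (t + s) * (Real.exp (-⟪hyp.Q s (p.h j), p.h j⟫_ℝ / 2) *
    Real.sin (⟪D.S s x, p.h j⟫_ℝ + p.θ j))) • p.h j with hξ
  have e : (p.heat lam s).gr (t, x) = (-Real.exp (-lam * s)) • D.adjS s ξ := by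
    rw [hξ, map_sum, Finset.smul_sum]
    unfold gr
    refine Finset.sum_congr rfl fun j _ => ?_
    simp only [heat, max_eq_left hs.1.le, inner_adjS, map_smul, smul_smul, hyp.inner_Q hs]
    congr 1
    ring
  have h1 : ‖D.adjS s ξ‖ ≤ ‖hyp.Λ s‖ * ‖hyp.sqrtQ s ξ‖ := by
    set v := D.adjS s ξ with hv
    have h2 : ‖v‖ * ‖v‖ ≤ ‖v‖ * (‖hyp.Λ s‖ * ‖hyp.sqrtQ s ξ‖) := by
      rw [← real_inner_self_eq_norm_mul_norm]
      conv_lhs => rw [hv]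
      rw [inner_adjS, ← hyp.Λ_spec s hs.1, ContinuousLinearMap.comp_apply, ← hv]
      have h3 : ⟪hyp.sqrtQ s (hyp.Λ s v), ξ⟫_ℝ = ⟪hyp.Λ s v, hyp.sqrtQ s ξ⟫_ℝ :=
        (hyp.sqrtQ_pos s hs.1).isSymmetric _ _
      rw [h3]
      refine (real_inner_le_norm _ _).trans ?_
      calc ‖hyp.Λ s v‖ * ‖hyp.sqrtQ s ξ‖ ≤ (‖hyp.Λ s‖ * ‖v‖) * ‖hyp.sqrtQ s ξ‖ := by
            gcongr; exact (hyp.Λ s).le_opNorm v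
        _ = _ := by ring
    rcases (norm_nonneg v).eq_or_lt with h0 | h0
    · rw [← h0]; positivity
    · exact le_of_mul_le_mul_left h2 h0
  have h4 := (O.hasGaussianCharFun hs.1).norm_sqrt_le (hyp.Q_pos s hs.1) (hyp.sqrtQ_pos s hs.1)
    (hyp.sqrtQ_sq s hs.1) (fun j => p.b j (t + s)) (fun j => ⟪D.S s x, p.h j⟫_ℝ + p.θ j) p.h
  have h5 : ∀ y, p.ev (t + s, D.S s x + y) =
      ∑ j, p.b j (t + s) * Real.cos (⟪y, p.h j⟫_ℝ + (⟪D.S s x, p.h j⟫_ℝ + p.θ j)) := by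
    intro y
    unfold ev
    refine Finset.sum_congr rfl fun j _ => ?_
    simp only [inner_add_left]
    congr 2
    ring
  simp_rw [h5]
  rw [e, norm_smul, norm_neg, Real.norm_eq_abs, abs_of_pos (Real.exp_pos _), mul_assoc]
  gcongr
  exact h1.trans (by gcongr)

/-- The difference of two trigonometric sums. -/
def sub : D.TrigSum := p.add (q.mulTime (fun _ => -1) contDiff_const)

theorem ev_sub (z : ℝ × H) : (p.sub q).ev z = p.ev z - q.ev z := by
  rw [sub, ev_add, ev_mulTime]; ring

theorem gr_heat_sub (s : ℝ) (z : ℝ × H) :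
    ((p.sub q).heat lam s).gr z = (p.heat lam s).gr z - (q.heat lam s).gr z := by
  refine (Fintype.sum_sum_type _).trans ?_
  rw [sub_eq_add_neg]
  refine congrArg₂ _ rfl ?_
  unfold gr
  rw [← Finset.sum_neg_distrib]
  refine Finset.sum_congr rfl fun (j : q.J) _ => ?_
  rw [← neg_smul]
  refine congrArg₂ _ ?_ rfl
  change -(Real.exp (-lam * s) * Real.exp (-D.covForm (q.h j) s / 2) * (-1 * q.b j (z.1 + s)) *
    Real.sin (⟪z.2, D.adjS (max s 0) (q.h j)⟫_ℝ + q.θ j)) = _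
  simp only [heat]
  ring

theorem deriv_b_heat (s : ℝ) (j : p.J) (t : ℝ) : deriv ((p.heat lam s).b j) t =
    Real.exp (-lam * s) * Real.exp (-D.covForm (p.h j) s / 2) * deriv (p.b j) (t + s) := by
  have := ((p.b_contDiff j).differentiable one_ne_zero (t + s)).hasDerivAt
  exact ((this.comp_add_const t s).const_mul _).deriv

theorem vz_heat_eq {s : ℝ} (hs : 0 ≤ s) (t : ℝ) (x : H) : (p.heat lam s).vz (t, x) =
    ∑ j, Real.exp (-lam * s) * Real.exp (-D.covForm (p.h j) s / 2) *
      (deriv (p.b j) (t + s) * Real.cos (⟪D.S s x, p.h j⟫_ℝ + p.θ j) -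
      p.b j (t + s) * (1 / 2 * D.covDensity (p.h j) s * Real.cos (⟪D.S s x, p.h j⟫_ℝ + p.θ j) +
      ⟪D.S s x, p.g j⟫_ℝ * Real.sin (⟪D.S s x, p.h j⟫_ℝ + p.θ j))) := by
  unfold vz
  refine Finset.sum_congr rfl fun (j : p.J) _ => ?_
  rw [deriv_b_heat]
  simp only [heat, max_eq_left hs, inner_adjS, covDensity]
  ring

theorem inner_S_hasDerivAt {h g : H} (hg : (h, g) ∈ D.A.adjoint.graph) (x : H) {s : ℝ}
    (hs : s ∈ Ioo 0 D.T) : HasDerivAt (fun r => ⟪D.S r x, h⟫_ℝ) ⟪D.S s x, g⟫_ℝ s := by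
  have hc : ContinuousOn (fun r => ⟪D.S r x, g⟫_ℝ) (Icc 0 D.T) :=
    (((D.S_cont x).mono Icc_subset_Ici_self)).inner continuousOn_const
  have hi : IntervalIntegrable (fun r => ⟪D.S r x, g⟫_ℝ) volume 0 s :=
    (hc.mono (by rw [uIcc_of_le hs.1.le]; exact Icc_subset_Icc_right hs.2.le)).intervalIntegrable
  have hc' := hc.mono Ioo_subset_Icc_self
  have h1 := intervalIntegral.integral_hasDerivAt_right hi
    (hc'.stronglyMeasurableAtFilter isOpen_Ioo s hs) (hc'.continuousAt (isOpen_Ioo.mem_nhds hs))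
  refine (h1.const_add ⟪x, h⟫_ℝ).congr_of_eventuallyEq ?_
  filter_upwards [isOpen_Ioo.mem_nhds hs] with r hr
  rw [← D.inner_S_sub (Ioo_subset_Icc_self hr) hg x]
  ring

theorem ev_heat_continuousOn (t : ℝ) (x : H) :
    ContinuousOn (fun s => (p.heat lam s).ev (t, x)) (Icc 0 D.T) := by
  have hS := (D.S_cont x).mono (fun r (hr : r ∈ Icc 0 D.T) => hr.1)
  refine ContinuousOn.congr ?_ fun s hs => p.ev_heat_eq lam hs.1 t x
  refine continuousOn_finsetSum _ fun j _ => ?_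
  have hcov := D.covForm_continuousOn (p.h j)
  have hb1 : ContinuousOn (fun s => p.b j (t + s)) (Icc 0 D.T) := by
    have := p.b_continuous j
    fun_prop
  exact ((((by fun_prop : ContinuousOn (fun s : ℝ => Real.exp (-lam * s)) (Icc 0 D.T)).mul
    (hcov.neg.div_const 2).rexp).mul hb1)).mul
    (Real.continuous_cos.comp_continuousOn ((hS.inner continuousOn_const).add continuousOn_const))

theorem vz_heat_continuousOn (t : ℝ) (x : H) :
    ContinuousOn (fun s => (p.heat lam s).vz (t, x)) (Icc 0 D.T) := by
  have hS := (D.S_cont x).mono (fun r (hr : r ∈ Icc 0 D.T) => hr.1)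
  refine ContinuousOn.congr ?_ fun s hs => p.vz_heat_eq lam hs.1 t x
  refine continuousOn_finsetSum _ fun j _ => ?_
  have hcov := D.covForm_continuousOn (p.h j)
  have hden := D.covDensity_continuousOn (p.h j)
  have hb1 : ContinuousOn (fun s => p.b j (t + s)) (Icc 0 D.T) := by
    have := p.b_continuous j
    fun_prop
  have hb2 : ContinuousOn (fun s => deriv (p.b j) (t + s)) (Icc 0 D.T) := by
    have := p.deriv_b_continuous j
    fun_prop
  have ha : ContinuousOn (fun s => ⟪D.S s x, p.h j⟫_ℝ + p.θ j) (Icc 0 D.T) :=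
    (hS.inner continuousOn_const).add continuousOn_const
  have hg : ContinuousOn (fun s => ⟪D.S s x, p.g j⟫_ℝ) (Icc 0 D.T) := hS.inner continuousOn_const
  have hco := Real.continuous_cos.comp_continuousOn ha
  have hsi := Real.continuous_sin.comp_continuousOn ha
  exact ((by fun_prop : ContinuousOn (fun s : ℝ => Real.exp (-lam * s)) (Icc 0 D.T)).mul
    (hcov.neg.div_const 2).rexp).mul ((hb2.mul hco).sub
      (hb1.mul (((continuousOn_const.mul hden).mul hco).add (hg.mul hsi))))

theorem integral_vz_heat (hb : ∀ j t, D.T ≤ t → p.b j t = 0) {t : ℝ} (ht : 0 ≤ t) (x : H) :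
    ∫ s in (0 : ℝ)..D.T, (p.heat lam s).vz (t, x) =
      lam * (∫ s in (0 : ℝ)..D.T, (p.heat lam s).ev (t, x)) - p.ev (t, x) := by
  have hT := D.hT
  have hd : ∀ s ∈ Ioo 0 D.T, HasDerivAt (fun s => (p.heat lam s).ev (t, x))
      ((p.heat lam s).vz (t, x) - lam * (p.heat lam s).ev (t, x)) s := by
    intro s hs
    rw [p.vz_heat_eq lam hs.1.le, p.ev_heat_eq lam hs.1.le, Finset.mul_sum,
      ← Finset.sum_sub_distrib]
    have h1 : HasDerivAt (fun s => ∑ j, Real.exp (-lam * s) *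
        Real.exp (-D.covForm (p.h j) s / 2) * p.b j (t + s) *
        Real.cos (⟪D.S s x, p.h j⟫_ℝ + p.θ j)) (∑ j, _) s :=
      HasDerivAt.fun_sum fun j _ =>
        ((((((hasDerivAt_id s).const_mul (-lam)).exp).mul
          (((D.covForm_hasDerivAt (p.h j) hs).neg.div_const 2).exp)).mul
          ((((p.b_contDiff j).differentiable one_ne_zero (t + s)).hasDerivAt).comp_const_add
            t s)).mul
          (((inner_S_hasDerivAt (p.mem j) x hs).add_const (p.θ j)).cos))
    refine (h1.congr_deriv ?_).congr_of_eventuallyEq ?_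
    · refine Finset.sum_congr rfl fun j _ => ?_
      simp only [Pi.mul_apply, id, Pi.neg_apply]
      ring
    · filter_upwards [isOpen_Ioo.mem_nhds hs] with r hr
      exact p.ev_heat_eq lam hr.1.le t x
  have hi1 : IntervalIntegrable (fun s => (p.heat lam s).ev (t, x)) volume 0 D.T := by
    refine ContinuousOn.intervalIntegrable ?_
    rw [uIcc_of_le hT.le]
    exact p.ev_heat_continuousOn lam t x
  have hi2 : IntervalIntegrable (fun s => (p.heat lam s).vz (t, x)) volume 0 D.T := by
    refine ContinuousOn.intervalIntegrable ?_
    rw [uIcc_of_le hT.le]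
    exact p.vz_heat_continuousOn lam t x
  have hF := intervalIntegral.integral_eq_sub_of_hasDeriv_right (a := 0) (b := D.T)
    (f := fun s => (p.heat lam s).ev (t, x))
    (f' := fun s => (p.heat lam s).vz (t, x) - lam * (p.heat lam s).ev (t, x))
    (by rw [uIcc_of_le hT.le]; exact p.ev_heat_continuousOn lam t x)
    (fun s hs => by
      rw [min_eq_left hT.le, max_eq_right hT.le] at hs
      exact (hd s hs).hasDerivWithinAt) (hi2.sub (hi1.const_mul _))
  rw [intervalIntegral.integral_sub hi2 (hi1.const_mul _), intervalIntegral.integral_const_mul] at hF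
  have e0 : (p.heat lam 0).ev (t, x) = p.ev (t, x) := by
    rw [p.ev_heat_eq lam le_rfl]
    simp [ev, covForm_zero, D.S_zero]
  have eT : (p.heat lam D.T).ev (t, x) = 0 := by
    rw [p.ev_heat_eq lam hT.le]
    refine Finset.sum_eq_zero fun j _ => ?_
    rw [hb j _ (by linarith)]
    simp
  rw [e0, eT] at hF
  linarith

end TrigSum

end FPData

end HeatFlow

section RiemannSums

set_option linter.unusedSectionVars false

namespace FPData

variable {H : Type} [NormedAddCommGroup H] [InnerProductSpace ℝ H] [CompleteSpace H]
  [SecondCountableTopology H] [MeasurableSpace H] [BorelSpace H]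
  {E : Type*} [NormedAddCommGroup E] [NormedSpace ℝ E]

/-- `F(s,t,x)` is bounded and equicontinuous in `s ∈ [0,T]`, uniformly in `t ∈ [0,T]` and
`x ∈ H`, relatively to the weight `(1 + |x|)^k`. -/
def WeightedEquicont (T : ℝ) (k : ℕ) (F : ℝ → ℝ → H → E) : Prop :=
  (∃ C : ℝ, 0 ≤ C ∧ ∀ s ∈ Icc 0 T, ∀ t ∈ Icc 0 T, ∀ x, ‖F s t x‖ ≤ C * (1 + ‖x‖) ^ k) ∧
  ∀ ε > 0, ∃ δ > 0, ∀ s ∈ Icc 0 T, ∀ s' ∈ Icc 0 T, |s - s'| < δ →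
    ∀ t ∈ Icc 0 T, ∀ x, ‖F s t x - F s' t x‖ ≤ ε * (1 + ‖x‖) ^ k

namespace WeightedEquicont

variable {T : ℝ} {k l : ℕ} {F G : ℝ → ℝ → H → E} {a : ℝ → ℝ → H → ℝ}

theorem add (hF : WeightedEquicont T k F) (hG : WeightedEquicont T k G) :
    WeightedEquicont T k (fun s t x => F s t x + G s t x) := by
  obtain ⟨⟨C, hC, hF1⟩, hF2⟩ := hF
  obtain ⟨⟨C', hC', hG1⟩, hG2⟩ := hG
  refine ⟨⟨C + C', by positivity, fun s hs t ht x => ?_⟩, fun ε hε => ?_⟩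
  · rw [add_mul]
    exact (norm_add_le _ _).trans (add_le_add (hF1 s hs t ht x) (hG1 s hs t ht x))
  · obtain ⟨δ, hδ, h1⟩ := hF2 (ε / 2) (half_pos hε)
    obtain ⟨δ', hδ', h2⟩ := hG2 (ε / 2) (half_pos hε)
    refine ⟨min δ δ', lt_min hδ hδ', fun s hs s' hs' hss t ht x => ?_⟩
    rw [add_sub_add_comm]
    refine (norm_add_le _ _).trans ?_
    have := add_le_add (h1 s hs s' hs' (hss.trans_le (min_le_left _ _)) t ht x)
      (h2 s hs s' hs' (hss.trans_le (min_le_right _ _)) t ht x)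
    refine this.trans_eq ?_
    ring

theorem const (c : E) : WeightedEquicont T k (fun _ _ (_ : H) => c) := by
  refine ⟨⟨‖c‖, norm_nonneg _, fun s _ t _ x => ?_⟩, fun ε hε => ⟨1, one_pos, fun s _ s' _ _ t _ x => ?_⟩⟩
  · exact le_mul_of_one_le_right (norm_nonneg _)
      (one_le_pow₀ (le_add_of_nonneg_right (norm_nonneg _)))
  · rw [sub_self, norm_zero]; positivity

theorem smul (ha : WeightedEquicont T k a) (hF : WeightedEquicont T l F) :
    WeightedEquicont T (k + l) (fun s t x => a s t x • F s t x) := by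
  obtain ⟨⟨C, hC, ha1⟩, ha2⟩ := ha
  obtain ⟨⟨C', hC', hF1⟩, hF2⟩ := hF
  refine ⟨⟨C * C', by positivity, fun s hs t ht x => ?_⟩, fun ε hε => ?_⟩
  · rw [norm_smul]
    calc ‖a s t x‖ * ‖F s t x‖ ≤ (C * (1 + ‖x‖) ^ k) * (C' * (1 + ‖x‖) ^ l) :=
          mul_le_mul (ha1 s hs t ht x) (hF1 s hs t ht x) (norm_nonneg _) (by positivity)
      _ = _ := by ring
  · obtain ⟨δ, hδ, h1⟩ := ha2 (ε / (2 * (C' + 1))) (by positivity)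
    obtain ⟨δ', hδ', h2⟩ := hF2 (ε / (2 * (C + 1))) (by positivity)
    refine ⟨min δ δ', lt_min hδ hδ', fun s hs s' hs' hss t ht x => ?_⟩
    have e : a s t x • F s t x - a s' t x • F s' t x =
        (a s t x - a s' t x) • F s t x + a s' t x • (F s t x - F s' t x) := by module
    rw [e]
    refine (norm_add_le _ _).trans ?_
    rw [norm_smul, norm_smul]
    have b1 := h1 s hs s' hs' (hss.trans_le (min_le_left _ _)) t ht x
    have b2 := h2 s hs s' hs' (hss.trans_le (min_le_right _ _)) t ht x
    have c1 : ε / (2 * (C' + 1)) * C' ≤ ε / 2 := by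
      rw [div_mul_eq_mul_div, div_le_div_iff₀ (by positivity) (by positivity)]
      nlinarith
    have c2 : C * (ε / (2 * (C + 1))) ≤ ε / 2 := by
      rw [mul_div_assoc', div_le_div_iff₀ (by positivity) (by positivity)]
      nlinarith
    calc ‖a s t x - a s' t x‖ * ‖F s t x‖ + ‖a s' t x‖ * ‖F s t x - F s' t x‖
        ≤ (ε / (2 * (C' + 1)) * (1 + ‖x‖) ^ k) * (C' * (1 + ‖x‖) ^ l) +
          (C * (1 + ‖x‖) ^ k) * (ε / (2 * (C + 1)) * (1 + ‖x‖) ^ l) := by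
          gcongr
          · exact hF1 s hs t ht x
          · exact ha1 s' hs' t ht x
      _ = (ε / (2 * (C' + 1)) * C' + C * (ε / (2 * (C + 1)))) * (1 + ‖x‖) ^ (k + l) := by ring
      _ ≤ ε * (1 + ‖x‖) ^ (k + l) := by gcongr; linarith

theorem mono (hF : WeightedEquicont T k F) (hkl : k ≤ l) : WeightedEquicont T l F := by
  have := (const (T := T) (k := l - k) (H := H) (1 : ℝ)).smul hF
  simpa [Nat.sub_add_cancel hkl] using this

theorem sum {J : Type*} (I : Finset J) {F : J → ℝ → ℝ → H → E}
    (hF : ∀ j, WeightedEquicont T k (F j)) :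
    WeightedEquicont T k (fun s t x => ∑ j ∈ I, F j s t x) := by
  classical
  induction I using Finset.induction_on with
  | empty => simpa using const (0 : E)
  | insert j I hj ih =>
    simp_rw [Finset.sum_insert hj]
    exact (hF j).add ih

theorem congr (hF : WeightedEquicont T k F)
    (h : ∀ s ∈ Icc 0 T, ∀ t ∈ Icc 0 T, ∀ x, G s t x = F s t x) : WeightedEquicont T k G := by
  obtain ⟨⟨C, hC, hF1⟩, hF2⟩ := hF
  refine ⟨⟨C, hC, fun s hs t ht x => by rw [h s hs t ht]; exact hF1 s hs t ht x⟩, fun ε hε => ?_⟩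
  obtain ⟨δ, hδ, h1⟩ := hF2 ε hε
  refine ⟨δ, hδ, fun s hs s' hs' hss t ht x => ?_⟩
  rw [h s hs t ht, h s' hs' t ht]
  exact h1 s hs s' hs' hss t ht x

theorem of_continuousOn {b : ℝ → ℝ → E} (hb : ContinuousOn (fun z : ℝ × ℝ => b z.1 z.2)
    (Icc 0 T ×ˢ Icc 0 T)) : WeightedEquicont T 0 (fun s t (_ : H) => b s t) := by
  have hK : IsCompact (Icc 0 T ×ˢ Icc 0 T) := isCompact_Icc.prod isCompact_Icc
  obtain ⟨C, hC⟩ := hK.exists_bound_of_continuousOn hb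
  have hu := Metric.uniformContinuousOn_iff.1 (hK.uniformContinuousOn_of_continuous hb)
  refine ⟨⟨max C 0, le_max_right _ _, fun s hs t ht x => ?_⟩, fun ε hε => ?_⟩
  · rw [pow_zero, mul_one]
    exact (hC (s, t) ⟨hs, ht⟩).trans (le_max_left _ _)
  · obtain ⟨δ, hδ, h⟩ := hu ε hε
    refine ⟨δ, hδ, fun s hs s' hs' hss t ht x => ?_⟩
    rw [pow_zero, mul_one, ← dist_eq_norm]
    refine (h (s, t) ⟨hs, ht⟩ (s', t) ⟨hs', ht⟩ ?_).le
    simpa [Prod.dist_eq, Real.dist_eq, hδ] using hss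

theorem inner_left {v : ℝ → H} (hv : ContinuousOn v (Icc 0 T)) :
    WeightedEquicont T 1 (fun s _ x => ⟪x, v s⟫_ℝ) := by
  have h0 : WeightedEquicont T 0 (fun s _ (_ : H) => v s) :=
    of_continuousOn (b := fun s _ => v s) (hv.comp continuousOn_fst fun _ hz => hz.1)
  obtain ⟨⟨C, hC, h1⟩, h2⟩ := h0
  refine ⟨⟨C, hC, fun s hs t ht x => ?_⟩, fun ε hε => ?_⟩
  · have := h1 s hs t ht x
    rw [pow_zero, mul_one] at this
    refine (norm_inner_le_norm _ _).trans ?_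
    nlinarith [norm_nonneg x, norm_nonneg (v s)]
  · obtain ⟨δ, hδ, h⟩ := h2 ε hε
    refine ⟨δ, hδ, fun s hs s' hs' hss t ht x => ?_⟩
    have := h s hs s' hs' hss t ht x
    rw [pow_zero, mul_one] at this
    rw [← inner_sub_right]
    refine (norm_inner_le_norm _ _).trans ?_
    nlinarith [norm_nonneg x, norm_nonneg (v s - v s')]

theorem comp_lipschitz (ha : WeightedEquicont T k a) {f : ℝ → ℝ} (hf : ∀ r, |f r| ≤ 1)
    (hf' : ∀ r r', |f r - f r'| ≤ |r - r'|) : WeightedEquicont T k (fun s t x => f (a s t x)) := by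
  refine ⟨⟨1, zero_le_one, fun s _ t _ x => ?_⟩, fun ε hε => ?_⟩
  · rw [one_mul]
    exact (hf _).trans (one_le_pow₀ (le_add_of_nonneg_right (norm_nonneg _)))
  · obtain ⟨δ, hδ, h⟩ := ha.2 ε hε
    exact ⟨δ, hδ, fun s hs s' hs' hss t ht x => (hf' _ _).trans (h s hs s' hs' hss t ht x)⟩

theorem continuousOn (hF : WeightedEquicont T k F) {t : ℝ} (ht : t ∈ Icc 0 T) (x : H) :
    ContinuousOn (fun s => F s t x) (Icc 0 T) := by
  rw [Metric.continuousOn_iff]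
  intro s hs ε hε
  obtain ⟨δ, hδ, h⟩ := hF.2 (ε / (2 * (1 + ‖x‖) ^ k)) (by positivity)
  refine ⟨δ, hδ, fun s' hs' hss => ?_⟩
  rw [dist_eq_norm]
  refine (h s' hs' s hs hss t ht x).trans_lt ?_
  rw [div_mul_eq_mul_div, mul_div_mul_right _ _ (by positivity)]
  linarith

/-- Convergence of left Riemann sums, uniformly with respect to the weight. -/
theorem riemann [CompleteSpace E] (hT : 0 < T) (hF : WeightedEquicont T k F) {ε : ℝ} (hε : 0 < ε) :
    ∀ᶠ N : ℕ in atTop, ∀ t ∈ Icc 0 T, ∀ x,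
      ‖∑ i : Fin N, (T / N) • F (i * (T / N)) t x - ∫ s in (0 : ℝ)..T, F s t x‖ ≤
        ε * (1 + ‖x‖) ^ k := by
  obtain ⟨δ, hδ, h⟩ := hF.2 (ε / T) (by positivity)
  have hlim : Tendsto (fun N : ℕ => T / N) atTop (𝓝 0) := tendsto_const_div_atTop_nhds_zero_nat T
  filter_upwards [eventually_gt_atTop 0, hlim.eventually_lt_const hδ] with N hN hNδ t ht x
  have hN' : (0 : ℝ) < N := by exact_mod_cast hN
  set τ := T / N with hτ
  have hτ0 : 0 < τ := by positivity
  have hNτ : N * τ = T := by rw [hτ]; field_simp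
  have hmem : ∀ i < N, Icc (i * τ) ((i + 1 : ℕ) * τ) ⊆ Icc 0 T := by
    intro i hi
    refine Icc_subset_Icc (by positivity) ?_
    rw [← hNτ]
    gcongr
    exact_mod_cast hi
  have hle : ∀ i : ℕ, i * τ ≤ (i + 1 : ℕ) * τ := fun i => by gcongr; simp
  have hint : ∀ i < N, IntervalIntegrable (fun s => F s t x) volume (i * τ) ((i + 1 : ℕ) * τ) := by
    intro i hi
    refine ContinuousOn.intervalIntegrable ?_
    rw [uIcc_of_le (hle i)]
    exact (hF.continuousOn ht x).mono (hmem i hi)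
  have hsum := intervalIntegral.sum_integral_adjacent_intervals (a := fun i : ℕ => i * τ) hint
  simp only [Nat.cast_zero, zero_mul, hNτ] at hsum
  rw [← hsum, Fin.sum_univ_eq_sum_range (fun i => τ • F (i * τ) t x) N, ← Finset.sum_sub_distrib]
  have hterm : ∀ i ∈ Finset.range N,
      ‖τ • F (i * τ) t x - ∫ s in (i * τ)..((i + 1 : ℕ) * τ), F s t x‖ ≤
        τ * (ε / T * (1 + ‖x‖) ^ k) := by
    intro i hi
    have hi := Finset.mem_range.1 hi
    have e : τ • F (i * τ) t x = ∫ s in (i * τ)..((i + 1 : ℕ) * τ), F (i * τ) t x := by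
      rw [intervalIntegral.integral_const]
      congr 1
      push_cast; ring
    rw [e, ← intervalIntegral.integral_sub intervalIntegrable_const (hint i hi)]
    have := intervalIntegral.norm_integral_le_of_norm_le_const
      (f := fun s => F (i * τ) t x - F s t x) (a := i * τ) (b := (i + 1 : ℕ) * τ)
      (C := ε / T * (1 + ‖x‖) ^ k) (fun s hs => by
        rw [uIoc_of_le (hle i)] at hs
        refine h _ (hmem i hi ⟨le_rfl, hle i⟩) _ (hmem i hi ⟨hs.1.le, hs.2⟩) ?_ t ht x
        rw [abs_sub_comm, abs_of_pos (sub_pos.2 hs.1)]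
        have := hs.2
        push_cast at this
        linarith)
    refine this.trans_eq ?_
    rw [abs_of_nonneg (sub_nonneg.2 (hle i))]
    push_cast; ring
  refine (norm_sum_le_of_le _ hterm).trans_eq ?_
  rw [Finset.sum_const, Finset.card_range, nsmul_eq_mul, ← mul_assoc, hNτ]
  field_simp

end WeightedEquicont

namespace TrigSum

variable {D : FPData H} (p : D.TrigSum) (lam : ℝ)

/-- The sum of a finite family of trigonometric sums. -/
def sum {N : ℕ} (P : Fin N → D.TrigSum) : D.TrigSum where
  J := Σ i, (P i).J
  fin := inferInstance
  b := fun j => (P j.1).b j.2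
  θ := fun j => (P j.1).θ j.2
  h := fun j => (P j.1).h j.2
  g := fun j => (P j.1).g j.2
  b_contDiff := fun j => (P j.1).b_contDiff j.2
  mem := fun j => (P j.1).mem j.2

theorem ev_sum {N : ℕ} (P : Fin N → D.TrigSum) (z : ℝ × H) : (sum P).ev z = ∑ i, (P i).ev z :=
  Fintype.sum_sigma _

theorem gr_sum {N : ℕ} (P : Fin N → D.TrigSum) (z : ℝ × H) : (sum P).gr z = ∑ i, (P i).gr z :=
  Fintype.sum_sigma _

theorem vz_sum {N : ℕ} (P : Fin N → D.TrigSum) (z : ℝ × H) : (sum P).vz z = ∑ i, (P i).vz z :=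
  Fintype.sum_sigma _

/-- The Riemann sums of `∫_0^T e^{-λs} R_s p(t + s, ·) ds`. -/
noncomputable def riemann (N : ℕ) : D.TrigSum :=
  sum fun i : Fin N => (p.heat lam (i * (D.T / N))).mulTime (fun _ => D.T / N) contDiff_const

theorem b_riemann_eq_zero (hb : ∀ j t, D.T ≤ t → p.b j t = 0) (N : ℕ) (j : (p.riemann lam N).J) :
    (p.riemann lam N).b j D.T = 0 := by
  obtain ⟨i, j⟩ := j
  change D.T / N * (Real.exp _ * Real.exp _ * p.b j (D.T + i * (D.T / N))) = 0
  have hT := D.hT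
  have : 0 ≤ i * (D.T / N) := by positivity
  exact mul_eq_zero_of_right _ (mul_eq_zero_of_right _ (hb _ _ (by linarith)))

theorem weightedEquicont_coeff (j : p.J) {b : ℝ → ℝ} (hb : Continuous b) :
    WeightedEquicont D.T 0 fun s t (_ : H) =>
      Real.exp (-lam * s) * Real.exp (-D.covForm (p.h j) s / 2) * b (t + s) := by
  refine WeightedEquicont.of_continuousOn (b := fun s t =>
    Real.exp (-lam * s) * Real.exp (-D.covForm (p.h j) s / 2) * b (t + s)) ?_
  have h1 : ContinuousOn (fun z : ℝ × ℝ => D.covForm (p.h j) z.1) (Icc 0 D.T ×ˢ Icc 0 D.T) :=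
    (D.covForm_continuousOn (p.h j)).comp continuousOn_fst fun _ hz => hz.1
  exact ((by fun_prop : Continuous fun z : ℝ × ℝ => Real.exp (-lam * z.1)).continuousOn.mul
    (h1.neg.div_const 2).rexp).mul (by fun_prop)

theorem adjS_max_continuousOn (h : H) :
    ContinuousOn (fun s => D.adjS (max s 0) h) (Icc 0 D.T) :=
  (D.adjS_continuousOn h).congr fun s hs => by simp only [max_eq_left hs.1]

theorem weightedEquicont_phase (j : p.J) : WeightedEquicont D.T 1 fun s _ (x : H) =>
    ⟪x, D.adjS (max s 0) (p.h j)⟫_ℝ + p.θ j :=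
  (WeightedEquicont.inner_left (adjS_max_continuousOn _)).add (WeightedEquicont.const _)

theorem weightedEquicont_cos (j : p.J) : WeightedEquicont D.T 1 fun s _ (x : H) =>
    Real.cos (⟪x, D.adjS (max s 0) (p.h j)⟫_ℝ + p.θ j) :=
  (p.weightedEquicont_phase j).comp_lipschitz Real.abs_cos_le_one fun r r' => by
    simpa [Real.dist_eq] using Real.lipschitzWith_cos.dist_le_mul r r'

theorem weightedEquicont_sin (j : p.J) : WeightedEquicont D.T 1 fun s _ (x : H) =>
    Real.sin (⟪x, D.adjS (max s 0) (p.h j)⟫_ℝ + p.θ j) :=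
  (p.weightedEquicont_phase j).comp_lipschitz Real.abs_sin_le_one fun r r' => by
    simpa [Real.dist_eq] using Real.lipschitzWith_sin.dist_le_mul r r'

theorem weightedEquicont_ev : WeightedEquicont D.T 2 fun s t x => (p.heat lam s).ev (t, x) :=
  (WeightedEquicont.sum Finset.univ fun j =>
    (p.weightedEquicont_coeff lam j (p.b_continuous j)).smul
      (p.weightedEquicont_cos j)).mono (by norm_num)

theorem weightedEquicont_adjS (h : H) :
    WeightedEquicont D.T 0 fun s _ (_ : H) => D.adjS (max s 0) h :=
  WeightedEquicont.of_continuousOn (b := fun s _ => D.adjS (max s 0) h)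
    ((adjS_max_continuousOn h).comp continuousOn_fst fun _ hz => hz.1)

theorem weightedEquicont_gr : WeightedEquicont D.T 2 fun s t x => (p.heat lam s).gr (t, x) := by
  refine ((WeightedEquicont.sum Finset.univ fun j => ((WeightedEquicont.const (k := 0) (-1 : ℝ)).smul
    ((p.weightedEquicont_coeff lam j (p.b_continuous j)).smul
      (p.weightedEquicont_sin j))).smul (weightedEquicont_adjS (p.h j))).mono
    (by norm_num)).congr fun s _ t _ x => ?_
  unfold gr
  refine Finset.sum_congr rfl fun (j : p.J) _ => ?_
  simp only [heat, smul_eq_mul, neg_mul, one_mul]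

theorem weightedEquicont_vz : WeightedEquicont D.T 2 fun s t x => (p.heat lam s).vz (t, x) := by
  have hden : ∀ j, WeightedEquicont D.T 0 fun s _ (_ : H) =>
      -(1 / 2 * ⟪D.C (D.adjS (max s 0) (p.h j)), D.adjS (max s 0) (p.h j)⟫_ℝ) := fun j => by
    have h1 := (adjS_max_continuousOn (D := D) (p.h j))
    have h2 : ContinuousOn (fun s => -(1 / 2 * ⟪D.C (D.adjS (max s 0) (p.h j)),
        D.adjS (max s 0) (p.h j)⟫_ℝ)) (Icc 0 D.T) :=
      (continuousOn_const.mul ((D.C.continuous.comp_continuousOn h1).inner h1)).neg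
    exact WeightedEquicont.of_continuousOn (b := fun s _ => -(1 / 2 *
      ⟪D.C (D.adjS (max s 0) (p.h j)), D.adjS (max s 0) (p.h j)⟫_ℝ))
      (h2.comp continuousOn_fst fun _ hz => hz.1)
  have h1 := fun j => ((p.weightedEquicont_coeff lam j (p.deriv_b_continuous j)).smul
      (p.weightedEquicont_cos j)).mono (show 0 + 1 ≤ 2 by norm_num)
  have h2 := fun j => ((p.weightedEquicont_coeff lam j (p.b_continuous j)).smul
      ((hden j).smul (p.weightedEquicont_cos j))).mono (show 0 + (0 + 1) ≤ 2 by norm_num)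
  have h3 := fun j => (p.weightedEquicont_coeff lam j (p.b_continuous j)).smul
      ((WeightedEquicont.const (k := 0) (-1 : ℝ)).smul
        ((WeightedEquicont.inner_left (adjS_max_continuousOn (p.g j))).smul
          (p.weightedEquicont_sin j)))
  refine (WeightedEquicont.sum Finset.univ fun j => (h1 j).add ((h2 j).add (h3 j))).congr
    fun s _ t _ x => ?_
  unfold vz
  refine Finset.sum_congr rfl fun (j : p.J) _ => ?_
  rw [deriv_b_heat]
  simp only [heat, smul_eq_mul]
  ring

/-- The Riemann sums of the heat flow converge together with the gradients and the images
under the Ornstein–Uhlenbeck operator. -/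
theorem exists_riemann {ε : ℝ} (hε : 0 < ε) : ∃ N : ℕ, ∀ t ∈ Icc 0 D.T, ∀ x : H,
    |(p.riemann lam N).ev (t, x) - ∫ s in (0 : ℝ)..D.T, (p.heat lam s).ev (t, x)|
        ≤ ε * (1 + ‖x‖) ^ 2 ∧
      ‖(p.riemann lam N).gr (t, x) - ∫ s in (0 : ℝ)..D.T, (p.heat lam s).gr (t, x)‖
        ≤ ε * (1 + ‖x‖) ^ 2 ∧
      |(p.riemann lam N).vz (t, x) - ∫ s in (0 : ℝ)..D.T, (p.heat lam s).vz (t, x)|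
        ≤ ε * (1 + ‖x‖) ^ 2 := by
  obtain ⟨N, h1, h2, h3⟩ := (((p.weightedEquicont_ev lam).riemann D.hT hε).and
    (((p.weightedEquicont_gr lam).riemann D.hT hε).and
      ((p.weightedEquicont_vz lam).riemann D.hT hε))).exists
  refine ⟨N, fun t ht x => ⟨?_, ?_, ?_⟩⟩
  · have := h1 t ht x
    simpa only [riemann, ev_sum, ev_mulTime, Real.norm_eq_abs, smul_eq_mul] using this
  · have := h2 t ht x
    simpa only [riemann, gr_sum, gr_mulTime] using this
  · have := h3 t ht x
    simpa only [riemann, vz_sum, vz_mulTime, deriv_const, zero_mul, zero_add, Real.norm_eq_abs,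
      smul_eq_mul] using this

end TrigSum

end FPData

end RiemannSums

section Approximation

set_option linter.unusedSectionVars false

open Polynomial in
/-- A member of a subalgebra of continuous functions stays in the subalgebra after composition
with a polynomial. -/
theorem Subalgebra.exists_mem_polynomial_comp {X : Type*} [TopologicalSpace X]
    (A : Subalgebra ℝ C(X, ℝ)) {q : C(X, ℝ)} (hq : q ∈ A) (P : ℝ[X]) :
    ∃ q' ∈ A, ∀ z, q' z = P.eval (q z) :=
  ⟨aeval q P, Algebra.adjoin_le (singleton_subset_iff.2 hq) (aeval_mem_adjoin_singleton ℝ q),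
    fun z => by simp⟩

section TrigAlgebra

variable (H : Type) [NormedAddCommGroup H] [InnerProductSpace ℝ H]

/-- The algebra of functions `∑ⱼ bⱼ(t) cos(⟨x, hⱼ⟩ + θⱼ)`, with `bⱼ` of class `C¹`. -/
def trigAlgebra : Subalgebra ℝ C(ℝ × H, ℝ) where
  carrier := {q | ∃ (J : Type) (_ : Fintype J) (b : J → ℝ → ℝ) (θ : J → ℝ) (h : J → H),
    (∀ j, ContDiff ℝ 1 (b j)) ∧ ∀ z, q z = ∑ j, b j z.1 * Real.cos (⟪z.2, h j⟫_ℝ + θ j)}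
  mul_mem' := by
    rintro q q' ⟨J, _, b, θ, h, hb, hq⟩ ⟨J', _, b', θ', h', hb', hq'⟩
    refine ⟨J × J' × Bool, inferInstance, fun j t => 1 / 2 * (b j.1 t * b' j.2.1 t),
      fun j => θ j.1 + bif j.2.2 then θ' j.2.1 else -θ' j.2.1,
      fun j => h j.1 + bif j.2.2 then h' j.2.1 else -h' j.2.1,
      fun j => contDiff_const.mul ((hb _).mul (hb' _)), fun z => ?_⟩
    rw [ContinuousMap.mul_apply, hq, hq', Finset.sum_mul_sum, Fintype.sum_prod_type]
    refine Finset.sum_congr rfl fun j _ => ?_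
    rw [Fintype.sum_prod_type]
    refine Finset.sum_congr rfl fun j' _ => ?_
    simp only [Fintype.sum_bool, cond_true, cond_false, inner_add_right, inner_neg_right]
    have h1 := Real.cos_add (⟪z.2, h j⟫_ℝ + θ j) (⟪z.2, h' j'⟫_ℝ + θ' j')
    have h2 := Real.cos_sub (⟪z.2, h j⟫_ℝ + θ j) (⟪z.2, h' j'⟫_ℝ + θ' j')
    rw [show ⟪z.2, h j⟫_ℝ + ⟪z.2, h' j'⟫_ℝ + (θ j + θ' j') =
      ⟪z.2, h j⟫_ℝ + θ j + (⟪z.2, h' j'⟫_ℝ + θ' j') by ring, h1,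
      show ⟪z.2, h j⟫_ℝ + -⟪z.2, h' j'⟫_ℝ + (θ j + -θ' j') =
      ⟪z.2, h j⟫_ℝ + θ j - (⟪z.2, h' j'⟫_ℝ + θ' j') by ring, h2]
    ring
  add_mem' := by
    rintro q q' ⟨J, _, b, θ, h, hb, hq⟩ ⟨J', _, b', θ', h', hb', hq'⟩
    refine ⟨J ⊕ J', inferInstance, Sum.elim b b', Sum.elim θ θ', Sum.elim h h',
      Sum.rec hb hb', fun z => ?_⟩
    rw [ContinuousMap.add_apply, hq, hq', Fintype.sum_sum_type]
    rfl
  algebraMap_mem' := fun r => ⟨Unit, inferInstance, fun _ _ => r, fun _ => 0, fun _ => 0,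
    fun _ => contDiff_const, fun z => by simp⟩

variable {H}

theorem trigAlgebra_separatesPoints : (trigAlgebra H).SeparatesPoints := by
  rintro ⟨t, x⟩ ⟨t', x'⟩ hne
  by_cases ht : t = t'
  · have hx : x - x' ≠ 0 := fun h0 => hne (by rw [ht, sub_eq_zero.1 h0])
    have hn : ⟪x - x', x - x'⟫_ℝ ≠ 0 := inner_self_ne_zero.2 hx
    let k : H := (Real.pi / ⟪x - x', x - x'⟫_ℝ) • (x - x')
    let q : C(ℝ × H, ℝ) := ⟨fun z => Real.cos (⟪z.2, k⟫_ℝ + -⟪x', k⟫_ℝ), by fun_prop⟩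
    refine ⟨q, ⟨q, ⟨Unit, inferInstance, fun _ _ => 1, fun _ => -⟪x', k⟫_ℝ, fun _ => k,
      fun _ => contDiff_const, fun z => by simp [q]⟩, rfl⟩, ?_⟩
    have e : ⟪x, k⟫_ℝ + -⟪x', k⟫_ℝ = Real.pi := by
      rw [← sub_eq_add_neg, ← inner_sub_left, real_inner_smul_right]
      field_simp
    change Real.cos (⟪x, k⟫_ℝ + -⟪x', k⟫_ℝ) ≠ Real.cos (⟪x', k⟫_ℝ + -⟪x', k⟫_ℝ)
    rw [e, add_neg_cancel, Real.cos_pi, Real.cos_zero]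
    norm_num
  · let q : C(ℝ × H, ℝ) := ⟨fun z => z.1, continuous_fst⟩
    exact ⟨q, ⟨q, ⟨Unit, inferInstance, fun _ t => t, fun _ => 0, fun _ => 0,
      fun _ => contDiff_id, fun z => by simp [q]⟩, rfl⟩, ht⟩

theorem exists_bound_of_mem_trigAlgebra {q : C(ℝ × H, ℝ)} (hq : q ∈ trigAlgebra H) (T : ℝ) :
    ∃ B, ∀ t ∈ Icc 0 T, ∀ x, |q (t, x)| ≤ B := by
  obtain ⟨J, _, b, θ, h, hb, hq⟩ := hq
  have hc : ContinuousOn (fun t => ∑ j, |b j t|) (Icc 0 T) :=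
    (continuous_finsetSum _ fun j _ => (hb j).continuous.abs).continuousOn
  obtain ⟨B, hB⟩ := isCompact_Icc.exists_bound_of_continuousOn hc
  refine ⟨B, fun t ht x => ?_⟩
  rw [hq]
  refine (Finset.abs_sum_le_sum_abs _ _).trans (le_trans ?_ ((le_abs_self _).trans (hB t ht)))
  refine Finset.sum_le_sum fun j _ => ?_
  rw [abs_mul]
  exact mul_le_of_le_one_right (abs_nonneg _) (Real.abs_cos_le_one _)

/-- Approximation on a finite-dimensional subspace by trigonometric sums, with control of the
quadratic growth. -/
theorem exists_mem_trigAlgebra_near {T M : ℝ} (hM0 : 0 ≤ M) {F : C(ℝ × H, ℝ)}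
    (hF : ∀ z, |F z| ≤ M * (1 + ‖z.2‖ ^ 2)) (V : Submodule ℝ H) [FiniteDimensional ℝ V]
    {R ε : ℝ} (hR : 0 ≤ R) (hε : 0 < ε) (hε1 : ε ≤ 1) :
    ∃ q ∈ trigAlgebra H, ∀ t ∈ Icc 0 T, ∀ x ∈ V, (‖x‖ ≤ R → |q (t, x) - F (t, x)| ≤ ε) ∧
      |q (t, x)| ≤ (M + 1) * (1 + ‖x‖ ^ 2) := by
  let K : Set (ℝ × H) := Icc 0 T ×ˢ ((fun v : V => (v : H)) '' Metric.closedBall 0 R)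
  have hK : IsCompact K :=
    isCompact_Icc.prod ((isCompact_closedBall _ _).image continuous_subtype_val)
  have hKmem : ∀ t ∈ Icc 0 T, ∀ x ∈ V, ‖x‖ ≤ R → (t, x) ∈ K := fun t ht x hx hxR =>
    ⟨ht, ⟨x, hx⟩, by simpa using hxR, rfl⟩
  obtain ⟨q, hq, hqF⟩ :=
    ContinuousMap.exists_mem_subalgebra_near_continuous_of_isCompact_of_separatesPoints
      trigAlgebra_separatesPoints F hK (half_pos hε)
  obtain ⟨B, hB⟩ := exists_bound_of_mem_trigAlgebra hq T
  set c := M * (1 + R ^ 2)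
  have hc : 0 ≤ c := by positivity
  obtain ⟨P, hP⟩ := exists_polynomial_near_of_continuousOn (-B) B
    (fun r => max (-c) (min r c)) (by fun_prop) (ε / 2) (half_pos hε)
  obtain ⟨q', hq', hqP⟩ := (trigAlgebra H).exists_mem_polynomial_comp hq P
  have hclip : ∀ r, |max (-c) (min r c)| ≤ c := fun r =>
    abs_le.2 ⟨le_max_left _ _, max_le (by linarith) (min_le_right _ _)⟩
  refine ⟨q', hq', fun t ht x hx => ?_⟩
  have hPt := hP _ (abs_le.1 (hB t ht x))
  rw [← hqP] at hPt
  have near : ‖x‖ ≤ R → |q' (t, x) - F (t, x)| ≤ ε := by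
    intro hxR
    have h1 := hqF _ (hKmem t ht x hx hxR)
    have h2 : |F (t, x)| ≤ c := (hF _).trans (by dsimp only [c]; gcongr)
    have h3 : max (-c) (min (F (t, x)) c) = F (t, x) := by
      rw [min_eq_left (abs_le.1 h2).2, max_eq_right (abs_le.1 h2).1]
    have h4 : |max (-c) (min (q (t, x)) c) - F (t, x)| ≤ |q (t, x) - F (t, x)| := by
      conv_lhs => rw [← h3]
      refine (abs_max_sub_max_le_max _ _ _ _).trans ?_
      rw [sub_self, abs_zero]
      refine max_le (abs_nonneg _) ((abs_min_sub_min_le_max _ _ _ _).trans ?_)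
      rw [sub_self, abs_zero]
      exact max_le le_rfl (abs_nonneg _)
    rw [Real.norm_eq_abs] at h1
    have := abs_sub_le (q' (t, x)) (max (-c) (min (q (t, x)) c)) (F (t, x))
    linarith
  refine ⟨near, ?_⟩
  by_cases hxR : ‖x‖ ≤ R
  · have h1 := near hxR
    have h2 := hF (t, x)
    have h3 := abs_sub_abs_le_abs_sub (q' (t, x)) (F (t, x))
    dsimp only at h2
    nlinarith [sq_nonneg ‖x‖]
  · have h1 := hclip (q (t, x))
    have h2 := abs_sub_abs_le_abs_sub (q' (t, x)) (max (-c) (min (q (t, x)) c))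
    have h3 : c ≤ M * (1 + ‖x‖ ^ 2) := by
      dsimp only [c]
      gcongr
      exact (not_le.1 hxR).le
    nlinarith [sq_nonneg ‖x‖]

end TrigAlgebra

namespace FPData

variable {H : Type} [NormedAddCommGroup H] [InnerProductSpace ℝ H] [CompleteSpace H]
  [SecondCountableTopology H] [MeasurableSpace H] [BorelSpace H] {D : FPData H}

theorem MemCT.exists_bound {f : ℝ → H → ℝ} (hf : D.MemCT f) :
    ∃ M, 0 ≤ M ∧ ∀ t ∈ Icc 0 D.T, ∀ x, |f t x| ≤ M * (1 + ‖x‖ ^ 2) := by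
  have := isCompact_Icc.induction_on (s := Icc 0 D.T)
    (p := fun s => ∃ M, 0 ≤ M ∧ ∀ t ∈ s, t ∈ Icc 0 D.T → ∀ x, |f t x| ≤ M * (1 + ‖x‖ ^ 2))
    ⟨0, le_rfl, by simp⟩ (fun s s' hss ⟨M, hM0, hM⟩ => ⟨M, hM0, fun t ht => hM t (hss ht)⟩)
    (fun s s' ⟨M, hM0, hM⟩ ⟨M', hM0', hM'⟩ => ⟨M + M', by positivity, fun t ht ht' x => by
      have : 0 ≤ 1 + ‖x‖ ^ 2 := by positivity
      rcases ht with ht | ht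
      · exact (hM t ht ht' x).trans (by gcongr; linarith)
      · exact (hM' t ht ht' x).trans (by gcongr; linarith)⟩) (fun t₀ ht₀ => by
      obtain ⟨δ, hδ, h⟩ := hf.2 t₀ ht₀ 1 one_pos
      obtain ⟨M, hM⟩ := (hf.1 t₀ ht₀).2
      refine ⟨Metric.ball t₀ δ, mem_nhdsWithin_of_mem_nhds (Metric.ball_mem_nhds _ hδ),
        |M| + 1, by positivity, fun t ht ht' x => ?_⟩
      have h1 := h t ht' ht x
      have h2 := hM x
      have h3 := abs_sub_abs_le_abs_sub (f t x) (f t₀ x)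
      have h4 : M * (1 + ‖x‖ ^ 2) ≤ |M| * (1 + ‖x‖ ^ 2) := by gcongr; exact le_abs_self M
      linarith)
  obtain ⟨M, hM0, hM⟩ := this
  exact ⟨M, hM0, fun t ht => hM t ht ht⟩

theorem MemCu2.continuous {φ : H → ℝ} (hφ : MemCu2 φ) : Continuous φ := by
  have h : φ = fun x => φ x / (1 + ‖x‖ ^ 2) * (1 + ‖x‖ ^ 2) := by
    ext x
    have : 1 + ‖x‖ ^ 2 ≠ 0 := by positivity
    field_simp
  rw [h]
  exact hφ.1.continuous.mul (by fun_prop)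

theorem MemCT.continuousOn {f : ℝ → H → ℝ} (hf : D.MemCT f) :
    ContinuousOn (fun z : ℝ × H => f z.1 z.2) (Icc 0 D.T ×ˢ univ) := by
  rintro ⟨t₀, x₀⟩ ⟨ht₀, -⟩
  rw [ContinuousWithinAt, Metric.tendsto_nhds]
  intro ε hε
  dsimp only at ht₀
  have hc := MemCu2.continuous (hf.1 t₀ ht₀)
  obtain ⟨δ, hδ, h⟩ := hf.2 t₀ ht₀ (ε / (2 * (2 + ‖x₀‖ ^ 2))) (by positivity)
  have e1 : ∀ᶠ z : ℝ × H in 𝓝[Icc 0 D.T ×ˢ univ] (t₀, x₀), |z.1 - t₀| < δ :=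
    nhdsWithin_le_nhds ((continuous_fst.tendsto (t₀, x₀)).eventually (Metric.ball_mem_nhds t₀ hδ))
  have e2 : ∀ᶠ z : ℝ × H in 𝓝[Icc 0 D.T ×ˢ univ] (t₀, x₀), |f t₀ z.2 - f t₀ x₀| < ε / 2 :=
    nhdsWithin_le_nhds (((hc.comp continuous_snd).tendsto (t₀, x₀)).eventually
      (Metric.ball_mem_nhds _ (half_pos hε)))
  have e3 : ∀ᶠ z : ℝ × H in 𝓝[Icc 0 D.T ×ˢ univ] (t₀, x₀), ‖z.2‖ ^ 2 < 1 + ‖x₀‖ ^ 2 :=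
    nhdsWithin_le_nhds (((continuous_snd.norm.pow 2).tendsto (t₀, x₀)).eventually_lt_const
      (by simp))
  filter_upwards [e1, e2, e3, self_mem_nhdsWithin] with z h1 h2 h3 h4
  have h5 := h z.1 h4.1 h1 z.2
  have h6 : ε / (2 * (2 + ‖x₀‖ ^ 2)) * (1 + ‖z.2‖ ^ 2) ≤ ε / 2 := by
    rw [div_mul_eq_mul_div, div_le_div_iff₀ (by positivity) (by positivity)]
    nlinarith
  rw [Real.dist_eq]
  have := abs_sub_le (f z.1 z.2) (f t₀ z.2) (f t₀ x₀)
  linarith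

/-- Bounded operators converging strongly to the identity, with values in finite-dimensional
subspaces, and whose adjoints map into `D(A*)`. -/
theorem exists_finiteRank_approx (D : FPData H) : ∃ (K : ℝ) (P : ℕ → H →L[ℝ] H)
    (V : ℕ → Submodule ℝ H), 1 ≤ K ∧ (∀ n, FiniteDimensional ℝ (V n)) ∧ (∀ n x, P n x ∈ V n) ∧
      (∀ n x, ‖P n x‖ ≤ K * ‖x‖) ∧
      (∀ n h, ∃ g, (ContinuousLinearMap.adjoint (P n) h, g) ∈ D.A.adjoint.graph) ∧
      ∀ x, Tendsto (fun n => P n x) atTop (𝓝 x) := by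
  obtain ⟨K, hK1, hK⟩ := D.exists_norm_S_le
  have hT := D.hT
  let ε : ℕ → ℝ := fun n => D.T / (n + 1)
  have hε : ∀ n, ε n ∈ Ioc 0 D.T := fun n =>
    ⟨by dsimp only [ε]; positivity, div_le_self hT.le (by simp)⟩
  have hlim : Tendsto ε atTop (𝓝 0) := by
    have := (tendsto_one_div_add_atTop_nhds_zero_nat (𝕜 := ℝ)).const_mul D.T
    simpa [ε, div_eq_mul_inv] using this
  choose B hB hBn using fun n => D.exists_intS hK ⟨(hε n).1.le, (hε n).2⟩
  let V : ℕ → Submodule ℝ H := fun n => Submodule.span ℝ (TopologicalSpace.denseSeq H '' Iio n)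
  have hV : ∀ n, FiniteDimensional ℝ (V n) := fun n =>
    FiniteDimensional.span_of_finite ℝ ((finite_Iio n).image _)
  have hVmono : Monotone V := fun m n hmn =>
    Submodule.span_mono (image_mono (Iio_subset_Iio hmn))
  have hVtop : ⊤ ≤ (⨆ n, V n).topologicalClosure := by
    intro x _
    refine closure_mono ?_ (TopologicalSpace.denseRange_denseSeq H x)
    rintro _ ⟨n, rfl⟩
    exact Submodule.mem_iSup_of_mem (n + 1)
      (Submodule.subset_span ⟨n, Nat.lt_succ_self n, rfl⟩)
  have hproj := fun x => Submodule.starProjection_tendsto_self V hVmono x hVtop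
  have hBn' : ∀ n x, ‖(ε n)⁻¹ • B n x‖ ≤ K * ‖x‖ := by
    intro n x
    have h0 := (hε n).1
    rw [norm_smul, norm_inv, Real.norm_eq_abs, abs_of_pos h0, inv_mul_le_iff₀ h0]
    exact (hBn n x).trans_eq (by ring)
  have hBlim : ∀ x, Tendsto (fun n => (ε n)⁻¹ • B n x) atTop (𝓝 x) := fun x => by
    simp_rw [hB]
    exact D.tendsto_average hε hlim x
  have hcontr : ∀ n x, ‖(V n).starProjection x‖ ≤ ‖x‖ := fun n x =>
    Submodule.norm_starProjection_apply_le _ _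
  refine ⟨K, fun n => (V n).starProjection.comp ((ε n)⁻¹ • B n), V, hK1, hV,
    fun n x => Submodule.starProjection_apply_mem _ _,
    fun n x => (hcontr n _).trans (hBn' n x), fun n h => ?_, fun x => ?_⟩
  · obtain ⟨g, hg⟩ := D.exists_smoothing (hε n) (B n) (hB n)
      (ContinuousLinearMap.adjoint (V n).starProjection h)
    refine ⟨(ε n)⁻¹ • g, ?_⟩
    have := Submodule.smul_mem D.A.adjoint.graph (ε n)⁻¹ hg
    simpa [ContinuousLinearMap.adjoint_comp] using this
  · have h1 : Tendsto (fun n => (V n).starProjection ((ε n)⁻¹ • B n x - x)) atTop (𝓝 0) :=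
      squeeze_zero_norm (fun n => hcontr n _)
        (by simpa using ((hBlim x).sub_const x).norm)
    have := h1.add (hproj x)
    simpa [← map_add] using this

/-- Functions of `C([0,T]; C_{u,2}(H))` are limits of trigonometric sums, with continuous
convergence in the space variable and a uniform quadratic bound. -/
theorem MemCT.exists_trigSum {f : ℝ → H → ℝ} (hf : D.MemCT f) :
    ∃ (M : ℝ) (q : ℕ → D.TrigSum), 0 ≤ M ∧
      (∀ t ∈ Icc 0 D.T, ∀ x, |f t x| ≤ M * (1 + ‖x‖ ^ 2)) ∧
      (∀ n, ∀ t ∈ Icc 0 D.T, ∀ x, |(q n).ev (t, x)| ≤ M * (1 + ‖x‖ ^ 2)) ∧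
      ∀ t ∈ Icc 0 D.T, ∀ x, Tendsto (fun z : ℕ × H => (q z.1).ev (t, z.2)) (atTop ×ˢ 𝓝 x)
        (𝓝 (f t x)) := by
  obtain ⟨M, hM0, hM⟩ := hf.exists_bound
  obtain ⟨K, P, V, hK1, hV, hPV, hPK, hPA, hPlim⟩ := D.exists_finiteRank_approx
  have hT := D.hT.le
  let F : C(ℝ × H, ℝ) := ⟨fun z => f (projIcc 0 D.T hT z.1) z.2,
    hf.continuousOn.comp_continuous (f := fun z : ℝ × H => ((projIcc 0 D.T hT z.1 : ℝ), z.2))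
      (by fun_prop) fun z => ⟨Subtype.coe_prop _, mem_univ _⟩⟩
  have hFf : ∀ t ∈ Icc 0 D.T, ∀ x, F (t, x) = f t x := fun t ht x => by
    simp only [F, ContinuousMap.coe_mk, projIcc_of_mem hT ht]
  choose q hq hqF using fun n : ℕ => exists_mem_trigAlgebra_near (T := D.T) hM0 (F := F)
    (fun z => hM _ (Subtype.coe_prop _) _) (V n) (R := n) (ε := 1 / ((n : ℝ) + 1))
    (by positivity) (by positivity) (by
      rw [div_le_one (by positivity)]; linarith [n.cast_nonneg (α := ℝ)])
  choose J hJ b θ h hb hqe using hq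
  choose g hg using hPA
  let p : ℕ → D.TrigSum := fun n => ⟨J n, hJ n, b n, θ n,
    fun j => ContinuousLinearMap.adjoint (P n) (h n j), fun j => g n (h n j), hb n,
    fun j => hg n (h n j)⟩
  have hp : ∀ n t x, (p n).ev (t, x) = q n (t, P n x) := by
    intro n t x
    rw [hqe]
    refine Finset.sum_congr rfl fun (j : J n) _ => ?_
    simp only [p, ContinuousLinearMap.adjoint_inner_right]
  have hK2 : 1 ≤ K ^ 2 := one_le_pow₀ hK1
  refine ⟨(M + 1) * K ^ 2, p, by positivity, fun t ht x => ?_, fun n t ht x => ?_,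
    fun t ht x => ?_⟩
  · refine (hM t ht x).trans ?_
    gcongr
    nlinarith
  · rw [hp]
    refine (hqF n t ht _ (hPV n x)).2.trans ?_
    rw [mul_assoc]
    gcongr
    have : ‖P n x‖ ^ 2 ≤ (K * ‖x‖) ^ 2 := by gcongr; exact hPK n x
    nlinarith
  · have hPx : Tendsto (fun z : ℕ × H => P z.1 z.2) (atTop ×ˢ 𝓝 x) (𝓝 x) := by
      have h1 : Tendsto (fun z : ℕ × H => P z.1 (z.2 - x)) (atTop ×ˢ 𝓝 x) (𝓝 0) := by
        refine squeeze_zero_norm (fun z => hPK z.1 _) ?_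
        have : Tendsto (fun y : H => K * ‖y - x‖) (𝓝 x) (𝓝 (K * ‖x - x‖)) :=
          Continuous.tendsto (by fun_prop) x
        rw [sub_self, norm_zero, mul_zero] at this
        exact this.comp tendsto_snd
      have := h1.add ((hPlim x).comp tendsto_fst)
      simpa using this
    have hFx : Tendsto (fun z : ℕ × H => F (t, P z.1 z.2)) (atTop ×ˢ 𝓝 x) (𝓝 (f t x)) := by
      rw [← hFf t ht x]
      exact ((F.continuous.comp (Continuous.prodMk_right t)).tendsto x).comp hPx
    have hd : Tendsto (fun z : ℕ × H => (p z.1).ev (t, z.2) - F (t, P z.1 z.2)) (atTop ×ˢ 𝓝 x)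
        (𝓝 0) := by
      have h0 : Tendsto (fun z : ℕ × H => 1 / ((z.1 : ℝ) + 1)) (atTop ×ˢ 𝓝 x) (𝓝 0) :=
        tendsto_one_div_add_atTop_nhds_zero_nat.comp tendsto_fst
      refine squeeze_zero_norm' ?_ h0
      have e1 : ∀ᶠ z : ℕ × H in atTop ×ˢ 𝓝 x, ‖P z.1 z.2‖ < ‖x‖ + 1 :=
        hPx.norm.eventually_lt_const (by linarith)
      have e2 : ∀ᶠ z : ℕ × H in atTop ×ˢ 𝓝 x, ‖x‖ + 1 ≤ (z.1 : ℝ) :=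
        (tendsto_natCast_atTop_atTop.comp tendsto_fst).eventually_ge_atTop _
      filter_upwards [e1, e2] with z h1 h2
      rw [hp]
      exact (hqF z.1 t ht _ (hPV _ _)).1 (h1.le.trans h2)
    simpa using hd.add hFx

end FPData

end Approximation

section HeatLimits

set_option linter.unusedSectionVars false

namespace FPData

variable {H : Type} [NormedAddCommGroup H] [InnerProductSpace ℝ H] [CompleteSpace H]
  [SecondCountableTopology H] [MeasurableSpace H] [BorelSpace H] {D : FPData H}
  {hyp : D.Hyp31}

theorem Hyp31.intervalIntegrable_norm_Λ (hyp : D.Hyp31) :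
    IntervalIntegrable (fun s => ‖hyp.Λ s‖) volume 0 D.T := by
  have h : IntervalIntegrable (fun s => Real.exp (-hyp.lam₀ * s) * ‖hyp.Λ s‖) volume 0 D.T := by
    rw [intervalIntegrable_iff_integrableOn_Ioc_of_le D.hT.le]
    exact (hyp.Λ_int _ le_rfl).mono_set Ioc_subset_Ioi_self
  have h2 := h.continuousOn_mul
    (g := fun s => Real.exp (hyp.lam₀ * s)) (by fun_prop : Continuous _).continuousOn
  refine h2.congr fun s _ => ?_
  rw [← mul_assoc, ← Real.exp_add]
  simp

theorem OUData.exists_moment_constants (O : D.OUData hyp) : ∃ κ m : ℝ, 0 ≤ κ ∧ 0 ≤ m ∧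
    ∀ s ∈ Ioc 0 D.T,
      (∀ x y, 1 + ‖D.S s x + y‖ ^ 2 ≤ κ * (1 + ‖x‖ ^ 2) * (1 + ‖y‖ ^ 2)) ∧
      Integrable (fun y => 1 + ‖y‖ ^ 2) (O.N s) ∧ Integrable (fun y => (1 + ‖y‖ ^ 2) ^ 2) (O.N s) ∧
      ∫ y, (1 + ‖y‖ ^ 2) ∂(O.N s) ≤ m ∧ ∫ y, (1 + ‖y‖ ^ 2) ^ 2 ∂(O.N s) ≤ m ^ 2 := by
  obtain ⟨M, hM1, hM⟩ := D.exists_norm_S_le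
  obtain ⟨m, hm⟩ := O.exists_moment_bound
  refine ⟨2 * M ^ 2, max m 1, by positivity, by positivity, fun s hs => ?_⟩
  obtain ⟨hi, hle⟩ := hm s hs
  have hle' : ∀ y : H, 1 + ‖y‖ ^ 2 ≤ (1 + ‖y‖ ^ 2) ^ 2 := fun y => by nlinarith [sq_nonneg ‖y‖]
  have hi' : Integrable (fun y : H => 1 + ‖y‖ ^ 2) (O.N s) :=
    hi.mono' (by fun_prop : Continuous _).aestronglyMeasurable (ae_of_all _ fun y => by
      rw [Real.norm_of_nonneg (by positivity)]; exact hle' y)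
  refine ⟨fun x y => one_add_norm_S_add_le hM1 (hM s ⟨hs.1.le, hs.2⟩) x y, hi', hi,
    (integral_mono hi' hi hle').trans (hle.trans (le_max_left _ _)), hle.trans ?_⟩
  nlinarith [le_max_left m 1, le_max_right m 1]

namespace TrigSum

theorem exists_heat_bound (O : D.OUData hyp) (lam : ℝ) : ∃ C : ℝ, 0 ≤ C ∧
    ∀ (p : D.TrigSum) (B : ℝ), 0 ≤ B → (∀ r, 0 ≤ r → ∀ z, |p.ev (r, z)| ≤ B * (1 + ‖z‖ ^ 2)) →
      ∀ s ∈ Ioc 0 D.T, ∀ t, 0 ≤ t → ∀ x,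
        |(p.heat lam s).ev (t, x)| ≤ C * B * (1 + ‖x‖ ^ 2) ∧
        ‖(p.heat lam s).gr (t, x)‖ ≤ C * B * (1 + ‖x‖ ^ 2) * ‖hyp.Λ s‖ := by
  obtain ⟨κ, m, hκ, hm, hO⟩ := O.exists_moment_constants
  refine ⟨Real.exp (|lam| * D.T) * (κ * m), by positivity, fun p B hB hp s hs t ht x => ?_⟩
  obtain ⟨hS, hi1, hi2, hm1, hm2⟩ := hO s hs
  have hexp : Real.exp (-lam * s) ≤ Real.exp (|lam| * D.T) := by
    refine Real.exp_le_exp.2 ?_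
    have := neg_abs_le lam
    have := abs_nonneg lam
    have := hs.1
    have := hs.2
    nlinarith
  have hb : ∀ y, |p.ev (t + s, D.S s x + y)| ≤ B * κ * (1 + ‖x‖ ^ 2) * (1 + ‖y‖ ^ 2) := by
    intro y
    refine (hp _ (by linarith [hs.1]) _).trans ?_
    calc B * (1 + ‖D.S s x + y‖ ^ 2) ≤ B * (κ * (1 + ‖x‖ ^ 2) * (1 + ‖y‖ ^ 2)) := by
          gcongr; exact hS x y
      _ = _ := by ring
  set c := B * κ * (1 + ‖x‖ ^ 2) with hc
  have hc0 : 0 ≤ c := by positivity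
  constructor
  · rw [p.ev_heat lam O hs, abs_mul, Real.abs_exp]
    have h1 : |∫ y, p.ev (t + s, D.S s x + y) ∂(O.N s)| ≤ c * m := by
      rw [← Real.norm_eq_abs]
      refine (norm_integral_le_of_norm_le (hi1.const_mul c) (ae_of_all _ hb)).trans ?_
      rw [integral_const_mul]
      gcongr
    calc _ ≤ Real.exp (|lam| * D.T) * (c * m) := by gcongr
      _ = _ := by rw [hc]; ring
  · refine (p.norm_gr_heat_le lam O hs t x).trans ?_
    have h1 : √(∫ y, p.ev (t + s, D.S s x + y) ^ 2 ∂(O.N s)) ≤ c * m := by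
      refine Real.sqrt_le_iff.2 ⟨by positivity, ?_⟩
      have : ∫ y, p.ev (t + s, D.S s x + y) ^ 2 ∂(O.N s) ≤
          ∫ y, c ^ 2 * (1 + ‖y‖ ^ 2) ^ 2 ∂(O.N s) := by
        refine integral_mono_of_nonneg (ae_of_all _ fun y => sq_nonneg _) (hi2.const_mul _)
          (ae_of_all _ fun y => ?_)
        dsimp only
        rw [← mul_pow, ← sq_abs]
        gcongr
        exact hb y
      rw [integral_const_mul] at this
      refine this.trans ?_
      rw [mul_pow c m]
      gcongr
    calc _ ≤ Real.exp (|lam| * D.T) * ‖hyp.Λ s‖ * (c * m) := by gcongr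
      _ = _ := by rw [hc]; ring

theorem exists_integral_heat_bound (O : D.OUData hyp) (lam : ℝ) : ∃ C : ℝ, 0 ≤ C ∧
    ∀ (p : D.TrigSum) (B : ℝ), 0 ≤ B → (∀ r, 0 ≤ r → ∀ z, |p.ev (r, z)| ≤ B * (1 + ‖z‖ ^ 2)) →
      ∀ t, 0 ≤ t → ∀ x,
        |∫ s in (0 : ℝ)..D.T, (p.heat lam s).ev (t, x)| ≤ C * B * (1 + ‖x‖ ^ 2) ∧
        ‖∫ s in (0 : ℝ)..D.T, (p.heat lam s).gr (t, x)‖ ≤ C * B * (1 + ‖x‖ ^ 2) := by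
  obtain ⟨C, hC, h⟩ := exists_heat_bound O lam
  have hT := D.hT.le
  set L := ∫ s in (0 : ℝ)..D.T, ‖hyp.Λ s‖
  have hL : 0 ≤ L := intervalIntegral.integral_nonneg hT fun s _ => norm_nonneg _
  refine ⟨C * D.T + C * L, by positivity, fun p B hB hp t ht x => ⟨?_, ?_⟩⟩
  · have := intervalIntegral.norm_integral_le_of_norm_le_const (a := 0) (b := D.T)
      (f := fun s => (p.heat lam s).ev (t, x)) (C := C * B * (1 + ‖x‖ ^ 2)) (fun s hs => by
        rw [uIoc_of_le hT] at hs
        exact (h p B hB hp s hs t ht x).1)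
    rw [Real.norm_eq_abs, sub_zero, abs_of_nonneg hT] at this
    have h2 : 0 ≤ C * L * B * (1 + ‖x‖ ^ 2) := by positivity
    linarith
  · have := intervalIntegral.norm_integral_le_of_norm_le (a := 0) (b := D.T) (μ := volume) hT
      (f := fun s => (p.heat lam s).gr (t, x))
      (g := fun s => C * B * (1 + ‖x‖ ^ 2) * ‖hyp.Λ s‖)
      (ae_of_all _ fun s hs => (h p B hB hp s hs t ht x).2)
      (hyp.intervalIntegrable_norm_Λ.const_mul _)
    rw [intervalIntegral.integral_const_mul] at this
    have h2 : 0 ≤ C * D.T * B * (1 + ‖x‖ ^ 2) := by positivity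
    change _ ≤ C * B * (1 + ‖x‖ ^ 2) * L at this
    linarith

section Limits

variable {p : ℕ → D.TrigSum} {M : ℝ} {φ : ℝ → H → ℝ}

theorem tendsto_integral_ev_heat (O : D.OUData hyp) (lam : ℝ) (hM : 0 ≤ M)
    (hp : ∀ n r, 0 ≤ r → ∀ z, |(p n).ev (r, z)| ≤ M * (1 + ‖z‖ ^ 2))
    (hφ : ∀ r, 0 ≤ r → ∀ x, Tendsto (fun z : ℕ × H => (p z.1).ev (r, z.2)) (atTop ×ˢ 𝓝 x)
      (𝓝 (φ r x))) {t : ℝ} (ht : t ∈ Icc 0 D.T) (x : H) :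
    Tendsto (fun n => ∫ s in (0 : ℝ)..D.T, ((p n).heat lam s).ev (t, x)) atTop
      (𝓝 (∫ s in (0 : ℝ)..D.T, Real.exp (-lam * s) *
        ∫ y, φ (t + s) (D.S s x + y) ∂(O.N s))) := by
  obtain ⟨C, hC, h⟩ := exists_heat_bound O lam
  obtain ⟨κ, m, hκ, hm, hO⟩ := O.exists_moment_constants
  have hT := D.hT.le
  refine intervalIntegral.tendsto_integral_filter_of_dominated_convergence
    (fun _ => C * M * (1 + ‖x‖ ^ 2)) (Eventually.of_forall fun n => ?_)
    (Eventually.of_forall fun n => ae_of_all _ fun s hs => ?_) intervalIntegrable_const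
    (ae_of_all _ fun s hs => ?_)
  · rw [uIoc_of_le hT]
    exact (((p n).ev_heat_continuousOn lam t x).mono Ioc_subset_Icc_self).aestronglyMeasurable
      measurableSet_Ioc
  · rw [uIoc_of_le hT] at hs
    exact (h (p n) M hM (hp n) s hs t ht.1 x).1
  · rw [uIoc_of_le hT] at hs
    obtain ⟨hS, hi1, -⟩ := hO s hs
    simp_rw [fun n => (p n).ev_heat lam O hs t x]
    refine Tendsto.const_mul _ (tendsto_integral_filter_of_dominated_convergence
      (fun y => M * (κ * (1 + ‖x‖ ^ 2)) * (1 + ‖y‖ ^ 2)) (Eventually.of_forall fun n => ?_)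
      (Eventually.of_forall fun n => ae_of_all _ fun y => ?_) (hi1.const_mul _)
      (ae_of_all _ fun y => ?_))
    · have := (p n).ev_continuous
      exact (by fun_prop : Continuous fun y => (p n).ev (t + s, D.S s x + y)).aestronglyMeasurable
    · refine (hp n _ (by linarith [hs.1, ht.1]) _).trans ?_
      rw [mul_assoc]
      gcongr
      exact hS x y
    · exact (hφ _ (by linarith [hs.1, ht.1]) _).comp (tendsto_id.prodMk tendsto_const_nhds)

theorem tendsto_gr_heat_sub (O : D.OUData hyp) (lam : ℝ) (hM : 0 ≤ M)
    (hp : ∀ n r, 0 ≤ r → ∀ z, |(p n).ev (r, z)| ≤ M * (1 + ‖z‖ ^ 2))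
    (hφ : ∀ r, 0 ≤ r → ∀ x, Tendsto (fun z : ℕ × H => (p z.1).ev (r, z.2)) (atTop ×ˢ 𝓝 x)
      (𝓝 (φ r x))) {t : ℝ} (ht : t ∈ Icc 0 D.T) (x : H) {s : ℝ} (hs : s ∈ Ioc 0 D.T) :
    Tendsto (fun z : (ℕ × ℕ) × H => (((p z.1.1).sub (p z.1.2)).heat lam s).gr (t, z.2))
      ((atTop ×ˢ atTop) ×ˢ 𝓝 x) (𝓝 0) := by
  obtain ⟨κ, m, hκ, hm, hO⟩ := O.exists_moment_constants
  obtain ⟨hS, -, hi2, -⟩ := hO s hs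
  have hts : 0 ≤ t + s := by linarith [hs.1, ht.1]
  have hx : ∀ᶠ z : (ℕ × ℕ) × H in (atTop ×ˢ atTop) ×ˢ 𝓝 x, ‖z.2‖ ^ 2 < 1 + ‖x‖ ^ 2 :=
    (((continuous_norm.pow 2).tendsto x).comp tendsto_snd).eventually_lt_const (by simp)
  have hint : Tendsto (fun z : (ℕ × ℕ) × H =>
      ∫ y, ((p z.1.1).sub (p z.1.2)).ev (t + s, D.S s z.2 + y) ^ 2 ∂(O.N s))
      ((atTop ×ˢ atTop) ×ˢ 𝓝 x) (𝓝 (∫ _, 0 ∂(O.N s))) := by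
    refine tendsto_integral_filter_of_dominated_convergence
      (fun y => (2 * M * (κ * (2 + ‖x‖ ^ 2))) ^ 2 * (1 + ‖y‖ ^ 2) ^ 2)
      (Eventually.of_forall fun z => ?_) ?_ (hi2.const_mul _) (ae_of_all _ fun y => ?_)
    · have := ((p z.1.1).sub (p z.1.2)).ev_continuous
      exact (by fun_prop : Continuous fun y =>
        ((p z.1.1).sub (p z.1.2)).ev (t + s, D.S s z.2 + y) ^ 2).aestronglyMeasurable
    · filter_upwards [hx] with z hz
      refine ae_of_all _ fun y => ?_
      rw [norm_pow, ← mul_pow, Real.norm_eq_abs, ev_sub]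
      gcongr
      have h1 := hp z.1.1 _ hts (D.S s z.2 + y)
      have h2 := hp z.1.2 _ hts (D.S s z.2 + y)
      have h3 : M * (1 + ‖D.S s z.2 + y‖ ^ 2) ≤ M * (κ * (2 + ‖x‖ ^ 2) * (1 + ‖y‖ ^ 2)) := by
        gcongr
        refine (hS z.2 y).trans ?_
        gcongr κ * ?_ * _
        linarith
      have h4 := abs_sub ((p z.1.1).ev (t + s, D.S s z.2 + y))
        ((p z.1.2).ev (t + s, D.S s z.2 + y))
      linarith
    · have hy : Tendsto (fun z : (ℕ × ℕ) × H => D.S s z.2 + y) ((atTop ×ˢ atTop) ×ˢ 𝓝 x)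
          (𝓝 (D.S s x + y)) :=
        ((by fun_prop : Continuous fun x' => D.S s x' + y).tendsto x).comp tendsto_snd
      have h1 := (hφ _ hts (D.S s x + y)).comp ((tendsto_fst.comp tendsto_fst).prodMk hy)
      have h2 := (hφ _ hts (D.S s x + y)).comp ((tendsto_snd.comp tendsto_fst).prodMk hy)
      have := (h1.sub h2).pow 2
      simpa [Function.comp_def, ev_sub] using this
  refine squeeze_zero_norm (fun z => norm_gr_heat_le _ lam O hs t z.2) ?_
  have := (hint.sqrt).const_mul (Real.exp (-lam * s) * ‖hyp.Λ s‖)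
  simpa using this

theorem tendsto_integral_gr_heat_sub (O : D.OUData hyp) (lam : ℝ) (hM : 0 ≤ M)
    (hp : ∀ n r, 0 ≤ r → ∀ z, |(p n).ev (r, z)| ≤ M * (1 + ‖z‖ ^ 2))
    (hφ : ∀ r, 0 ≤ r → ∀ x, Tendsto (fun z : ℕ × H => (p z.1).ev (r, z.2)) (atTop ×ˢ 𝓝 x)
      (𝓝 (φ r x))) {t : ℝ} (ht : t ∈ Icc 0 D.T) (x : H) :
    Tendsto (fun z : (ℕ × ℕ) × H => (∫ s in (0 : ℝ)..D.T, ((p z.1.1).heat lam s).gr (t, z.2)) -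
      ∫ s in (0 : ℝ)..D.T, ((p z.1.2).heat lam s).gr (t, z.2))
      ((atTop ×ˢ atTop) ×ˢ 𝓝 x) (𝓝 0) := by
  obtain ⟨C, hC, h⟩ := exists_heat_bound O lam
  have hT := D.hT.le
  have hcont : ∀ (q : D.TrigSum) (x' : H),
      ContinuousOn (fun s => (q.heat lam s).gr (t, x')) (Icc 0 D.T) := fun q x' =>
    (q.weightedEquicont_gr lam).continuousOn ht x'
  have hint : ∀ (q : D.TrigSum) (x' : H),
      IntervalIntegrable (fun s => (q.heat lam s).gr (t, x')) volume 0 D.T := fun q x' =>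
    ContinuousOn.intervalIntegrable (by rw [uIcc_of_le hT]; exact hcont q x')
  have hx : ∀ᶠ z : (ℕ × ℕ) × H in (atTop ×ˢ atTop) ×ˢ 𝓝 x, ‖z.2‖ ^ 2 < 1 + ‖x‖ ^ 2 :=
    (((continuous_norm.pow 2).tendsto x).comp tendsto_snd).eventually_lt_const (by simp)
  simp_rw [← intervalIntegral.integral_sub (hint _ _) (hint _ _), ← gr_heat_sub]
  rw [← intervalIntegral.integral_zero (a := 0) (b := D.T) (μ := volume) (E := H)]
  refine intervalIntegral.tendsto_integral_filter_of_dominated_convergence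
    (fun s => C * (2 * M) * (2 + ‖x‖ ^ 2) * ‖hyp.Λ s‖) (Eventually.of_forall fun z => ?_)
    ?_ (hyp.intervalIntegrable_norm_Λ.const_mul _) (ae_of_all _ fun s hs => ?_)
  · rw [uIoc_of_le hT]
    exact ((hcont _ z.2).mono Ioc_subset_Icc_self).aestronglyMeasurable measurableSet_Ioc
  · filter_upwards [hx] with z hz
    refine ae_of_all _ fun s hs => ?_
    rw [uIoc_of_le hT] at hs
    refine (h ((p z.1.1).sub (p z.1.2)) (2 * M) (by positivity) (fun r hr y => ?_) s hs t ht.1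
      z.2).2.trans ?_
    · rw [ev_sub]
      refine (abs_sub _ _).trans ?_
      linarith [hp z.1.1 r hr y, hp z.1.2 r hr y]
    · gcongr ?_ * _
      gcongr C * (2 * M) * ?_
      linarith
  · rw [uIoc_of_le hT] at hs
    exact tendsto_gr_heat_sub O lam hM hp hφ ht x hs

end Limits

end TrigSum

/-- The resolvent only sees the values of `f` before the final time. -/
theorem OUData.Gop_eq (O : D.OUData hyp) (lam : ℝ) (f : ℝ → H → ℝ) {t : ℝ} (ht : t ∈ Icc 0 D.T)
    (x : H) : O.Gop lam f (t, x) = ∫ s in (0 : ℝ)..D.T, Real.exp (-lam * s) *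
      ∫ y, (if t + s < D.T then f (t + s) (D.S s x + y) else 0) ∂(O.N s) := by
  have hle : 0 ≤ D.T - t := sub_nonneg.2 ht.2
  have e : O.Gop lam f (t, x) = ∫ s in (0 : ℝ)..(D.T - t), Real.exp (-lam * s) *
      ∫ y, f (t + s) (D.S s x + y) ∂(O.N s) := by
    have := intervalIntegral.integral_comp_sub_right (a := t) (b := D.T)
      (fun s => Real.exp (-lam * s) * ∫ y, f (t + s) (D.S s x + y) ∂(O.N s)) t
    rw [sub_self] at this
    rw [← this]
    simp only [OUData.Gop, OUData.Rop, add_sub_cancel]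
  rw [e, intervalIntegral.integral_of_le hle, intervalIntegral.integral_of_le D.hT.le,
    setIntegral_eq_of_subset_of_forall_sdiff_eq_zero (s := Ioo 0 (D.T - t)) (t := Ioc 0 D.T)
      measurableSet_Ioc,
    integral_Ioc_eq_integral_Ioo]
  · refine setIntegral_congr_fun measurableSet_Ioo fun s hs => ?_
    have : t + s < D.T := by linarith [hs.2]
    simp only [this, if_true]
  · exact fun s hs => ⟨hs.1, by linarith [hs.2, ht.1]⟩
  · rintro s ⟨hs, hs'⟩
    have : ¬ t + s < D.T := fun h => hs' ⟨hs.1, by linarith⟩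
    simp only [this, if_false, integral_zero, mul_zero]

end FPData

end HeatLimits

section ResolventApproximation

set_option linter.unusedSectionVars false

theorem contDiff_smoothTransition_mul_sub (T : ℝ) (n : ℕ) :
    ContDiff ℝ 1 fun t : ℝ => Real.smoothTransition (n * (T - t)) := by
  have h : ContDiff ℝ 1 Real.smoothTransition := mod_cast Real.smoothTransition.contDiff (n := 1)
  exact h.comp (contDiff_const.mul (contDiff_const.sub contDiff_id))

theorem contDiff_sub_mul_exp (T m : ℝ) :
    ContDiff ℝ 1 fun t : ℝ => (T - t) * Real.exp (-(m * (T - t))) :=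
  (contDiff_const.sub contDiff_id).mul
    (contDiff_const.mul (contDiff_const.sub contDiff_id)).neg.exp

theorem deriv_sub_mul_exp (T m t : ℝ) :
    deriv (fun t : ℝ => (T - t) * Real.exp (-(m * (T - t)))) t =
      (m * (T - t) - 1) * Real.exp (-(m * (T - t))) := by
  have h1 : HasDerivAt (fun t : ℝ => T - t) (-1) t := by
    simpa using (hasDerivAt_id t).const_sub T
  have := (h1.mul (h1.const_mul m).neg.exp).deriv
  refine Eq.trans this ?_
  simp only [Pi.neg_apply]
  ring

theorem abs_sub_one_mul_exp_le {w : ℝ} (hw : 0 ≤ w) : |(w - 1) * Real.exp (-w)| ≤ 1 := by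
  rw [abs_mul, Real.abs_exp, Real.exp_neg, ← div_eq_mul_inv, div_le_one (Real.exp_pos _)]
  have := Real.add_one_le_exp w
  exact abs_le.2 ⟨by linarith, by linarith⟩

theorem sub_mul_exp_le {T m t : ℝ} (hm : 0 < m) (ht : t ≤ T) :
    |(T - t) * Real.exp (-(m * (T - t)))| ≤ 1 / m := by
  have h : 0 ≤ T - t := sub_nonneg.2 ht
  rw [abs_of_nonneg (by positivity), Real.exp_neg, ← div_eq_mul_inv,
    div_le_div_iff₀ (Real.exp_pos _) hm]
  have := Real.add_one_le_exp (m * (T - t))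
  linarith

theorem tendsto_sub_one_mul_exp :
    Tendsto (fun w : ℝ => (w - 1) * Real.exp (-w)) atTop (𝓝 0) := by
  have := (Real.tendsto_pow_mul_exp_neg_atTop_nhds_zero 1).sub
    (Real.tendsto_pow_mul_exp_neg_atTop_nhds_zero 0)
  simpa [sub_mul] using this

/-- A pointwise limit is differentiable if the gradients are locally uniformly Cauchy. -/
theorem exists_hasGradientAt_of_cauchy {H : Type*} [NormedAddCommGroup H] [InnerProductSpace ℝ H]
    [CompleteSpace H] {v : ℕ → H → ℝ} {g : ℕ → H → H} {u : H → ℝ}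
    (hg : ∀ n x, HasGradientAt (v n) (g n x) x) (hv : ∀ x, Tendsto (fun n => v n x) atTop (𝓝 (u x)))
    (hc : ∀ x, Tendsto (fun z : (ℕ × ℕ) × H => g z.1.1 z.2 - g z.1.2 z.2)
      ((atTop ×ˢ atTop) ×ˢ 𝓝 x) (𝓝 0)) :
    ∃ G : H → H, ∀ x, HasGradientAt u (G x) x ∧ Tendsto (fun n => g n x) atTop (𝓝 (G x)) := by
  have hcauchy : ∀ x, CauchySeq fun n => g n x := fun x => by
    rw [cauchySeq_iff_tendsto_dist_atTop_0, ← prod_atTop_atTop_eq]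
    have := ((hc x).comp (tendsto_id.prodMk
      (tendsto_const_nhds (x := x) (f := (atTop : Filter ℕ) ×ˢ (atTop : Filter ℕ))))).norm
    simpa [Function.comp_def, dist_eq_norm] using this
  choose G hG using fun x => cauchySeq_tendsto_of_complete (hcauchy x)
  refine ⟨G, fun x => ⟨?_, hG x⟩⟩
  rw [hasGradientAt_iff_hasFDerivAt]
  let J := InnerProductSpace.toDual ℝ H
  refine hasFDerivAt_of_tendstoUniformlyOnFilter (l := atTop) (f := v)
    (f' := fun n y => J (g n y)) (g' := fun y => J (G y)) ?_
    (Eventually.of_forall fun n => (hg n.1 n.2).hasFDerivAt) (Eventually.of_forall hv)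
  refine UniformCauchySeqOnFilter.tendstoUniformlyOnFilter_of_tendsto (fun U hU => ?_)
    (Eventually.of_forall fun y => (J.continuous.tendsto _).comp (hG y))
  obtain ⟨ε, hε, hεU⟩ := Metric.mem_uniformity_dist.1 hU
  have := (hc x).norm.eventually_lt_const (by simpa using hε)
  filter_upwards [this] with z hz
  refine hεU ?_
  rw [J.dist_map, dist_eq_norm]
  exact hz

namespace FPData

variable {H : Type} [NormedAddCommGroup H] [InnerProductSpace ℝ H] [CompleteSpace H]
  [SecondCountableTopology H] [MeasurableSpace H] [BorelSpace H] {D : FPData H}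
  {hyp : D.Hyp31}

namespace TrigSum

theorem exists_bound (p : D.TrigSum) : ∃ W : ℝ, 0 ≤ W ∧ ∀ t ∈ Icc 0 D.T, ∀ x,
    ‖p.gr (t, x)‖ ≤ W * (1 + ‖x‖ ^ 2) ∧ |p.vz (t, x)| ≤ W * (1 + ‖x‖ ^ 2) := by
  have hb := p.b_continuous
  have hb' := p.deriv_b_continuous
  have hc : Continuous fun t => ∑ j, (|p.b j t| * ‖p.h j‖ + |deriv (p.b j) t| +
      |p.b j t| * (|1 / 2 * ⟪D.C (p.h j), p.h j⟫_ℝ| + ‖p.g j‖)) := by fun_prop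
  obtain ⟨W, hW⟩ := (isCompact_Icc (a := (0 : ℝ)) (b := D.T)).exists_bound_of_continuousOn
    hc.continuousOn
  refine ⟨max W 0, le_max_right _ _, fun t ht x => ?_⟩
  have hle := ((le_abs_self _).trans (hW t ht)).trans (le_max_left W 0)
  have hx : 1 ≤ 1 + ‖x‖ ^ 2 := by nlinarith [sq_nonneg ‖x‖]
  have hx' : ‖x‖ ≤ 1 + ‖x‖ ^ 2 := by nlinarith [sq_nonneg (‖x‖ - 1)]
  constructor
  · refine (norm_sum_le _ _).trans (le_trans ?_ (mul_le_mul_of_nonneg_right hle (by positivity)))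
    rw [Finset.sum_mul]
    refine Finset.sum_le_sum fun j _ => ?_
    rw [norm_smul, norm_neg, norm_mul, Real.norm_eq_abs, Real.norm_eq_abs]
    calc _ ≤ |p.b j t| * 1 * ‖p.h j‖ := by gcongr; exact Real.abs_sin_le_one _
      _ = |p.b j t| * ‖p.h j‖ * 1 := by ring
      _ ≤ _ := by
        gcongr
        have h1 := abs_nonneg (deriv (p.b j) t)
        have : 0 ≤ |p.b j t| * (|1 / 2 * ⟪D.C (p.h j), p.h j⟫_ℝ| + ‖p.g j‖) := by positivity
        linarith
  · refine (Finset.abs_sum_le_sum_abs _ _).trans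
      (le_trans ?_ (mul_le_mul_of_nonneg_right hle (by positivity)))
    rw [Finset.sum_mul]
    refine Finset.sum_le_sum fun j _ => ?_
    set cj := Real.cos (⟪x, p.h j⟫_ℝ + p.θ j)
    set sj := Real.sin (⟪x, p.h j⟫_ℝ + p.θ j)
    have hcj : |cj| ≤ 1 := Real.abs_cos_le_one _
    have hsj : |sj| ≤ 1 := Real.abs_sin_le_one _
    set X := 1 + ‖x‖ ^ 2
    have h1 : |deriv (p.b j) t * cj| ≤ |deriv (p.b j) t| * X := by
      rw [abs_mul]; gcongr; exact hcj.trans hx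
    have h2 : |1 / 2 * ⟪D.C (p.h j), p.h j⟫_ℝ * cj| ≤ |1 / 2 * ⟪D.C (p.h j), p.h j⟫_ℝ| * X := by
      rw [abs_mul]; gcongr; exact hcj.trans hx
    have h3 : |⟪x, p.g j⟫_ℝ * sj| ≤ ‖p.g j‖ * X := by
      rw [abs_mul]
      calc |⟪x, p.g j⟫_ℝ| * |sj| ≤ (‖x‖ * ‖p.g j‖) * 1 := by
            gcongr; exact abs_real_inner_le_norm _ _
        _ = ‖p.g j‖ * ‖x‖ := by ring
        _ ≤ _ := by gcongr
    have h4 : |p.b j t * (1 / 2 * ⟪D.C (p.h j), p.h j⟫_ℝ * cj + ⟪x, p.g j⟫_ℝ * sj)| ≤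
        |p.b j t| * ((|1 / 2 * ⟪D.C (p.h j), p.h j⟫_ℝ| + ‖p.g j‖) * X) := by
      rw [abs_mul]
      gcongr
      refine (abs_add_le _ _).trans ?_
      rw [add_mul]
      exact add_le_add h2 h3
    have h5 : 0 ≤ |p.b j t| * ‖p.h j‖ * X := by positivity
    refine (abs_sub _ _).trans ?_
    rw [add_mul, add_mul]
    have := add_le_add h1 h4
    linarith

variable {q : ℕ → D.TrigSum} {M : ℝ} {f : ℝ → H → ℝ}

/-- Smooth truncation at the final time. -/
theorem exists_cutoff (hM : 0 ≤ M)
    (hq : ∀ n, ∀ t ∈ Icc 0 D.T, ∀ x, |(q n).ev (t, x)| ≤ M * (1 + ‖x‖ ^ 2))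
    (hqf : ∀ t ∈ Icc 0 D.T, ∀ x, Tendsto (fun z : ℕ × H => (q z.1).ev (t, z.2)) (atTop ×ˢ 𝓝 x)
      (𝓝 (f t x))) :
    ∃ p : ℕ → D.TrigSum, (∀ n j t, D.T ≤ t → (p n).b j t = 0) ∧
      (∀ n r, 0 ≤ r → ∀ z, |(p n).ev (r, z)| ≤ M * (1 + ‖z‖ ^ 2)) ∧
      ∀ r, 0 ≤ r → ∀ x, Tendsto (fun z : ℕ × H => (p z.1).ev (r, z.2)) (atTop ×ˢ 𝓝 x)
        (𝓝 (if r < D.T then f r x else 0)) := by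
  have hzero : ∀ (n : ℕ) (t : ℝ), D.T ≤ t → Real.smoothTransition (n * (D.T - t)) = 0 :=
    fun n t ht => Real.smoothTransition.zero_of_nonpos
      (mul_nonpos_of_nonneg_of_nonpos n.cast_nonneg (sub_nonpos.2 ht))
  refine ⟨fun n => (q n).mulTime _ (contDiff_smoothTransition_mul_sub D.T n), fun n j t ht => ?_,
    fun n r hr z => ?_, fun r hr x => ?_⟩
  · exact mul_eq_zero_of_left (hzero n t ht) _
  · rw [ev_mulTime]
    dsimp only
    rcases le_total D.T r with h | h
    · rw [hzero n r h, zero_mul, abs_zero]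
      positivity
    · rw [abs_mul, abs_of_nonneg (Real.smoothTransition.nonneg _)]
      exact (mul_le_of_le_one_left (abs_nonneg _) (Real.smoothTransition.le_one _)).trans
        (hq n r ⟨hr, h⟩ z)
  · simp_rw [ev_mulTime]
    split_ifs with h
    · refine (hqf r ⟨hr, h.le⟩ x).congr' ?_
      have hlim : Tendsto (fun z : ℕ × H => (z.1 : ℝ) * (D.T - r)) (atTop ×ˢ 𝓝 x) atTop :=
        (tendsto_natCast_atTop_atTop.comp tendsto_fst).atTop_mul_const (sub_pos.2 h)
      filter_upwards [hlim.eventually_ge_atTop 1] with z hz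
      rw [Real.smoothTransition.one_of_one_le hz, one_mul]
    · simp_rw [hzero _ r (not_lt.1 h), zero_mul]
      exact tendsto_const_nhds

/-- Correction near the final time: small together with its gradient, its image under the
Ornstein–Uhlenbeck operator concentrates at the final time. -/
theorem exists_corrector
    (hM : 0 ≤ M) (hq : ∀ n, ∀ t ∈ Icc 0 D.T, ∀ x, |(q n).ev (t, x)| ≤ M * (1 + ‖x‖ ^ 2))
    (hqf : ∀ t ∈ Icc 0 D.T, ∀ x, Tendsto (fun z : ℕ × H => (q z.1).ev (t, z.2)) (atTop ×ˢ 𝓝 x)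
      (𝓝 (f t x))) :
    ∃ r : ℕ → D.TrigSum, (∀ n j, (r n).b j D.T = 0) ∧
      (∀ n, ∀ t ∈ Icc 0 D.T, ∀ x, |(r n).ev (t, x)| ≤ 1 / ((n : ℝ) + 1) * (1 + ‖x‖ ^ 2) ∧
        ‖(r n).gr (t, x)‖ ≤ 1 / ((n : ℝ) + 1) * (1 + ‖x‖ ^ 2) ∧
        |(r n).vz (t, x)| ≤ (M + 1) * (1 + ‖x‖ ^ 2)) ∧
      ∀ t ∈ Icc 0 D.T, ∀ x, Tendsto (fun n => (r n).vz (t, x)) atTop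
        (𝓝 (if t < D.T then 0 else -f t x)) := by
  choose W hW0 hW using fun n => (q n).exists_bound
  let m : ℕ → ℝ := fun n => (M + W n + 1) * (n + 1)
  have hm1 : ∀ n : ℕ, (n : ℝ) + 1 ≤ m n := fun n =>
    le_mul_of_one_le_left (by positivity) (by linarith [hW0 n])
  have hm0 : ∀ n : ℕ, 0 < m n := fun n => lt_of_lt_of_le (by positivity) (hm1 n)
  have hmlim : Tendsto m atTop atTop :=
    tendsto_atTop_mono hm1 (tendsto_natCast_atTop_atTop.atTop_add tendsto_const_nhds)
  let ψ : ℕ → ℝ → ℝ := fun n t => (D.T - t) * Real.exp (-(m n * (D.T - t)))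
  have hψ : ∀ n, ContDiff ℝ 1 (ψ n) := fun n => contDiff_sub_mul_exp D.T (m n)
  have hψ' : ∀ n t, deriv (ψ n) t =
      (m n * (D.T - t) - 1) * Real.exp (-(m n * (D.T - t))) := fun n t =>
    deriv_sub_mul_exp D.T (m n) t
  have hsmall : ∀ n, ∀ t ∈ Icc 0 D.T, ∀ (x : H) (a : ℝ), a ≤ M + W n + 1 →
      |ψ n t| * (a * (1 + ‖x‖ ^ 2)) ≤ 1 / ((n : ℝ) + 1) * (1 + ‖x‖ ^ 2) := by
    intro n t ht x a ha
    have h1 : 0 < M + W n + 1 := by linarith [hW0 n]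
    calc |ψ n t| * (a * (1 + ‖x‖ ^ 2))
        ≤ |ψ n t| * ((M + W n + 1) * (1 + ‖x‖ ^ 2)) := by gcongr
      _ ≤ 1 / m n * ((M + W n + 1) * (1 + ‖x‖ ^ 2)) := by
          gcongr
          exact sub_mul_exp_le (hm0 n) ht.2
      _ = 1 / ((n : ℝ) + 1) * (1 + ‖x‖ ^ 2) := by
          dsimp only [m]
          field_simp
  have hvz : ∀ n, ∀ t ∈ Icc 0 D.T, ∀ x, |ψ n t * (q n).vz (t, x)| ≤
      1 / ((n : ℝ) + 1) * (1 + ‖x‖ ^ 2) := fun n t ht x => by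
    rw [abs_mul]
    exact (mul_le_mul_of_nonneg_left (hW n t ht x).2 (abs_nonneg _)).trans
      (hsmall n t ht x _ (by linarith))
  have hn1 : ∀ n : ℕ, 1 / ((n : ℝ) + 1) ≤ 1 := fun n => by
    rw [div_le_one (by positivity)]; linarith [n.cast_nonneg (α := ℝ)]
  refine ⟨fun n => (q n).mulTime (ψ n) (hψ n), fun n j => ?_, fun n t ht x => ⟨?_, ?_, ?_⟩,
    fun t ht x => ?_⟩
  · refine mul_eq_zero_of_left ?_ _
    simp [ψ]
  · rw [ev_mulTime, abs_mul]
    exact (mul_le_mul_of_nonneg_left (hq n t ht x) (abs_nonneg _)).trans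
      (hsmall n t ht x _ (by linarith [hW0 n]))
  · rw [gr_mulTime, norm_smul, Real.norm_eq_abs]
    exact (mul_le_mul_of_nonneg_left (hW n t ht x).1 (abs_nonneg _)).trans
      (hsmall n t ht x _ (by linarith))
  · rw [vz_mulTime]
    refine (abs_add_le _ _).trans ?_
    rw [add_mul]
    refine add_le_add ?_ ((hvz n t ht x).trans (by gcongr; exact hn1 n))
    rw [abs_mul, hψ']
    exact (mul_le_of_le_one_left (abs_nonneg _) (abs_sub_one_mul_exp_le
      (mul_nonneg (hm0 n).le (sub_nonneg.2 ht.2)))).trans (hq n t ht x)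
  · simp_rw [vz_mulTime]
    have h0 : Tendsto (fun n : ℕ => ψ n t * (q n).vz (t, x)) atTop (𝓝 0) := by
      refine squeeze_zero_norm (fun n => hvz n t ht x) ?_
      simpa using (tendsto_one_div_add_atTop_nhds_zero_nat (𝕜 := ℝ)).mul_const (1 + ‖x‖ ^ 2)
    have hqx : Tendsto (fun n => (q n).ev (t, x)) atTop (𝓝 (f t x)) :=
      (hqf t ht x).comp (tendsto_id.prodMk tendsto_const_nhds)
    split_ifs with h
    · have h1 : Tendsto (fun n => deriv (ψ n) t) atTop (𝓝 0) := by
        simp_rw [hψ']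
        exact tendsto_sub_one_mul_exp.comp (hmlim.atTop_mul_const (sub_pos.2 h))
      simpa using (h1.mul hqx).add h0
    · have hT : t = D.T := le_antisymm ht.2 (not_lt.1 h)
      have h1 : ∀ n, deriv (ψ n) t = -1 := fun n => by rw [hψ', hT]; simp
      simp_rw [h1]
      simpa using (hqx.const_mul (-1)).add h0

end TrigSum

/-- Approximation of the resolvent by trigonometric sums. -/
theorem MemCT.exists_trigSum_resolvent (O : D.OUData hyp) (lam : ℝ) {f : ℝ → H → ℝ}
    (hf : D.MemCT f) : ∃ (P : ℕ → D.TrigSum) (c : ℝ), 0 < c ∧ (∀ n j, (P n).b j D.T = 0) ∧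
      (∀ n, ∀ t ∈ Icc 0 D.T, ∀ x,
        |(P n).ev (t, x)| + ‖(P n).gr (t, x)‖ + |(P n).vz (t, x)| ≤ c * (1 + ‖x‖ ^ 2)) ∧
      ∀ t ∈ Icc 0 D.T, ∀ x,
        Tendsto (fun n => (P n).ev (t, x)) atTop (𝓝 (O.Gop lam f (t, x))) ∧
        Tendsto (fun n => (P n).vz (t, x)) atTop (𝓝 (lam * O.Gop lam f (t, x) - f t x)) ∧
        Tendsto (fun z : (ℕ × ℕ) × H => (P z.1.1).gr (t, z.2) - (P z.1.2).gr (t, z.2))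
          ((atTop ×ˢ atTop) ×ˢ 𝓝 x) (𝓝 0) := by
  obtain ⟨M, q, hM, -, hq, hqf⟩ := hf.exists_trigSum
  obtain ⟨p, hpb, hp, hpf⟩ := TrigSum.exists_cutoff hM hq hqf
  obtain ⟨r, hrb, hr, hrf⟩ := TrigSum.exists_corrector hM hq hqf
  obtain ⟨C, hC, hbd⟩ := TrigSum.exists_integral_heat_bound O lam
  have he : ∀ n : ℕ, 0 < 1 / ((n : ℝ) + 1) := fun n => by positivity
  have he1 : ∀ n : ℕ, 1 / ((n : ℝ) + 1) ≤ 1 := fun n => by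
    rw [div_le_one (by positivity)]; linarith [n.cast_nonneg (α := ℝ)]
  have hlim : Tendsto (fun n : ℕ => 1 / ((n : ℝ) + 1)) atTop (𝓝 0) :=
    tendsto_one_div_add_atTop_nhds_zero_nat
  choose N hN using fun n => (p n).exists_riemann lam (he n)
  have hsq : ∀ (n : ℕ) (x : H), 1 / ((n : ℝ) + 1) * (1 + ‖x‖) ^ 2 ≤
      2 * (1 / ((n : ℝ) + 1) * (1 + ‖x‖ ^ 2)) := fun n x => by
    have := mul_le_mul_of_nonneg_left
      (by nlinarith [sq_nonneg (‖x‖ - 1)] : (1 + ‖x‖) ^ 2 ≤ 2 * (1 + ‖x‖ ^ 2)) (he n).le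
    linarith
  let P : ℕ → D.TrigSum := fun n => ((p n).riemann lam (N n)).add (r n)
  have hev : ∀ n, ∀ t ∈ Icc 0 D.T, ∀ x,
      ‖(P n).ev (t, x) - ∫ s in (0 : ℝ)..D.T, ((p n).heat lam s).ev (t, x)‖ ≤
        3 * (1 / ((n : ℝ) + 1) * (1 + ‖x‖ ^ 2)) := fun n t ht x => by
    rw [TrigSum.ev_add, add_sub_right_comm]
    have h1 := (hN n t ht x).1
    have h2 := (hr n t ht x).1
    rw [← Real.norm_eq_abs] at h1 h2
    linarith [norm_add_le_of_le h1 h2, hsq n x]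
  have hgr : ∀ n, ∀ t ∈ Icc 0 D.T, ∀ x,
      ‖(P n).gr (t, x) - ∫ s in (0 : ℝ)..D.T, ((p n).heat lam s).gr (t, x)‖ ≤
        3 * (1 / ((n : ℝ) + 1) * (1 + ‖x‖ ^ 2)) := fun n t ht x => by
    rw [TrigSum.gr_add, add_sub_right_comm]
    linarith [norm_add_le_of_le (hN n t ht x).2.1 (hr n t ht x).2.1, hsq n x]
  have hvz : ∀ n, ∀ t ∈ Icc 0 D.T, ∀ x,
      ‖(P n).vz (t, x) - ((lam * ∫ s in (0 : ℝ)..D.T, ((p n).heat lam s).ev (t, x)) -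
        (p n).ev (t, x) + (r n).vz (t, x))‖ ≤ 2 * (1 / ((n : ℝ) + 1) * (1 + ‖x‖ ^ 2)) :=
    fun n t ht x => by
      rw [TrigSum.vz_add, add_sub_add_right_eq_sub, ← TrigSum.integral_vz_heat _ lam (hpb n) ht.1,
        Real.norm_eq_abs]
      exact (hN n t ht x).2.2.trans (hsq n x)
  have hsmall : ∀ (k : ℝ) (x : H),
      Tendsto (fun n : ℕ => k * (1 / ((n : ℝ) + 1) * (1 + ‖x‖ ^ 2))) atTop (𝓝 0) := fun k x => by
    simpa using (hlim.mul_const (1 + ‖x‖ ^ 2)).const_mul k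
  refine ⟨P, (2 * (C * M) + 6) + (|lam| * (C * M) + M + (M + 1) + 2), by positivity, fun n j => ?_,
    fun n t ht x => ?_, fun t ht x => ?_⟩
  · rcases j with j | j
    exacts [(p n).b_riemann_eq_zero lam (hpb n) _ j, hrb n j]
  · obtain ⟨hI1, hI2⟩ := hbd (p n) M hM (hp n) t ht.1 x
    have h1 := norm_le_norm_add_norm_sub' ((P n).ev (t, x))
      (∫ s in (0 : ℝ)..D.T, ((p n).heat lam s).ev (t, x))
    have h2 := norm_le_norm_add_norm_sub' ((P n).gr (t, x))
      (∫ s in (0 : ℝ)..D.T, ((p n).heat lam s).gr (t, x))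
    have h3 := norm_le_norm_add_norm_sub' ((P n).vz (t, x))
      ((lam * ∫ s in (0 : ℝ)..D.T, ((p n).heat lam s).ev (t, x)) - (p n).ev (t, x) +
        (r n).vz (t, x))
    have h4 : ‖(lam * ∫ s in (0 : ℝ)..D.T, ((p n).heat lam s).ev (t, x)) - (p n).ev (t, x) +
        (r n).vz (t, x)‖ ≤ |lam| * (C * M * (1 + ‖x‖ ^ 2)) + M * (1 + ‖x‖ ^ 2) +
          (M + 1) * (1 + ‖x‖ ^ 2) := by
      refine norm_add_le_of_le (norm_sub_le_of_le ?_ (hp n t ht.1 x)) (hr n t ht x).2.2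
      rw [norm_mul, Real.norm_eq_abs, Real.norm_eq_abs]
      gcongr
    have h5 : 1 / ((n : ℝ) + 1) * (1 + ‖x‖ ^ 2) ≤ 1 + ‖x‖ ^ 2 :=
      mul_le_of_le_one_left (by positivity) (he1 n)
    have h6 := hev n t ht x
    have h7 := hgr n t ht x
    have h8 := hvz n t ht x
    rw [← Real.norm_eq_abs] at hI1
    rw [← Real.norm_eq_abs, ← Real.norm_eq_abs]
    linarith
  · have hJ := TrigSum.tendsto_integral_ev_heat O lam hM hp hpf ht x
    rw [← O.Gop_eq lam f ht x] at hJ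
    have hpx : Tendsto (fun n => (p n).ev (t, x)) atTop (𝓝 (if t < D.T then f t x else 0)) :=
      (hpf t ht.1 x).comp (tendsto_id.prodMk tendsto_const_nhds)
    refine ⟨?_, ?_, ?_⟩
    · have := (squeeze_zero_norm (fun n => hev n t ht x) (hsmall 3 x)).add hJ
      simpa using this
    · have := (squeeze_zero_norm (fun n => hvz n t ht x) (hsmall 2 x)).add
        (((hJ.const_mul lam).sub hpx).add (hrf t ht x))
      convert this using 2
      · ring
      · split_ifs <;> ring
    · have hX : Tendsto (fun z : (ℕ × ℕ) × H => 1 + ‖z.2‖ ^ 2) ((atTop ×ˢ atTop) ×ˢ 𝓝 x)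
          (𝓝 (1 + ‖x‖ ^ 2)) :=
        ((continuous_const.add (continuous_norm.pow 2)).tendsto x).comp tendsto_snd
      have hz1 : Tendsto (fun z : (ℕ × ℕ) × H =>
          (P z.1.1).gr (t, z.2) - ∫ s in (0 : ℝ)..D.T, ((p z.1.1).heat lam s).gr (t, z.2))
          ((atTop ×ˢ atTop) ×ˢ 𝓝 x) (𝓝 0) := by
        refine squeeze_zero_norm (fun z => hgr z.1.1 t ht z.2) ?_
        simpa using ((hlim.comp (tendsto_fst.comp tendsto_fst)).mul hX).const_mul 3
      have hz2 : Tendsto (fun z : (ℕ × ℕ) × H =>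
          (P z.1.2).gr (t, z.2) - ∫ s in (0 : ℝ)..D.T, ((p z.1.2).heat lam s).gr (t, z.2))
          ((atTop ×ˢ atTop) ×ˢ 𝓝 x) (𝓝 0) := by
        refine squeeze_zero_norm (fun z => hgr z.1.2 t ht z.2) ?_
        simpa using ((hlim.comp (tendsto_snd.comp tendsto_fst)).mul hX).const_mul 3
      have := (hz1.sub hz2).add (TrigSum.tendsto_integral_gr_heat_sub O lam hM hp hpf ht x)
      rw [sub_zero, add_zero] at this
      refine this.congr fun z => ?_
      abel

end FPData

end ResolventApproximation

section Theorems

open MeasureTheory Set Filter Topology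
open scoped InnerProductSpace ENNReal NNReal

variable {H : Type} [NormedAddCommGroup H] [InnerProductSpace ℝ H] [CompleteSpace H]
  [SecondCountableTopology H] [MeasurableSpace H] [BorelSpace H]

/-- Corollary 3.4: approximation of `u ∈ D(V)` by elements of `E_A`
together with the spatial gradients. -/
theorem statement15 (D : FPData H) (hyp : D.Hyp31) (O : D.OUData hyp)
    (ν : Measure (ℝ × H)) [IsFiniteMeasure ν]
    (hconc : ν {p : ℝ × H | p.1 ∉ Icc 0 D.T} = 0)
    (u : ℝ × H → ℝ) (lam : ℝ) (f : ℝ → H → ℝ) (hf : D.MemCT f)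
    (hu : ∀ p : ℝ × H, u p = O.Gop lam f p) :
    (∀ t ∈ Icc 0 D.T, ∀ x : H, DifferentiableAt ℝ (fun y => u (t, y)) x) ∧
    ∃ (un : ℕ → ℝ × H → ℝ) (c : ℝ), 0 < c ∧ (∀ n, un n ∈ D.EA) ∧
      (∀ n, ∀ p : ℝ × H, p.1 ∈ Icc 0 D.T →
        |un n p| + ‖xGrad (un n) p‖ + |D.Vzero (un n) p| ≤ c * (1 + ‖p.2‖ ^ 2)) ∧
      TendstoInMeasure ν un atTop u ∧
      TendstoInMeasure ν (fun n => xGrad (un n)) atTop (xGrad u) ∧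
      TendstoInMeasure ν (fun n => D.Vzero (un n)) atTop
        (fun p => lam * u p - f p.1 p.2) := by
  obtain ⟨P, c, hc, hb, hbound, hlim⟩ := hf.exists_trigSum_resolvent O lam
  have hgrad : ∀ t ∈ Icc 0 D.T, ∃ G : H → H, ∀ x, HasGradientAt (fun y => u (t, y)) (G x) x ∧
      Tendsto (fun n => (P n).gr (t, x)) atTop (𝓝 (G x)) := fun t ht =>
    exists_hasGradientAt_of_cauchy (fun n x => (P n).hasGradientAt_ev t x)
      (fun x => by rw [hu]; exact (hlim t ht x).1) fun x => (hlim t ht x).2.2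
  have hx : ∀ n, xGrad (P n).ev = (P n).gr := fun n => funext (P n).xGrad_ev
  have hv : ∀ n, D.Vzero (P n).ev = (P n).vz := fun n => funext (P n).Vzero_ev
  have hae : ∀ᵐ p ∂ν, p.1 ∈ Icc 0 D.T := hconc
  refine ⟨fun t ht x => ?_, fun n => (P n).ev, c, hc, fun n => (P n).ev_mem_EA (hb n),
    fun n p hp => ?_, ?_, ?_, ?_⟩
  · obtain ⟨G, hG⟩ := hgrad t ht
    exact (hG x).1.differentiableAt
  · rw [hx, hv]
    exact hbound n p.1 hp p.2
  · refine tendstoInMeasure_of_tendsto_ae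
      (fun n => (P n).ev_continuous.aestronglyMeasurable) ?_
    filter_upwards [hae] with p hp
    rw [hu]
    exact (hlim p.1 hp p.2).1
  · simp_rw [hx]
    refine tendstoInMeasure_of_tendsto_ae
      (fun n => (P n).gr_continuous.aestronglyMeasurable) ?_
    filter_upwards [hae] with p hp
    obtain ⟨G, hG⟩ := hgrad p.1 hp
    rw [xGrad, (hG p.2).1.gradient]
    exact (hG p.2).2
  · simp_rw [hv]
    refine tendstoInMeasure_of_tendsto_ae
      (fun n => (P n).vz_continuous.aestronglyMeasurable) ?_
    filter_upwards [hae] with p hp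
    rw [hu]
    exact (hlim p.1 hp p.2).2.1

end Theorems
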